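/- arXiv:1505.02280 — 2 statements merged into one kernel-verified Lean document; each statement's English description precedes it below -/
import Mathlib

section
/- Let G be a finite abelian group, G_1, ..., G_s subgroups of G, and Φ_1, ..., Φ_t : G_1 × ... × G_s → G group homomorphisms. For every ε > 0 there exists δ = δ(ε, t) > 0 such that for every S ⊆ G with |S| ≥ ε|G|, the number of tuples (x, x_1,...,x_s) ∈ G × G_1 × ... × G_s with x + Φ_j(x_1,...,x_s) ∈ S for all j = 1,...,t is at least δ times the total number of such tuples (x, x_1,...,x_s) ∈ G × G_1 × ... × G_s (which is |G|·|G_1|···|G_s|). -/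
namespace HomotheticConfigurations

open MeasureTheory Filter Set Topology
open scoped ENNReal

section Loeb

variable {Y : ℕ → Type}

/-- The subset of the product `∀ n, Y n` determined by a sequence of subsets `A n ⊆ Y n`
and a fixed nonprincipal ultrafilter on `ℕ`. -/
def internal (A : ∀ n, Set (Y n)) : Set (∀ n, Y n) :=
  {x | ∀ᶠ n in (hyperfilter ℕ : Filter ℕ), x n ∈ A n}

lemma internal_inter (A B : ∀ n, Set (Y n)) :
    internal A ∩ internal B = internal fun n ↦ A n ∩ B n := by
  ext x
  simp [internal, Filter.eventually_and]

lemma internal_compl (A : ∀ n, Set (Y n)) : (internal A)ᶜ = internal fun n ↦ (A n)ᶜ := by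
  ext x
  exact Ultrafilter.eventually_not.symm

lemma internal_union (A B : ∀ n, Set (Y n)) :
    internal A ∪ internal B = internal fun n ↦ A n ∪ B n := by
  ext x
  simp [internal, Ultrafilter.eventually_or]

lemma internal_empty : internal (fun n ↦ (∅ : Set (Y n))) = ∅ := by
  ext x
  simp [internal, (hyperfilter ℕ).neBot.ne]

lemma internal_univ : internal (fun n ↦ (univ : Set (Y n))) = univ := by
  ext x
  simp [internal]

lemma internal_iInter {κ : Type*} [Finite κ] (A : κ → ∀ n, Set (Y n)) :
    ⋂ k, internal (A k) = internal fun n ↦ ⋂ k, A k n := by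
  ext x
  simp [internal, Filter.eventually_all]

lemma eventually_subset_of_internal_subset [∀ n, Nonempty (Y n)] {A B : ∀ n, Set (Y n)}
    (h : internal A ⊆ internal B) : ∀ᶠ n in (hyperfilter ℕ : Filter ℕ), A n ⊆ B n := by
  by_contra hc
  rw [← Ultrafilter.eventually_not] at hc
  have hx : ∀ n, ∃ y : Y n, ¬ A n ⊆ B n → y ∈ A n ∧ y ∉ B n := fun n ↦ by
    by_cases hn : A n ⊆ B n
    · exact ⟨Classical.arbitrary _, fun h ↦ absurd hn h⟩
    · obtain ⟨y, hy⟩ := Set.not_subset.1 hn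
      exact ⟨y, fun _ ↦ hy⟩
  choose x hx using hx
  have h1 : x ∈ internal A := hc.mono fun n hn ↦ (hx n hn).1
  obtain ⟨n, hn, hn'⟩ := (hc.and (h h1)).exists
  exact (hx n hn).2 hn'

lemma eventually_eq_of_internal_eq [∀ n, Nonempty (Y n)] {A B : ∀ n, Set (Y n)}
    (h : internal A = internal B) : ∀ᶠ n in (hyperfilter ℕ : Filter ℕ), A n = B n := by
  filter_upwards [eventually_subset_of_internal_subset h.subset,
    eventually_subset_of_internal_subset h.superset] with n h1 h2 using h1.antisymm h2

/-- Countable saturation. -/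
lemma exists_internal_eq_empty [∀ n, Nonempty (Y n)] {A : ℕ → ∀ n, Set (Y n)}
    (hA : Antitone fun i ↦ internal (A i)) (h : ⋂ i, internal (A i) = ∅) :
    ∃ i, internal (A i) = ∅ := by
  classical
  by_contra! hne
  let B : ℕ → ∀ n, Set (Y n) := fun i n ↦ ⋂ j ∈ Iic i, A j n
  have hB : ∀ i, ∀ᶠ n in (hyperfilter ℕ : Filter ℕ), (B i n).Nonempty := fun i ↦ by
    obtain ⟨x, hx⟩ := hne i
    have : ∀ᶠ n in (hyperfilter ℕ : Filter ℕ), ∀ j ∈ Iic i, x n ∈ A j n :=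
      (finite_Iic i).eventually_all.2 fun j hj ↦ hA hj hx
    exact this.mono fun n hn ↦ ⟨x n, by simpa [B] using hn⟩
  have hx : ∀ n, ∃ y : Y n, ∀ i ≤ n, (B i n).Nonempty → y ∈ B i n := fun n ↦ by
    by_cases hP : ∃ i ≤ n, (B i n).Nonempty
    · obtain ⟨i₁, hi₁, hP₁⟩ := hP
      obtain ⟨y, hy⟩ := Nat.findGreatest_spec (P := fun i ↦ (B i n).Nonempty) hi₁ hP₁
      refine ⟨y, fun i hi hne ↦ ?_⟩
      have hle : i ≤ Nat.findGreatest (fun i ↦ (B i n).Nonempty) n :=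
        Nat.le_findGreatest hi hne
      simp only [B, mem_iInter, mem_Iic] at hy ⊢
      exact fun j hj ↦ hy j (hj.trans hle)
    · exact ⟨Classical.arbitrary _, fun i hi hne ↦ absurd ⟨i, hi, hne⟩ hP⟩
  choose x hx using hx
  have : x ∈ ⋂ i, internal (A i) := by
    refine mem_iInter.2 fun i ↦ ?_
    have hge : ∀ᶠ n in (hyperfilter ℕ : Filter ℕ), i ≤ n :=
      (Nat.hyperfilter_le_atTop) (eventually_ge_atTop i)
    filter_upwards [hB i, hge] with n h1 h2
    have := hx n i h2 h1
    simp only [B, mem_iInter, mem_Iic] at this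
    exact this i le_rfl
  simp [h] at this

/-- The proportion of elements of a finite type lying in `A`. -/
noncomputable def density {T : Type} (A : Set T) : ℝ := A.ncard / Nat.card T

lemma density_nonneg {T : Type} (A : Set T) : 0 ≤ density A := by
  unfold density; positivity

lemma density_univ (T : Type) [Finite T] [Nonempty T] : density (univ : Set T) = 1 := by
  have : (Nat.card T : ℝ) ≠ 0 := by exact_mod_cast Nat.card_pos.ne'
  simp [density, ncard_univ, this]

lemma density_empty (T : Type) : density (∅ : Set T) = 0 := by simp [density]

lemma density_union {T : Type} [Finite T] {A B : Set T} (h : Disjoint A B) :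
    density (A ∪ B) = density A + density B := by
  simp [density, ncard_union_eq h, add_div]

variable (Y) in
/-- The algebra of all internal sets. -/
def internalSets : Set (Set (∀ n, Y n)) := range internal

lemma isSetAlgebra_internalSets : IsSetAlgebra (internalSets Y) where
  empty_mem := ⟨_, internal_empty⟩
  compl_mem := by
    rintro _ ⟨A, rfl⟩
    exact ⟨_, (internal_compl A).symm⟩
  union_mem := by
    rintro _ _ ⟨A, rfl⟩ ⟨B, rfl⟩
    exact ⟨_, (internal_union A B).symm⟩

/-- The limit of the densities of a sequence of sets defining `s`. -/
noncomputable def loebContent (s : Set (∀ n, Y n)) : ℝ≥0∞ :=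
  limUnder (hyperfilter ℕ : Filter ℕ)
    fun n ↦ ENNReal.ofReal (density (Classical.epsilon (fun A ↦ internal A = s) n))

lemma tendsto_loebContent [∀ n, Nonempty (Y n)] (A : ∀ n, Set (Y n)) :
    Tendsto (fun n ↦ ENNReal.ofReal (density (A n))) (hyperfilter ℕ : Filter ℕ)
      (𝓝 (loebContent (internal A))) := by
  have h := Classical.epsilon_spec (p := fun B ↦ internal B = internal A) ⟨A, rfl⟩
  have hlim : ∃ L : ℝ≥0∞, Tendsto (fun n ↦ ENNReal.ofReal
      (density (Classical.epsilon (fun B ↦ internal B = internal A) n)))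
      (hyperfilter ℕ : Filter ℕ) (𝓝 L) := by
    obtain ⟨L, -, hL⟩ := isCompact_univ.ultrafilter_le_nhds ((hyperfilter ℕ).map fun n ↦
      ENNReal.ofReal (density (Classical.epsilon (fun B ↦ internal B = internal A) n)))
      (by simp)
    exact ⟨L, hL⟩
  refine (tendsto_nhds_limUnder hlim).congr' ?_
  filter_upwards [eventually_eq_of_internal_eq h] with n hn
  rw [hn]

variable (Y) in
/-- The σ-algebra generated by the internal sets. -/
abbrev loebSpace : MeasurableSpace (∀ n, Y n) := MeasurableSpace.generateFrom (internalSets Y)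

/-- Existence of the Loeb measure of a sequence of finite uniform probability spaces. -/
theorem exists_loebMeasure [∀ n, Finite (Y n)] [∀ n, Nonempty (Y n)] :
    ∃ μ : @Measure (∀ n, Y n) (loebSpace Y), IsProbabilityMeasure μ ∧
      ∀ A : ∀ n, Set (Y n), Tendsto (fun n ↦ density (A n)) (hyperfilter ℕ : Filter ℕ)
        (𝓝 (μ.real (internal A))) := by
  have hempty : loebContent (∅ : Set (∀ n, Y n)) = 0 := by
    have := tendsto_loebContent fun n ↦ (∅ : Set (Y n))
    simp only [density_empty, internal_empty, ENNReal.ofReal_zero] at this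
    exact tendsto_nhds_unique this tendsto_const_nhds
  have hone : loebContent (univ : Set (∀ n, Y n)) = 1 := by
    have := tendsto_loebContent fun n ↦ (univ : Set (Y n))
    simp only [density_univ, internal_univ, ENNReal.ofReal_one] at this
    exact tendsto_nhds_unique this tendsto_const_nhds
  have hC := (isSetAlgebra_internalSets (Y := Y)).isSetRing
  let m : AddContent ℝ≥0∞ (internalSets Y) := hC.addContent_of_union loebContent hempty <| by
    rintro _ _ ⟨A, rfl⟩ ⟨B, rfl⟩ hAB
    rw [internal_union]
    refine tendsto_nhds_unique (tendsto_loebContent _)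
      (((tendsto_loebContent A).add (tendsto_loebContent B)).congr' ?_)
    have : internal (fun n ↦ A n ∩ B n) = internal fun n ↦ (∅ : Set (Y n)) := by
      rw [← internal_inter, hAB.inter_eq, internal_empty]
    filter_upwards [eventually_eq_of_internal_eq this] with n hn
    rw [density_union (disjoint_iff_inter_eq_empty.2 hn),
      ENNReal.ofReal_add (density_nonneg _) (density_nonneg _)]
  have hm : ∀ s, m s = loebContent s := fun s ↦ rfl
  have hne : ∀ s ∈ internalSets Y, m s ≠ ∞ := fun s hs ↦ by
    refine ne_top_of_le_ne_top ?_ (addContent_mono (m := m) hC.isSetSemiring hs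
      isSetAlgebra_internalSets.univ_mem (subset_univ s))
    simp [hm, hone]
  have hsub : m.IsSigmaSubadditive := by
    refine isSigmaSubadditive_of_addContent_iUnion_eq_tsum hC fun f hf hU hd ↦
      addContent_iUnion_eq_sum_of_tendsto_zero hC m hne (fun s hs hanti hs0 ↦ ?_) hf hU hd
    choose A hA using hs
    obtain rfl : (fun i ↦ internal (A i)) = s := funext hA
    obtain ⟨i, hi⟩ := exists_internal_eq_empty hanti hs0
    refine tendsto_const_nhds.congr' ?_
    filter_upwards [eventually_ge_atTop i] with j hj
    have hj0 : internal (A j) = ∅ := subset_eq_empty (hanti hj) hi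
    simp only [hm, hj0, hempty]
  let := loebSpace Y
  refine ⟨m.measure hC.isSetSemiring le_rfl hsub, ?_⟩
  have key : ∀ A : ∀ n, Set (Y n), m.measure hC.isSetSemiring le_rfl hsub (internal A) =
      loebContent (internal A) := fun A ↦
    m.measure_eq hC.isSetSemiring rfl hsub ⟨A, rfl⟩
  refine ⟨⟨by rw [← internal_univ, key, internal_univ, hone]⟩, fun A ↦ ?_⟩
  have := (ENNReal.tendsto_toReal (hne _ ⟨A, rfl⟩)).comp (tendsto_loebContent A)
  rw [measureReal_def, key]
  exact this.congr fun n ↦ ENNReal.toReal_ofReal (density_nonneg _)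

end Loeb

section Removal

/-- `A` is conditionally independent of `m₁` given `m`. -/
def CondIndepOf {X : Type*} (m m₁ : MeasurableSpace X) {m₀ : MeasurableSpace X} (μ : Measure X)
    (A : Set X) : Prop :=
  ∀ W, MeasurableSet[m₁] W →
    μ.real (A ∩ W) = ∫ x in W, (μ[A.indicator fun _ ↦ (1 : ℝ)|m]) x ∂μ

variable {X : Type*} {m n m₁ : MeasurableSpace X} [m₀ : MeasurableSpace X] {μ : Measure X}

lemma integral_indicator_one_mul {A : Set X} (hA : MeasurableSet A) (g : X → ℝ) :
    ∫ x, A.indicator (fun _ ↦ (1 : ℝ)) x * g x ∂μ = ∫ x in A, g x ∂μ := by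
  rw [← integral_indicator hA]
  congr with x
  by_cases hx : x ∈ A <;> simp [hx]

lemma integrable_indicator_one_mul {A : Set X} (hA : MeasurableSet A) {g : X → ℝ}
    (hg : Integrable g μ) : Integrable ((A.indicator fun _ ↦ (1 : ℝ)) * g) μ := by
  refine (hg.indicator hA).congr (ae_of_all _ fun x ↦ ?_)
  by_cases hx : x ∈ A <;> simp [hx]

lemma setIntegral_indicator_one {A W : Set X} (hA : MeasurableSet A) :
    ∫ x in W, A.indicator (fun _ ↦ (1 : ℝ)) x ∂μ = μ.real (A ∩ W) := by
  rw [setIntegral_indicator hA, setIntegral_const, smul_eq_mul, mul_one, inter_comm]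

variable [IsProbabilityMeasure μ]

lemma integrable_indicator_one {A : Set X} (hA : MeasurableSet A) :
    Integrable (A.indicator fun _ ↦ (1 : ℝ)) μ :=
  (integrable_const 1).indicator hA

lemma integral_condExp_mul (hm : m ≤ m₀) {f g : X → ℝ}
    (hf : Integrable f μ) (hg : StronglyMeasurable[m] g) (hfg : Integrable (f * g) μ) :
    ∫ x, (μ[f|m]) x * g x ∂μ = ∫ x, f x * g x ∂μ := by
  have h := condExp_mul_of_stronglyMeasurable_right hg hfg hf
  calc ∫ x, (μ[f|m]) x * g x ∂μ = ∫ x, (μ[f * g|m]) x ∂μ := integral_congr_ae h.symm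
    _ = _ := integral_condExp hm

lemma setIntegral_condExp_comm (hm : m ≤ m₀) {A B : Set X}
    (hA : MeasurableSet A) (hB : MeasurableSet B) :
    ∫ x in A, (μ[B.indicator fun _ ↦ (1 : ℝ)|m]) x ∂μ =
      ∫ x in B, (μ[A.indicator fun _ ↦ (1 : ℝ)|m]) x ∂μ := by
  have key : ∀ {A B : Set X}, MeasurableSet A → MeasurableSet B →
      ∫ x in A, (μ[B.indicator fun _ ↦ (1 : ℝ)|m]) x ∂μ =
        ∫ x, (μ[A.indicator fun _ ↦ (1 : ℝ)|m]) x * (μ[B.indicator fun _ ↦ (1 : ℝ)|m]) x ∂μ :=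
    fun {A B} hA hB ↦ by
      rw [integral_condExp_mul hm (integrable_indicator_one hA) stronglyMeasurable_condExp
        (integrable_indicator_one_mul hA integrable_condExp), integral_indicator_one_mul hA]
  rw [key hA hB, key hB hA]
  simp_rw [mul_comm]

lemma CondIndepOf.mono (hmn : m ≤ n) (hn : n ≤ m₁) (h₁ : m₁ ≤ m₀)
    {A : Set X} (hA : MeasurableSet A) (h : CondIndepOf m m₁ μ A) : CondIndepOf n m₁ μ A := by
  have : μ[A.indicator fun _ ↦ (1 : ℝ)|m] =ᵐ[μ] μ[A.indicator fun _ ↦ (1 : ℝ)|n] := by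
    refine ae_eq_condExp_of_forall_setIntegral_eq (hn.trans h₁) (integrable_indicator_one hA)
      (fun s _ _ ↦ integrable_condExp.integrableOn) (fun s hs _ ↦ ?_)
      (stronglyMeasurable_condExp.mono hmn).aestronglyMeasurable
    rw [← h s (hn s hs), setIntegral_indicator_one hA]
  intro W hW
  rw [h W hW]
  exact integral_congr_ae (ae_restrict_of_ae this)

/-- Conditional independence extends to the σ-algebra generated by `m` and an algebra of
conditionally independent sets. -/
lemma CondIndepOf.sup_generateFrom (hm : m ≤ m₁) (h₁ : m₁ ≤ m₀)
    {𝒬 : Set (Set X)} (h𝒬 : IsSetAlgebra 𝒬) (hmeas : ∀ Q ∈ 𝒬, MeasurableSet Q)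
    (h : ∀ Q ∈ 𝒬, CondIndepOf m m₁ μ Q) {A : Set X}
    (hA : MeasurableSet[m ⊔ MeasurableSpace.generateFrom 𝒬] A) : CondIndepOf m m₁ μ A := by
  have hsup : m ⊔ MeasurableSpace.generateFrom 𝒬 ≤ m₀ :=
    sup_le (hm.trans h₁) (MeasurableSpace.generateFrom_le hmeas)
  let P : Set (Set X) := {s | ∃ Q ∈ 𝒬, ∃ L, MeasurableSet[m] L ∧ s = Q ∩ L}
  have hP : m ⊔ MeasurableSpace.generateFrom 𝒬 = MeasurableSpace.generateFrom P := by
    refine le_antisymm (sup_le (fun s hs ↦ ?_) ?_) (MeasurableSpace.generateFrom_le ?_)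
    · exact MeasurableSpace.measurableSet_generateFrom
        ⟨univ, h𝒬.univ_mem, s, hs, (univ_inter s).symm⟩
    · exact MeasurableSpace.generateFrom_mono fun Q hQ ↦
        ⟨Q, hQ, univ, MeasurableSet.univ, (inter_univ Q).symm⟩
    · rintro _ ⟨Q, hQ, L, hL, rfl⟩
      exact MeasurableSet.inter
        ((le_sup_right : _ ≤ m ⊔ MeasurableSpace.generateFrom 𝒬) _
          (MeasurableSpace.measurableSet_generateFrom hQ))
        ((le_sup_left : m ≤ m ⊔ MeasurableSpace.generateFrom 𝒬) _ hL)
  have hpi : IsPiSystem P := by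
    rintro _ ⟨Q, hQ, L, hL, rfl⟩ _ ⟨Q', hQ', L', hL', rfl⟩ -
    exact ⟨Q ∩ Q', h𝒬.inter_mem hQ hQ', L ∩ L', hL.inter hL', inter_inter_inter_comm ..⟩
  intro W hW
  have hW₀ := h₁ W hW
  set w := μ[W.indicator fun _ ↦ (1 : ℝ)|m] with hw
  have key : ∀ A, MeasurableSet[m ⊔ MeasurableSpace.generateFrom 𝒬] A →
      ∫ x in A, W.indicator (fun _ ↦ (1 : ℝ)) x ∂μ = ∫ x in A, w x ∂μ := by
    intro A hA
    have hWi : Integrable (W.indicator fun _ ↦ (1 : ℝ)) μ := integrable_indicator_one hW₀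
    have hwi : Integrable w μ := integrable_condExp
    have huniv : ∫ x, W.indicator (fun _ ↦ (1 : ℝ)) x ∂μ = ∫ x, w x ∂μ :=
      (integral_condExp (hm.trans h₁)).symm
    induction A, hA using MeasurableSpace.induction_on_inter hP hpi with
    | empty => simp
    | basic t ht =>
      obtain ⟨Q, hQ, L, hL, rfl⟩ := ht
      have hQ₀ := hmeas Q hQ
      have hL₀ := h₁ _ (hm L hL)
      have e1 : ∫ x in Q ∩ L, w x ∂μ = ∫ x in Q, L.indicator w x ∂μ := by
        rw [setIntegral_indicator hL₀]
      have e2 : L.indicator w =ᵐ[μ] μ[(W ∩ L).indicator fun _ ↦ (1 : ℝ)|m] := by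
        have := (condExp_indicator (m := m) hWi hL).symm
        rwa [indicator_indicator, inter_comm L W] at this
      rw [e1, integral_congr_ae (ae_restrict_of_ae e2),
        setIntegral_condExp_comm (hm.trans h₁) hQ₀ (hW₀.inter hL₀),
        ← h Q hQ _ (hW.inter (hm L hL)), setIntegral_indicator_one hW₀]
      congr 1
      ext x
      simp only [mem_inter_iff]
      tauto
    | compl t ht ih =>
      rw [setIntegral_compl (hsup t ht) hWi, setIntegral_compl (hsup t ht) hwi, ih, huniv]
    | iUnion f hd hf ih =>
      rw [integral_iUnion (fun i ↦ hsup _ (hf i)) hd hWi.integrableOn,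
        integral_iUnion (fun i ↦ hsup _ (hf i)) hd hwi.integrableOn]
      exact tsum_congr ih
  rw [← setIntegral_condExp_comm (hm.trans h₁) (hsup A hA) hW₀, ← key A hA,
    setIntegral_indicator_one hW₀, inter_comm]

/-- A set of points at which the conditional density of `B` is small compared with that of `Q`. -/
lemma exists_relatively_sparse (hm : m ≤ m₁) (h₁ : m₁ ≤ m₀)
    {Q B : Set X} (hQ : CondIndepOf m m₁ μ Q) (hB : CondIndepOf m m₁ μ B) (c : ℝ) :
    ∃ G, MeasurableSet[m] G ∧ c * μ.real (Q ∩ Gᶜ) ≤ μ.real B ∧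
      ∀ W, MeasurableSet[m₁] W → W ⊆ G → μ W ≠ 0 → μ.real (B ∩ W) < c * μ.real (Q ∩ W) := by
  set q := μ[Q.indicator fun _ ↦ (1 : ℝ)|m]
  set b := μ[B.indicator fun _ ↦ (1 : ℝ)|m]
  have hq : StronglyMeasurable[m] q := stronglyMeasurable_condExp
  have hb : StronglyMeasurable[m] b := stronglyMeasurable_condExp
  have hqi : Integrable q μ := integrable_condExp
  have hbi : Integrable b μ := integrable_condExp
  have hG : MeasurableSet[m] {x | b x < c * q x} :=
    hb.measurableSet_lt (hq.const_mul c)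
  refine ⟨_, hG, ?_, fun W hW hWG hW0 ↦ ?_⟩
  · refine le_trans ?_ (measureReal_mono (inter_subset_left (s := B) (t := {x | b x < c * q x}ᶜ)))
    rw [hQ _ (hm _ hG.compl), hB _ (hm _ hG.compl), ← integral_const_mul]
    exact setIntegral_mono_on (hqi.const_mul c).integrableOn hbi.integrableOn
      (h₁ _ (hm _ hG.compl)) fun x hx ↦ not_lt.1 hx
  · rw [hQ W hW, hB W hW, ← integral_const_mul, ← sub_pos,
      ← integral_sub (hqi.const_mul c).integrableOn hbi.integrableOn]
    rw [setIntegral_pos_iff_support_of_nonneg_ae]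
    · refine (pos_iff_ne_zero.2 hW0).trans_le (measure_mono fun x hx ↦ ⟨?_, hx⟩)
      exact (sub_pos.2 (hWG hx)).ne'
    · exact (ae_restrict_iff' (h₁ _ hW)).2 (ae_of_all _ fun x hx ↦ (sub_pos.2 (hWG hx)).le)
    · exact ((hqi.const_mul c).sub hbi).integrableOn

lemma exists_mem_generateSetAlgebra_approx {C : Set (Set X)} (hC : ∀ s ∈ C, MeasurableSet s)
    {F : Set X} (hF : MeasurableSet[MeasurableSpace.generateFrom C] F) {ρ : ℝ} (hρ : 0 < ρ) :
    ∃ K ∈ generateSetAlgebra C, μ.real (F \ K) ≤ ρ ∧ μ.real (K \ F) ≤ ρ := by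
  have hle : MeasurableSpace.generateFrom C ≤ m₀ := MeasurableSpace.generateFrom_le hC
  obtain ⟨K, hK, h⟩ := @Measure.MeasureDense.approx X (MeasurableSpace.generateFrom C) _ _
    (@Measure.MeasureDense.of_generateFrom_isSetAlgebra_finite X
      (MeasurableSpace.generateFrom C) (μ.trim hle) _ inferInstance isSetAlgebra_generateSetAlgebra
      generateFrom_generateSetAlgebra_eq.symm) F hF (measure_ne_top _ _) ρ hρ
  have hKm : MeasurableSet[MeasurableSpace.generateFrom C] K := by
    rw [← generateFrom_generateSetAlgebra_eq]
    exact MeasurableSpace.measurableSet_generateFrom hK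
  rw [trim_measurableSet_eq hle (hF.symmDiff hKm)] at h
  have h' : μ.real (symmDiff F K) ≤ ρ := ENNReal.toReal_le_of_le_ofReal hρ.le h.le
  exact ⟨K, hK, (measureReal_mono fun x hx ↦ Or.inl hx).trans h',
    (measureReal_mono fun x hx ↦ Or.inr hx).trans h'⟩

end Removal

section Decomposition

variable {X : Type*}

lemma exists_fiber_decomposition {𝒬 C : Set (Set X)} (h𝒬 : IsSetAlgebra 𝒬) {A : Set X}
    (hA : A ∈ generateSetAlgebra (𝒬 ∪ C)) :
    ∃ (κ : Type) (_ : Finite κ) (f : X → κ) (L : κ → Set X), (∀ k, f ⁻¹' {k} ∈ 𝒬) ∧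
      (∀ k, L k ∈ generateSetAlgebra C) ∧ A = {x | x ∈ L (f x)} := by
  have hC : IsSetAlgebra (generateSetAlgebra C) := isSetAlgebra_generateSetAlgebra
  induction hA with
  | base s hs =>
    rcases hs with hs | hs
    · refine ⟨Prop, inferInstance, (· ∈ s), fun p ↦ {_x | p}, fun p ↦ ?_, fun p ↦ ?_, rfl⟩
      · by_cases hp : p
        · convert hs using 1
          ext x
          simp [hp]
        · convert h𝒬.compl_mem hs using 1
          ext x
          simp [hp]
      · by_cases hp : p
        · simpa [hp] using hC.univ_mem
        · simpa [hp] using hC.empty_mem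
    · refine ⟨Unit, inferInstance, fun _ ↦ (), fun _ ↦ s, fun _ ↦ ?_,
        fun _ ↦ self_subset_generateSetAlgebra hs, rfl⟩
      simpa using h𝒬.univ_mem
  | empty =>
    refine ⟨Unit, inferInstance, fun _ ↦ (), fun _ ↦ ∅, fun _ ↦ ?_, fun _ ↦ hC.empty_mem, rfl⟩
    simpa using h𝒬.univ_mem
  | compl s hs ih =>
    obtain ⟨κ, hκ, f, L, hf, hL, rfl⟩ := ih
    exact ⟨κ, hκ, f, fun k ↦ (L k)ᶜ, hf, fun k ↦ hC.compl_mem (hL k), rfl⟩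
  | union s t hs ht ihs iht =>
    obtain ⟨κ, hκ, f, L, hf, hL, rfl⟩ := ihs
    obtain ⟨κ', hκ', f', L', hf', hL', rfl⟩ := iht
    refine ⟨κ × κ', inferInstance, fun x ↦ (f x, f' x), fun k ↦ L k.1 ∪ L' k.2, fun k ↦ ?_,
      fun k ↦ hC.union_mem (hL _) (hL' _), rfl⟩
    convert h𝒬.inter_mem (hf k.1) (hf' k.2) using 1
    ext x
    simp [Prod.ext_iff]

lemma exists_common_fiber_decomposition {I : Type} [Finite I] {𝒬 : Set (Set X)}
    {C : I → Set (Set X)} (h𝒬 : IsSetAlgebra 𝒬) {A : I → Set X}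
    (hA : ∀ a, A a ∈ generateSetAlgebra (𝒬 ∪ C a)) :
    ∃ (κ : Type) (_ : Finite κ) (f : X → κ) (L : I → κ → Set X), (∀ k, f ⁻¹' {k} ∈ 𝒬) ∧
      (∀ a k, L a k ∈ generateSetAlgebra (C a)) ∧ ∀ a, A a = {x | x ∈ L a (f x)} := by
  choose κ hκ f L hf hL hfL using fun a ↦ exists_fiber_decomposition h𝒬 (hA a)
  cases nonempty_fintype I
  refine ⟨∀ a, κ a, inferInstance, fun x a ↦ f a x, fun a k ↦ L a (k a), fun k ↦ ?_,
    fun a k ↦ hL a _, hfL⟩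
  convert h𝒬.biInter_mem Finset.univ fun a _ ↦ hf a (k a) using 1
  ext x
  simp [funext_iff]

lemma setOf_mem_fiber {κ : Type*} (f : X → κ) (L : κ → Set X) :
    {x | x ∈ L (f x)} = ⋃ k, f ⁻¹' {k} ∩ L k := by
  ext x
  simp

/-- The union of the set families `𝒜 e` for `e ∈ 𝓕`. -/
def gens {ι : Type} (𝒜 : Finset ι → Set (Set X)) (𝓕 : Finset (Finset ι)) : Set (Set X) :=
  ⋃ e ∈ 𝓕, 𝒜 e

variable {ι : Type} {𝒜 : Finset ι → Set (Set X)}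

lemma subset_gens {𝓕 : Finset (Finset ι)} {e : Finset ι} (he : e ∈ 𝓕) : 𝒜 e ⊆ gens 𝒜 𝓕 :=
  subset_biUnion_of_mem (u := 𝒜) (Finset.mem_coe.2 he)

lemma gens_mono {𝓕 𝓖 : Finset (Finset ι)} (h : 𝓕 ⊆ 𝓖) : gens 𝒜 𝓕 ⊆ gens 𝒜 𝓖 :=
  biUnion_subset_biUnion_left h

lemma gens_subset_union_erase [DecidableEq ι] (𝓕 : Finset (Finset ι)) (e : Finset ι) :
    gens 𝒜 𝓕 ⊆ 𝒜 e ∪ gens 𝒜 (𝓕.erase e) := by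
  refine iUnion₂_subset fun e' he' ↦ ?_
  by_cases h : e' = e
  · exact h ▸ subset_union_left
  · exact (subset_gens (Finset.mem_erase.2 ⟨h, he'⟩)).trans subset_union_right

lemma measurableSet_of_mem_generateSetAlgebra {C : Set (Set X)} {A : Set X}
    (hA : A ∈ generateSetAlgebra C) : MeasurableSet[MeasurableSpace.generateFrom C] A := by
  rw [← generateFrom_generateSetAlgebra_eq]
  exact MeasurableSpace.measurableSet_generateFrom hA

end Decomposition

section Removal

variable {X : Type*} {m m₁ : MeasurableSpace X} [m₀ : MeasurableSpace X] {μ : Measure X}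
  [IsProbabilityMeasure μ]

lemma exists_sparsification (hm : m ≤ m₁) (h₁ : m₁ ≤ m₀) {𝒬 : Set (Set X)}
    (h𝒬 : IsSetAlgebra 𝒬) (hmeas : ∀ Q ∈ 𝒬, MeasurableSet Q)
    (h : ∀ Q ∈ 𝒬, CondIndepOf m m₁ μ Q) {F : Set X}
    (hF : MeasurableSet[m ⊔ MeasurableSpace.generateFrom 𝒬] F) {κ : Type} [Fintype κ] {f : X → κ}
    (hf : ∀ k, f ⁻¹' {k} ∈ 𝒬) {L : κ → Set X} (hL : ∀ k, MeasurableSet[m] (L k)) {c : ℝ}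
    (hc : 0 ≤ c) :
    ∃ M : κ → Set X, (∀ k, MeasurableSet[m] (M k)) ∧
      (∀ k W, MeasurableSet[m₁] W → W ⊆ M k → μ W ≠ 0 →
        μ.real ((f ⁻¹' {k} ∩ W) \ F) < c * μ.real (f ⁻¹' {k} ∩ W)) ∧
      ∀ M' : κ → Set X, c * μ.real (F \ {x | x ∈ M' (f x)}) ≤
        c * μ.real (F \ {x | x ∈ L (f x)}) + μ.real ({x | x ∈ L (f x)} \ F) +
          c * ∑ k, μ.real (M k \ M' k) := by
  have hF₀ : MeasurableSet F :=
    sup_le (hm.trans h₁) (MeasurableSpace.generateFrom_le hmeas) _ hF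
  have hL₀ k : MeasurableSet (L k) := h₁ _ (hm _ (hL k))
  set B : κ → Set X := fun k ↦ (f ⁻¹' {k} ∩ L k) \ F with hB
  have hBm k : MeasurableSet[m ⊔ MeasurableSpace.generateFrom 𝒬] (B k) := by
    refine MeasurableSet.diff (MeasurableSet.inter ?_ ?_) hF
    · exact (le_sup_right : _ ≤ m ⊔ MeasurableSpace.generateFrom 𝒬) _
        (MeasurableSpace.measurableSet_generateFrom (hf k))
    · exact (le_sup_left : m ≤ m ⊔ MeasurableSpace.generateFrom 𝒬) _ (hL k)
  choose G hGm hGc hGW using fun k ↦ exists_relatively_sparse hm h₁ (h _ (hf k))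
    (CondIndepOf.sup_generateFrom hm h₁ h𝒬 hmeas h (hBm k)) c
  refine ⟨fun k ↦ L k ∩ G k, fun k ↦ (hL k).inter (hGm k), fun k W hW hWM hW0 ↦ ?_, fun M' ↦ ?_⟩
  · convert hGW k W hW (hWM.trans inter_subset_right) hW0 using 2
    ext x
    have := @hWM x
    simp only [mem_inter_iff, Set.mem_sdiff, hB] at this ⊢
    tauto
  · have hsub : F \ {x | x ∈ M' (f x)} ⊆ (F \ {x | x ∈ L (f x)}) ∪
        ((⋃ k, f ⁻¹' {k} ∩ (G k)ᶜ) ∪ ⋃ k, (L k ∩ G k) \ M' k) := by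
      intro x ⟨hxF, hxM⟩
      by_cases hxL : x ∈ L (f x)
      · by_cases hxG : x ∈ G (f x)
        · exact Or.inr (Or.inr (mem_iUnion.2 ⟨f x, ⟨hxL, hxG⟩, hxM⟩))
        · exact Or.inr (Or.inl (mem_iUnion.2 ⟨f x, rfl, hxG⟩))
      · exact Or.inl ⟨hxF, hxL⟩
    have h1 : c * μ.real (⋃ k, f ⁻¹' {k} ∩ (G k)ᶜ) ≤ μ.real ({x | x ∈ L (f x)} \ F) := by
      calc c * μ.real (⋃ k, f ⁻¹' {k} ∩ (G k)ᶜ)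
          ≤ c * ∑ k, μ.real (f ⁻¹' {k} ∩ (G k)ᶜ) := by
            gcongr
            exact measureReal_iUnion_fintype_le _
        _ ≤ ∑ k, μ.real (B k) := by
            rw [Finset.mul_sum]
            exact Finset.sum_le_sum fun k _ ↦ hGc k
        _ = μ.real (⋃ k, B k) := by
            refine (measureReal_iUnion_fintype (fun i j hij ↦ ?_)
              fun k ↦ ((hmeas _ (hf k)).inter (hL₀ k)).diff hF₀).symm
            refine disjoint_left.2 fun x hx hy ↦ hij ?_
            exact (hx.1.1 : f x = i).symm.trans hy.1.1
        _ = μ.real ({x | x ∈ L (f x)} \ F) := by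
            rw [setOf_mem_fiber, iUnion_sdiff]
    calc c * μ.real (F \ {x | x ∈ M' (f x)})
        ≤ c * (μ.real (F \ {x | x ∈ L (f x)}) + (μ.real (⋃ k, f ⁻¹' {k} ∩ (G k)ᶜ) +
            ∑ k, μ.real ((L k ∩ G k) \ M' k))) := by
          gcongr
          refine (measureReal_mono hsub).trans ((measureReal_union_le _ _).trans ?_)
          gcongr
          refine (measureReal_union_le _ _).trans ?_
          gcongr
          exact measureReal_iUnion_fintype_le _
      _ ≤ _ := by linarith

lemma measureReal_inter_iInter_eq_zero {I : Type} [Fintype I] {F : I → Set X}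
    (hF : μ (⋂ a, F a) = 0) {W : Set X} {c : ℝ} (hc : Fintype.card I * c < 1)
    (h : ∀ a, μ.real (W \ F a) ≤ c * μ.real W) : μ.real W = 0 := by
  have h1 : μ.real W ≤ μ.real (⋂ a, F a) + ∑ a, μ.real (W \ F a) := by
    have hsub : W ⊆ (⋂ a, F a) ∪ ⋃ a, W \ F a := by
      intro x hx
      by_cases hxF : x ∈ ⋂ a, F a
      · exact Or.inl hxF
      · obtain ⟨a, ha⟩ := not_forall.1 (mt mem_iInter.2 hxF)
        exact Or.inr (mem_iUnion.2 ⟨a, hx, ha⟩)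
    refine (measureReal_mono hsub).trans ((measureReal_union_le _ _).trans ?_)
    gcongr
    exact measureReal_iUnion_fintype_le _
  have h2 : ∑ a, μ.real (W \ F a) ≤ Fintype.card I * (c * μ.real W) := by
    simpa using Finset.sum_le_sum fun a (_ : a ∈ Finset.univ) ↦ h a
  have h0 : μ.real (⋂ a, F a) = 0 := by simp [measureReal_def, hF]
  have h3 : 0 ≤ μ.real W := measureReal_nonneg
  by_contra h4
  have h5 : 0 < μ.real W := lt_of_le_of_ne h3 (Ne.symm h4)
  nlinarith

variable {ι : Type} [DecidableEq ι] {𝒜 : Finset ι → Set (Set X)}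

lemma exists_fiberwise_approx (hA : ∀ e, IsSetAlgebra (𝒜 e))
    (hmeas : ∀ e, ∀ s ∈ 𝒜 e, MeasurableSet s)
    (hind : ∀ (e : Finset ι) (𝓕 : Finset (Finset ι)), (∀ e' ∈ 𝓕, ¬ e ⊆ e') → ∀ Q ∈ 𝒜 e,
      CondIndepOf (MeasurableSpace.generateFrom (gens 𝒜 e.ssubsets))
        (MeasurableSpace.generateFrom (gens 𝒜 𝓕)) μ Q)
    {e : Finset ι} {𝓖 𝓓 : Finset (Finset ι)} (h𝓖 : ∀ e' ∈ 𝓖, ¬ e ⊆ e')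
    (h𝓓 : ∀ e' ∈ 𝓓, ∀ e'' ⊆ e', e'' ∈ 𝓓) (h𝓓𝓖 : 𝓓.erase e ⊆ 𝓖) {F : Set X}
    (hF : MeasurableSet[MeasurableSpace.generateFrom (gens 𝒜 𝓓)] F) {κ : Type} [Fintype κ]
    {f : X → κ} (hf : ∀ k, f ⁻¹' {k} ∈ 𝒜 e) {L : κ → Set X}
    (hL : ∀ k, L k ∈ generateSetAlgebra (gens 𝒜 (𝓓.erase e))) {c η : ℝ} (hc : 0 < c)
    (hFL : c * μ.real (F \ {x | x ∈ L (f x)}) + μ.real ({x | x ∈ L (f x)} \ F) ≤ c * (η / 2)) :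
    ∃ M : κ → Set X,
      (∀ k, MeasurableSet[MeasurableSpace.generateFrom (gens 𝒜 (𝓓.erase e))] (M k)) ∧
      (∀ k W, MeasurableSet[MeasurableSpace.generateFrom (gens 𝒜 𝓖)] W → W ⊆ M k →
        μ.real ((f ⁻¹' {k} ∩ W) \ F) ≤ c * μ.real (f ⁻¹' {k} ∩ W)) ∧
      (e ∈ 𝓓 → ∀ k W, MeasurableSet[MeasurableSpace.generateFrom (gens 𝒜 𝓖)] W → W ⊆ M k →
        μ W ≠ 0 → μ.real (f ⁻¹' {k} ∩ W) ≠ 0) ∧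
      ∀ M' : κ → Set X, (∀ k, M' k ∈ generateSetAlgebra (gens 𝒜 (𝓓.erase e))) →
        ∑ k, μ.real (M k \ M' k) ≤ η / 2 →
        ∃ F' ∈ generateSetAlgebra (gens 𝒜 𝓓), μ.real (F \ F') ≤ η ∧
          ∀ k, f ⁻¹' {k} ∩ F' ⊆ M' k := by
  have hgm (𝓕) : ∀ s ∈ gens 𝒜 𝓕, MeasurableSet s := fun s hs ↦ by
    obtain ⟨e', -, he'⟩ := mem_iUnion₂.1 hs
    exact hmeas e' s he'
  have hm : MeasurableSpace.generateFrom (gens 𝒜 (𝓓.erase e)) ≤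
      MeasurableSpace.generateFrom (gens 𝒜 𝓖) := MeasurableSpace.generateFrom_mono (gens_mono h𝓓𝓖)
  have h₁ : MeasurableSpace.generateFrom (gens 𝒜 𝓖) ≤ m₀ :=
    MeasurableSpace.generateFrom_le (hgm 𝓖)
  have halg : IsSetAlgebra (generateSetAlgebra (gens 𝒜 𝓓)) := isSetAlgebra_generateSetAlgebra
  have hmono : generateSetAlgebra (gens 𝒜 (𝓓.erase e)) ⊆ generateSetAlgebra (gens 𝒜 𝓓) :=
    generateSetAlgebra_mono (gens_mono (Finset.erase_subset _ _))
  have hη : 0 ≤ η / 2 := by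
    by_contra hη
    have := mul_neg_of_pos_of_neg hc (not_le.1 hη)
    have := mul_nonneg hc.le (measureReal_nonneg (μ := μ) (s := F \ {x | x ∈ L (f x)}))
    have := measureReal_nonneg (μ := μ) (s := {x | x ∈ L (f x)} \ F)
    linarith
  by_cases he : e ∈ 𝓓
  · have hss : e.ssubsets ⊆ 𝓓.erase e := fun e' he' ↦ by
      rw [Finset.mem_ssubsets] at he'
      exact Finset.mem_erase.2 ⟨he'.ne, h𝓓 e he e' he'.subset⟩
    have hci : ∀ Q ∈ 𝒜 e, CondIndepOf (MeasurableSpace.generateFrom (gens 𝒜 (𝓓.erase e)))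
        (MeasurableSpace.generateFrom (gens 𝒜 𝓖)) μ Q := fun Q hQ ↦
      (hind e 𝓖 h𝓖 Q hQ).mono (MeasurableSpace.generateFrom_mono (gens_mono hss)) hm h₁
        (hmeas e Q hQ)
    have hF' : MeasurableSet[MeasurableSpace.generateFrom (gens 𝒜 (𝓓.erase e)) ⊔
        MeasurableSpace.generateFrom (𝒜 e)] F := by
      rw [sup_comm, MeasurableSpace.generateFrom_sup_generateFrom]
      exact MeasurableSpace.generateFrom_mono (gens_subset_union_erase 𝓓 e) _ hF
    obtain ⟨M, hM, hMW, hMM'⟩ := exists_sparsification hm h₁ (hA e) (hmeas e) hci hF' hf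
      (fun k ↦ measurableSet_of_mem_generateSetAlgebra (hL k)) hc.le
    refine ⟨M, hM, fun k W hW hWM ↦ ?_, fun _ k W hW hWM hW0 h0 ↦ ?_, fun M' hM' hη' ↦ ?_⟩
    · by_cases hW0 : μ W = 0
      · have h0 : ∀ s ⊆ W, μ.real s = 0 := fun s hs ↦ by
          simp [measureReal_def, measure_mono_null hs hW0]
        rw [h0 _ (sdiff_subset.trans inter_subset_right), h0 _ inter_subset_right, mul_zero]
      · exact (hMW k W hW hWM hW0).le
    · have := hMW k W hW hWM hW0
      rw [h0, mul_zero] at this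
      exact this.not_ge measureReal_nonneg
    · refine ⟨{x | x ∈ M' (f x)}, ?_, ?_, ?_⟩
      · rw [setOf_mem_fiber]
        have := halg.biUnion_mem Finset.univ fun k _ ↦ halg.inter_mem
          (self_subset_generateSetAlgebra (subset_gens he (hf k))) (hmono (hM' k))
        simpa using this
      · have := mul_le_mul_of_nonneg_left hη' hc.le
        refine le_of_mul_le_mul_left ((hMM' M').trans ?_) hc
        linarith
      · rintro k x ⟨rfl, hx⟩
        exact hx
  · rw [Finset.erase_eq_of_notMem he] at *
    refine ⟨fun _ ↦ F, fun _ ↦ hF, fun k W _ hWM ↦ ?_, fun h ↦ (he h).elim,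
      fun M' hM' hη' ↦ ⟨⋂ k, M' k, ?_, ?_, fun k ↦ ?_⟩⟩
    · rw [sdiff_eq_empty.2 (inter_subset_right.trans hWM), measureReal_empty]
      exact mul_nonneg hc.le measureReal_nonneg
    · have := halg.biInter_mem Finset.univ fun k _ ↦ hM' k
      simpa using this
    · rw [sdiff_iInter]
      refine (measureReal_iUnion_fintype_le _).trans (hη'.trans ?_)
      linarith
    · exact inter_subset_right.trans (iInter_subset _ k)

/-- An abstract removal lemma. -/
theorem exists_empty_iInter_of_null_iInter (hA : ∀ e, IsSetAlgebra (𝒜 e))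
    (hmeas : ∀ e, ∀ s ∈ 𝒜 e, MeasurableSet s)
    (hind : ∀ (e : Finset ι) (𝓕 : Finset (Finset ι)), (∀ e' ∈ 𝓕, ¬ e ⊆ e') → ∀ Q ∈ 𝒜 e,
      CondIndepOf (MeasurableSpace.generateFrom (gens 𝒜 e.ssubsets))
        (MeasurableSpace.generateFrom (gens 𝒜 𝓕)) μ Q)
    {I : Type} [Finite I] (𝓖 : Finset (Finset ι)) {𝓓 : I → Finset (Finset ι)}
    (h𝓓𝓖 : ∀ a, 𝓓 a ⊆ 𝓖) (h𝓓 : ∀ a, ∀ e ∈ 𝓓 a, ∀ e' ⊆ e, e' ∈ 𝓓 a) {F : I → Set X}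
    (hF : ∀ a, MeasurableSet[MeasurableSpace.generateFrom (gens 𝒜 (𝓓 a))] (F a))
    (hF0 : μ (⋂ a, F a) = 0) {η : ℝ} (hη : 0 < η) :
    ∃ F' : I → Set X, (∀ a, F' a ∈ generateSetAlgebra (gens 𝒜 (𝓓 a))) ∧
      (∀ a, μ.real (F a \ F' a) ≤ η) ∧ ⋂ a, F' a = ∅ := by
  cases nonempty_fintype I
  have hgm (𝓕) : ∀ s ∈ gens 𝒜 𝓕, MeasurableSet s := fun s hs ↦ by
    obtain ⟨e', -, he'⟩ := mem_iUnion₂.1 hs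
    exact hmeas e' s he'
  induction 𝓖 using Finset.induction_on_max_value (α := ℕ) (f := Finset.card (α := ι))
    generalizing 𝓓 F η with
  | empty =>
    have hFa a : F a = ∅ ∨ F a = univ := by
      have h := hF a
      rw [Finset.subset_empty.1 (h𝓓𝓖 a)] at h
      have hbot : MeasurableSpace.generateFrom (gens 𝒜 ∅) = ⊥ := by simp [gens]
      rwa [hbot, MeasurableSpace.measurableSet_bot_iff] at h
    refine ⟨F, fun a ↦ ?_, fun a ↦ by simpa using hη.le, ?_⟩
    · rcases hFa a with h | h <;> rw [h]
      · exact isSetAlgebra_generateSetAlgebra.empty_mem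
      · exact isSetAlgebra_generateSetAlgebra.univ_mem
    · by_cases h : ∃ a, F a = ∅
      · obtain ⟨a, ha⟩ := h
        exact subset_empty_iff.1 (ha ▸ iInter_subset F a)
      · push Not at h
        have : ∀ a, F a = univ := fun a ↦ (hFa a).resolve_left (h a).ne_empty
        simp [this] at hF0
  | insert e 𝓖 he hmax ih =>
    have h𝓖 : ∀ e' ∈ 𝓖, ¬ e ⊆ e' := fun e' he' hee' ↦
      he (Finset.eq_of_subset_of_card_le hee' (hmax e' he') ▸ he')
    have herase a : (𝓓 a).erase e ⊆ 𝓖 := by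
      rw [← Finset.subset_insert_iff]
      exact h𝓓𝓖 a
    by_cases hex : ∃ a, e ∈ 𝓓 a
    swap
    · push Not at hex
      exact ih (fun a ↦ by simpa [Finset.erase_eq_of_notMem (hex a)] using herase a) h𝓓 hF hF0 hη
    obtain ⟨a₀, ha₀⟩ := hex
    set N : ℝ := (Fintype.card I : ℝ)
    have hN : 0 ≤ N := Nat.cast_nonneg _
    set c : ℝ := 1 / (N + 1) with hc
    have hc0 : 0 < c := by positivity
    set ρ : ℝ := c * (η / 2) / (c + 1) with hρ
    have hρ0 : 0 < ρ := by positivity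
    choose K hK hFK hKF using fun a ↦
      exists_mem_generateSetAlgebra_approx (μ := μ) (hgm (𝓓 a)) (hF a) hρ0
    obtain ⟨κ, hκ, f, L, hf, hL, hKL⟩ := exists_common_fiber_decomposition (hA e) (A := K)
      fun a ↦ generateSetAlgebra_mono (gens_subset_union_erase (𝓓 a) e) (hK a)
    cases nonempty_fintype κ
    have happrox a : c * μ.real (F a \ {x | x ∈ L a (f x)}) + μ.real ({x | x ∈ L a (f x)} \ F a) ≤
        c * (η / 2) := by
      rw [← hKL]
      calc _ ≤ c * ρ + ρ := by
            gcongr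
            exacts [hFK a, hKF a]
        _ = c * (η / 2) := by
            rw [hρ]
            field_simp
    choose M hM hMle hMne hMM' using fun a ↦ exists_fiberwise_approx hA hmeas hind h𝓖 (h𝓓 a)
      (herase a) (hF a) hf (hL a) hc0 (happrox a)
    have hnull k : μ (⋂ a, M a k) = 0 := by
      by_contra hne
      have hW : MeasurableSet[MeasurableSpace.generateFrom (gens 𝒜 𝓖)] (⋂ a, M a k) :=
        MeasurableSet.iInter fun a ↦
          MeasurableSpace.generateFrom_mono (gens_mono (herase a)) _ (hM a k)
      refine hMne a₀ ha₀ k _ hW (iInter_subset _ a₀) hne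
        (measureReal_inter_iInter_eq_zero hF0 (c := c) ?_ fun a ↦
          hMle a k _ hW (iInter_subset _ a))
      rw [hc, mul_one_div, div_lt_one (by positivity)]
      exact lt_add_one N
    have hdown a : ∀ e₁ ∈ (𝓓 a).erase e, ∀ e₂ ⊆ e₁, e₂ ∈ (𝓓 a).erase e := by
      intro e₁ he₁ e₂ he₂
      refine Finset.mem_erase.2 ⟨?_, h𝓓 a e₁ (Finset.mem_of_mem_erase he₁) e₂ he₂⟩
      rintro rfl
      exact h𝓖 e₁ (herase a he₁) he₂
    have hη' : 0 < η / 2 / (Fintype.card κ + 1) := by positivity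
    choose M' hM' hdiff hempty using fun k ↦
      ih (𝓓 := fun a ↦ (𝓓 a).erase e) herase hdown (fun a ↦ hM a k) (hnull k) hη'
    have hsum a : ∑ k, μ.real (M a k \ M' k a) ≤ η / 2 := by
      calc _ ≤ ∑ _k : κ, η / 2 / (Fintype.card κ + 1) :=
            Finset.sum_le_sum fun k _ ↦ hdiff k a
        _ = (Fintype.card κ / (Fintype.card κ + 1)) * (η / 2) := by
            rw [Finset.sum_const, nsmul_eq_mul, Finset.card_univ]
            ring
        _ ≤ 1 * (η / 2) := by
            gcongr
            rw [div_le_one (by positivity)]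
            linarith
        _ = η / 2 := one_mul _
    choose F' hF' hFF' hfib using fun a ↦ hMM' a (fun k ↦ M' k a) (fun k ↦ hM' k a) (hsum a)
    refine ⟨F', hF', hFF', eq_empty_of_forall_notMem fun x hx ↦ ?_⟩
    have : x ∈ ⋂ a, M' (f x) a :=
      mem_iInter.2 fun a ↦ hfib a (f x) ⟨rfl, mem_iInter.1 hx a⟩
    rw [hempty] at this
    exact this

end Removal

section Cylinders

variable {ι V : Type} {e e' : Finset ι}

/-- The subsets of `ι → V` that depend only on the coordinates in `e`. -/
def cylinders (V : Type) (e : Finset ι) : Set (Set (ι → V)) :=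
  {A | ∀ x y : ι → V, (∀ i ∈ e, x i = y i) → x ∈ A → y ∈ A}

lemma isSetAlgebra_cylinders : IsSetAlgebra (cylinders V e) where
  empty_mem := fun _ _ _ h ↦ h
  compl_mem := fun _ hA x y hxy hx hy ↦ hx (hA y x (fun i hi ↦ (hxy i hi).symm) hy)
  union_mem := fun _ _ hA hB x y hxy ↦ Or.imp (hA x y hxy) (hB x y hxy)

lemma cylinders_mono (h : e ⊆ e') : cylinders V e ⊆ cylinders V e' :=
  fun _ hA x y hxy ↦ hA x y fun i hi ↦ hxy i (h hi)

variable [DecidableEq ι]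

/-- The section of `W` in which the coordinates outside `e` are those of `z`. -/
def slice (e : Finset ι) (W : Set (ι → V)) (z : ι → V) : Set (ι → V) :=
  {y | e.piecewise y z ∈ W}

lemma slice_mem_cylinders {W : Set (ι → V)} (hW : W ∈ cylinders V e') (z : ι → V) :
    slice e W z ∈ cylinders V (e' ∩ e) := by
  refine fun x y hxy ↦ hW _ _ fun i hi ↦ ?_
  by_cases hie : i ∈ e
  · simp [hie, hxy i (Finset.mem_inter.2 ⟨hi, hie⟩)]
  · simp [hie]

lemma involutive_piecewise_swap (e : Finset ι) : Function.Involutive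
    fun p : (ι → V) × (ι → V) ↦ (e.piecewise p.1 p.2, e.piecewise p.2 p.1) := by
  rintro ⟨z, y⟩
  ext i <;> by_cases hi : i ∈ e <;> simp [hi]

lemma sum_ncard_slice_inter [Fintype (ι → V)] (W : Set (ι → V)) {A : Set (ι → V)}
    (hA : A ∈ cylinders V e) :
    ∑ z, (slice e W z ∩ A).ncard = Fintype.card (ι → V) * (W ∩ A).ncard := by
  classical
  have hcard (B : Set (ι → V)) : B.ncard = ∑ y, if y ∈ B then 1 else 0 := by
    rw [Finset.sum_boole, ncard_eq_toFinset_card']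
    congr 1
    ext y
    simp
  have hmem (z y : ι → V) : e.piecewise y z ∈ A ↔ y ∈ A :=
    ⟨hA _ _ fun i hi ↦ by simp [hi], hA _ _ fun i hi ↦ by simp [hi]⟩
  calc ∑ z, (slice e W z ∩ A).ncard
      = ∑ p : (ι → V) × (ι → V), if e.piecewise p.2 p.1 ∈ W ∩ A then 1 else 0 := by
        rw [Fintype.sum_prod_type]
        simp_rw [hcard, mem_inter_iff, hmem]
        rfl
    _ = ∑ p : (ι → V) × (ι → V), if p.2 ∈ W ∩ A then 1 else 0 :=
        Equiv.sum_comp (involutive_piecewise_swap e).toPerm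
          fun p : (ι → V) × (ι → V) ↦ if p.2 ∈ W ∩ A then 1 else 0
    _ = _ := by
        rw [Fintype.sum_prod_type]
        simp [hcard (W ∩ A)]

lemma exists_slice_abs_le [Finite ι] [Finite V] [Nonempty V] {κ : Type*} [Fintype κ] (c : κ → ℝ)
    {P : κ → Set (ι → V)} (hP : ∀ k, P k ∈ cylinders V e) (W : Set (ι → V)) :
    ∃ z, |∑ k, c k * density (W ∩ P k)| ≤ |∑ k, c k * density (slice e W z ∩ P k)| := by
  cases nonempty_fintype (ι → V)
  have hpos : (0 : ℝ) < Fintype.card (ι → V) := Nat.cast_pos.2 Fintype.card_pos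
  have h1 : ∑ z, ∑ k, c k * density (slice e W z ∩ P k) =
      Fintype.card (ι → V) * ∑ k, c k * density (W ∩ P k) := by
    rw [Finset.sum_comm, Finset.mul_sum]
    refine Finset.sum_congr rfl fun k _ ↦ ?_
    have := sum_ncard_slice_inter W (hP k)
    rw [← Finset.mul_sum]
    simp only [density]
    rw [← Finset.sum_div, ← Nat.cast_sum, this]
    push_cast
    ring
  by_contra! h
  have h2 := Finset.sum_lt_sum_of_nonempty Finset.univ_nonempty fun z _ ↦ h z
  have h3 := Finset.abs_sum_le_sum_abs (fun z ↦ ∑ k, c k * density (slice e W z ∩ P k))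
    Finset.univ
  rw [h1, abs_mul, abs_of_pos hpos] at h3
  rw [Finset.sum_const, nsmul_eq_mul, Finset.card_univ] at h2
  exact h2.not_ge h3

end Cylinders

section SpanApprox

variable {X : Type*} [m₀ : MeasurableSpace X] {μ : Measure X} [IsProbabilityMeasure μ]

lemma exists_integral_abs_sub_le_of_eq_generateFrom {C : Set (Set X)}
    (hC : m₀ = MeasurableSpace.generateFrom C) {f : X → ℝ} (hf : Integrable f μ) {η : ℝ}
    (hη : 0 < η) :
    ∃ (κ : Type) (_ : Fintype κ) (c : κ → ℝ) (P : κ → Set X),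
      (∀ k, P k ∈ generateSetAlgebra C) ∧
      ∫ x, |f x - ∑ k, c k * (P k).indicator (fun _ ↦ 1) x| ∂μ ≤ η := by
  have hdense : μ.MeasureDense (generateSetAlgebra C) :=
    Measure.MeasureDense.of_generateFrom_isSetAlgebra_finite μ isSetAlgebra_generateSetAlgebra
      (hC.trans generateFrom_generateSetAlgebra_eq.symm)
  obtain ⟨g, hg, hgLp⟩ := MemLp.exists_simpleFunc_eLpNorm_sub_lt
    (memLp_one_iff_integrable.2 hf) ENNReal.one_ne_top
    (ε := ENNReal.ofReal (η / 2)) (by simpa using hη)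
  have hgi : Integrable g μ := memLp_one_iff_integrable.1 hgLp
  have hfg : ∫ x, |f x - g x| ∂μ ≤ η / 2 := by
    have h := integral_norm_eq_lintegral_enorm (hf.sub hgi).aestronglyMeasurable
    rw [← eLpNorm_one_eq_lintegral_enorm] at h
    refine le_trans (le_of_eq h) (ENNReal.toReal_le_of_le_ofReal (by positivity) hg.le)
  set B : ℝ := ∑ r : g.range, |(r : ℝ)|
  have hB : 0 ≤ B := Finset.sum_nonneg fun _ _ ↦ abs_nonneg _
  set ρ : ℝ := η / 2 / (B + 1) with hρ
  have hρ0 : 0 < ρ := by positivity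
  choose P hP hPg using fun r : g.range ↦
    hdense.approx (g ⁻¹' {(r : ℝ)}) (g.measurableSet_fiber _) (measure_ne_top _ _) ρ hρ0
  have hPm r : MeasurableSet (P r) := hdense.measurable _ (hP r)
  refine ⟨g.range, inferInstance, fun r ↦ r, P, hP, ?_⟩
  have hgsum x : g x = ∑ r : g.range, (r : ℝ) * (g ⁻¹' {(r : ℝ)}).indicator (fun _ ↦ 1) x := by
    rw [Finset.sum_eq_single ⟨g x, g.mem_range_self x⟩]
    · simp
    · intro r _ hr
      have : g x ≠ r := fun h ↦ hr (Subtype.ext h.symm)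
      simp [this]
    · simp
  have hind (r : g.range) x : |(g ⁻¹' {(r : ℝ)}).indicator (fun _ ↦ (1 : ℝ)) x -
      (P r).indicator (fun _ ↦ 1) x| =
        (symmDiff (g ⁻¹' {(r : ℝ)}) (P r)).indicator (fun _ ↦ 1) x := by
    by_cases h1 : x ∈ g ⁻¹' {(r : ℝ)} <;> by_cases h2 : x ∈ P r <;>
      simp [-mem_preimage, mem_symmDiff, h1, h2]
  have hpt x : |f x - ∑ r : g.range, (r : ℝ) * (P r).indicator (fun _ ↦ 1) x| ≤
      |f x - g x| + ∑ r : g.range, |(r : ℝ)| *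
        (symmDiff (g ⁻¹' {(r : ℝ)}) (P r)).indicator (fun _ ↦ 1) x := by
    refine (abs_sub_le _ (g x) _).trans ?_
    gcongr
    nth_rw 1 [hgsum x]
    rw [← Finset.sum_sub_distrib]
    refine (Finset.abs_sum_le_sum_abs _ _).trans (le_of_eq ?_)
    refine Finset.sum_congr rfl fun r _ ↦ ?_
    rw [← mul_sub, abs_mul, hind]
  have hsymm (r : g.range) : MeasurableSet (symmDiff (g ⁻¹' {(r : ℝ)}) (P r)) :=
    (g.measurableSet_fiber _).symmDiff (hPm r)
  have hint (r : g.range) : Integrable (fun x ↦ |(r : ℝ)| *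
      (symmDiff (g ⁻¹' {(r : ℝ)}) (P r)).indicator (fun _ ↦ (1 : ℝ)) x) μ :=
    (integrable_indicator_one (hsymm r)).const_mul _
  have habs : Integrable (fun x ↦ |f x - g x|) μ := (hf.sub hgi).abs
  calc _ ≤ ∫ x, |f x - g x| + ∑ r : g.range, |(r : ℝ)| *
        (symmDiff (g ⁻¹' {(r : ℝ)}) (P r)).indicator (fun _ ↦ 1) x ∂μ := by
        refine integral_mono_of_nonneg (ae_of_all _ fun x ↦ abs_nonneg _) ?_ (ae_of_all _ hpt)
        exact habs.add (integrable_finsetSum _ fun r _ ↦ hint r)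
    _ = ∫ x, |f x - g x| ∂μ + ∑ r : g.range, |(r : ℝ)| *
        μ.real (symmDiff (g ⁻¹' {(r : ℝ)}) (P r)) := by
        rw [integral_add habs (integrable_finsetSum _ fun r _ ↦ hint r),
          integral_finsetSum _ fun r _ ↦ hint r]
        congr 1
        refine Finset.sum_congr rfl fun r _ ↦ ?_
        rw [integral_const_mul, integral_indicator_const _ (hsymm r), smul_eq_mul, mul_one]
    _ ≤ η / 2 + ∑ r : g.range, |(r : ℝ)| * ρ := by
        gcongr with r
        exact ENNReal.toReal_le_of_le_ofReal hρ0.le (hPg r).le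
    _ ≤ η := by
        have : B * ρ ≤ η / 2 := by
          rw [hρ, mul_div_assoc', div_le_iff₀ (by positivity)]
          nlinarith
        rw [← Finset.sum_mul]
        linarith

lemma exists_integral_abs_sub_le {C : Set (Set X)} (hC : ∀ s ∈ C, MeasurableSet s) {f : X → ℝ}
    (hf : Integrable f μ) (hfm : StronglyMeasurable[MeasurableSpace.generateFrom C] f) {η : ℝ}
    (hη : 0 < η) :
    ∃ (κ : Type) (_ : Fintype κ) (c : κ → ℝ) (P : κ → Set X),
      (∀ k, P k ∈ generateSetAlgebra C) ∧
      ∫ x, |f x - ∑ k, c k * (P k).indicator (fun _ ↦ 1) x| ∂μ ≤ η := by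
  have hle : MeasurableSpace.generateFrom C ≤ m₀ := MeasurableSpace.generateFrom_le hC
  have hprob : @IsProbabilityMeasure X (MeasurableSpace.generateFrom C) (μ.trim hle) :=
    @IsProbabilityMeasure.mk X (MeasurableSpace.generateFrom C) _
      (by rw [trim_measurableSet_eq hle MeasurableSet.univ, measure_univ])
  obtain ⟨κ, hκ, c, P, hP, h⟩ := @exists_integral_abs_sub_le_of_eq_generateFrom X
    (MeasurableSpace.generateFrom C) (μ.trim hle) hprob C rfl f (hf.trim hle hfm) η hη
  refine ⟨κ, hκ, c, P, hP, ?_⟩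
  rwa [integral_trim hle]
  refine (hfm.sub (Finset.stronglyMeasurable_fun_sum _ fun k _ ↦ ?_)).norm
  exact (stronglyMeasurable_const.indicator
    (measurableSet_of_mem_generateSetAlgebra (hP k))).const_mul _

end SpanApprox

section Independence

variable {ι : Type} {V : ℕ → Type} {e : Finset ι}

/-- The sets determined by a sequence of sets depending only on the coordinates in `e`. -/
def internalCylinders (V : ℕ → Type) (e : Finset ι) : Set (Set (∀ n, ι → V n)) :=
  {B | ∃ A : ∀ n, Set (ι → V n), (∀ n, A n ∈ cylinders (V n) e) ∧ internal A = B}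

lemma isSetAlgebra_internalCylinders : IsSetAlgebra (internalCylinders V e) where
  empty_mem := ⟨fun _ ↦ ∅, fun _ ↦ isSetAlgebra_cylinders.empty_mem, internal_empty⟩
  compl_mem := by
    rintro _ ⟨A, hA, rfl⟩
    exact ⟨_, fun n ↦ isSetAlgebra_cylinders.compl_mem (hA n), (internal_compl A).symm⟩
  union_mem := by
    rintro _ _ ⟨A, hA, rfl⟩ ⟨B, hB, rfl⟩
    exact ⟨_, fun n ↦ isSetAlgebra_cylinders.union_mem (hA n) (hB n), (internal_union A B).symm⟩

lemma internalCylinders_mono {e' : Finset ι} (h : e ⊆ e') :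
    internalCylinders V e ⊆ internalCylinders V e' := by
  rintro _ ⟨A, hA, rfl⟩
  exact ⟨A, fun n ↦ cylinders_mono h (hA n), rfl⟩

variable [DecidableEq ι]

lemma generateFrom_gens_internalCylinders (𝓕 : Finset (Finset ι)) :
    MeasurableSpace.generateFrom (gens (internalCylinders V) 𝓕) = MeasurableSpace.generateFrom
      {W | ∃ B : Finset ι → ∀ n, Set (ι → V n), (∀ e' n, B e' n ∈ cylinders (V n) e') ∧
        W = ⋂ e' : 𝓕, internal (B e')} := by
  refine le_antisymm (MeasurableSpace.generateFrom_mono ?_) (MeasurableSpace.generateFrom_le ?_)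
  · refine iUnion₂_subset fun e' he' ↦ ?_
    rintro _ ⟨A, hA, rfl⟩
    refine ⟨fun e'' n ↦ if e'' = e' then A n else univ, fun e'' n ↦ ?_, ?_⟩
    · by_cases h : e'' = e'
      · simpa [h] using hA n
      · simpa [h] using isSetAlgebra_cylinders.univ_mem
    · refine subset_antisymm (subset_iInter fun e'' ↦ ?_) ((iInter_subset _ ⟨e', he'⟩).trans ?_)
      · by_cases h : e''.1 = e'
        · simp [h]
        · simp [h, internal_univ]
      · simp
  · rintro _ ⟨B, hB, rfl⟩
    exact MeasurableSet.iInter fun e' ↦ MeasurableSpace.measurableSet_generateFrom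
      (subset_gens e'.2 ⟨B e', hB e', rfl⟩)

variable [Finite ι] [∀ n, Finite (V n)] [∀ n, Nonempty (V n)]
  [MeasurableSpace (∀ n, ι → V n)] {μ : Measure (∀ n, ι → V n)}

lemma exists_abs_sum_measureReal_le
    (hlim : ∀ A : ∀ n, Set (ι → V n), Tendsto (fun n ↦ density (A n)) (hyperfilter ℕ : Filter ℕ)
      (𝓝 (μ.real (internal A))))
    {𝓕 : Finset (Finset ι)} (h𝓕 : ∀ e' ∈ 𝓕, ¬ e ⊆ e') {κ : Type} [Fintype κ] (c : κ → ℝ)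
    {P : κ → Set (∀ n, ι → V n)} (hP : ∀ k, P k ∈ internalCylinders V e)
    {B : Finset ι → ∀ n, Set (ι → V n)} (hB : ∀ e' n, B e' n ∈ cylinders (V n) e') :
    ∃ W, MeasurableSet[MeasurableSpace.generateFrom (gens (internalCylinders V) e.ssubsets)] W ∧
      |∑ k, c k * μ.real ((⋂ e' : 𝓕, internal (B e')) ∩ P k)| ≤
        |∑ k, c k * μ.real (W ∩ P k)| := by
  choose A hA hAP using hP
  choose z hz using fun n ↦ exists_slice_abs_le c (fun k ↦ hA k n) (⋂ e' : 𝓕, B e' n)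
  refine ⟨⋂ e' : 𝓕, internal fun n ↦ slice e (B e' n) (z n), ?_, ?_⟩
  · refine MeasurableSet.iInter fun e' ↦ MeasurableSpace.measurableSet_generateFrom
      (subset_gens (e := e'.1 ∩ e) (Finset.mem_ssubsets.2 ?_) ⟨_, fun n ↦
        slice_mem_cylinders (hB e' n) (z n), rfl⟩)
    exact Finset.inter_subset_right.ssubset_of_ne fun h ↦
      h𝓕 e' e'.2 (h ▸ Finset.inter_subset_left)
  · have hlim' (D : ∀ n, Set (ι → V n)) :
        Tendsto (fun n ↦ |∑ k, c k * density (D n ∩ A k n)|) (hyperfilter ℕ : Filter ℕ)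
          (𝓝 |∑ k, c k * μ.real (internal D ∩ P k)|) := by
      refine (tendsto_finsetSum _ fun k _ ↦ Tendsto.const_mul _ ?_).abs
      rw [← hAP, internal_inter]
      exact hlim _
    rw [internal_iInter, internal_iInter]
    refine le_of_tendsto_of_tendsto' (hlim' _) (hlim' _) fun n ↦ (hz n).trans (le_of_eq ?_)
    have : slice e (⋂ e' : 𝓕, B e' n) (z n) = ⋂ e' : 𝓕, slice e (B e' n) (z n) := by
      ext y
      simp [slice]
    rw [this]

theorem condIndepOf_of_mem_internalCylinders [IsProbabilityMeasure μ]
    (hmeas : ∀ A : ∀ n, Set (ι → V n), MeasurableSet (internal A))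
    (hlim : ∀ A : ∀ n, Set (ι → V n), Tendsto (fun n ↦ density (A n)) (hyperfilter ℕ : Filter ℕ)
      (𝓝 (μ.real (internal A))))
    {𝓕 : Finset (Finset ι)} (h𝓕 : ∀ e' ∈ 𝓕, ¬ e ⊆ e') {Q : Set (∀ n, ι → V n)}
    (hQ : Q ∈ internalCylinders V e) :
    CondIndepOf (MeasurableSpace.generateFrom (gens (internalCylinders V) e.ssubsets))
      (MeasurableSpace.generateFrom (gens (internalCylinders V) 𝓕)) μ Q := by
  have hcm : ∀ (e' : Finset ι), ∀ s ∈ internalCylinders V e', MeasurableSet s := by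
    rintro e' _ ⟨A, -, rfl⟩
    exact hmeas A
  have hgm (𝓕) : ∀ s ∈ gens (internalCylinders V) 𝓕, MeasurableSet s := fun s hs ↦ by
    obtain ⟨e', -, he'⟩ := mem_iUnion₂.1 hs
    exact hcm e' s he'
  have hle (𝓕 : Finset (Finset ι)) := MeasurableSpace.generateFrom_le (hgm 𝓕)
  have hQ₀ := hcm e Q hQ
  set f : (∀ n, ι → V n) → ℝ := Q.indicator fun _ ↦ 1 with hf
  have hfi : Integrable f μ := integrable_indicator_one hQ₀
  set q := μ[f|MeasurableSpace.generateFrom (gens (internalCylinders V) e.ssubsets)] with hq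
  have hqi : Integrable q μ := integrable_condExp
  suffices h : ∀ W, MeasurableSet[MeasurableSpace.generateFrom (gens (internalCylinders V) 𝓕)] W →
      ∫ x in W, f x ∂μ = ∫ x in W, q x ∂μ from fun W hW ↦ by
    rw [← h W hW, hf, setIntegral_indicator_one hQ₀]
  intro W hW
  induction W, hW using MeasurableSpace.induction_on_inter
    (generateFrom_gens_internalCylinders 𝓕) with
  | h_inter =>
    rintro _ ⟨B, hB, rfl⟩ _ ⟨B', hB', rfl⟩ -
    refine ⟨fun e' n ↦ B e' n ∩ B' e' n,
      fun e' n ↦ isSetAlgebra_cylinders.inter_mem (hB e' n) (hB' e' n), ?_⟩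
    simp_rw [← internal_inter, iInter_inter_distrib]
  | empty => simp
  | basic t ht =>
    have ht₀ : MeasurableSet t := by
      refine hle 𝓕 t ?_
      rw [generateFrom_gens_internalCylinders]
      exact MeasurableSpace.measurableSet_generateFrom ht
    obtain ⟨B, hB, rfl⟩ := ht
    refine eq_of_forall_dist_le fun η hη ↦ ?_
    rw [Real.dist_eq]
    obtain ⟨κ, _, c, P, hP, hPq⟩ := exists_integral_abs_sub_le (hgm e.ssubsets) hqi
      stronglyMeasurable_condExp (half_pos hη)
    have hPe k : P k ∈ internalCylinders V e := by
      refine isSetAlgebra_internalCylinders.generateSetAlgebra_subset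
        (iUnion₂_subset fun e' he' ↦ ?_) (hP k)
      exact internalCylinders_mono (Finset.mem_ssubsets.1 he').subset
    have hint k : Integrable (fun x ↦ c k * (P k).indicator (fun _ ↦ (1 : ℝ)) x) μ :=
      (integrable_indicator_one (hcm e _ (hPe k))).const_mul _
    set h : (∀ n, ι → V n) → ℝ := fun x ↦ ∑ k, c k * (P k).indicator (fun _ ↦ 1) x with hh
    have hhi : Integrable h μ := integrable_finsetSum _ fun k _ ↦ hint k
    have hqh {W} : |∫ x in W, q x ∂μ - ∫ x in W, h x ∂μ| ≤ η / 2 := by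
      rw [← integral_sub hqi.integrableOn hhi.integrableOn]
      refine (abs_integral_le_integral_abs).trans ((setIntegral_le_integral (hqi.sub hhi).abs
        (ae_of_all _ fun x ↦ abs_nonneg _)).trans hPq)
    obtain ⟨W, hW, hWle⟩ := exists_abs_sum_measureReal_le hlim h𝓕 (κ := Option κ)
      (fun k ↦ k.elim 1 fun k ↦ -c k) (P := fun k ↦ k.elim Q P)
      (fun k ↦ by cases k <;> simp [hQ, hPe]) hB
    have hsum W : ∑ k : Option κ, (k.elim 1 fun k ↦ -c k) * μ.real (W ∩ k.elim Q P) =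
        ∫ x in W, f x ∂μ - ∫ x in W, h x ∂μ := by
      rw [hh, integral_finsetSum _ fun k _ ↦ (hint k).integrableOn, Fintype.sum_option, hf,
        setIntegral_indicator_one hQ₀, inter_comm]
      simp_rw [integral_const_mul, setIntegral_indicator_one (hcm e _ (hPe _))]
      simp [inter_comm W, sub_eq_add_neg]
    rw [hsum, hsum] at hWle
    rw [← setIntegral_condExp (hle _) hfi hW] at hWle
    have h1 := abs_sub_le (∫ x in ⋂ e' : 𝓕, internal (B e'), f x ∂μ)
      (∫ x in ⋂ e' : 𝓕, internal (B e'), h x ∂μ) (∫ x in ⋂ e' : 𝓕, internal (B e'), q x ∂μ)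
    rw [abs_sub_comm (∫ x in ⋂ e' : 𝓕, internal (B e'), h x ∂μ)] at h1
    have h2 := hqh (W := W)
    have h3 := hqh (W := ⋂ e' : 𝓕, internal (B e'))
    linarith
  | compl t ht ih =>
    rw [setIntegral_compl (hle 𝓕 t ht) hfi, setIntegral_compl (hle 𝓕 t ht) hqi, ih,
      hq, integral_condExp (hle _)]
  | iUnion g hd hg ih =>
    rw [integral_iUnion (fun i ↦ hle 𝓕 _ (hg i)) hd hfi.integrableOn,
      integral_iUnion (fun i ↦ hle 𝓕 _ (hg i)) hd hqi.integrableOn]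
    exact tsum_congr ih

end Independence

section Simplex

lemma card_mul_ncard_le_ncard {ι V : Type} [Fintype ι] [DecidableEq ι] [Finite V] {j : ι}
    {D B : Set (ι → V)} (hB : B ∈ cylinders V (Finset.univ.erase j)) (hDB : D ⊆ B)
    (hD : ∀ x ∈ D, ∀ y ∈ D, (∀ i ≠ j, x i = y i) → x = y) :
    Nat.card V * D.ncard ≤ B.ncard := by
  rw [← Nat.card_coe_set_eq D, ← Nat.card_coe_set_eq B, ← Nat.card_prod]
  refine Nat.card_le_card_of_injective (fun p : V × D ↦ (⟨Function.update p.2.1 j p.1,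
    hB p.2.1 _ (fun i hi ↦ ?_) (hDB p.2.2)⟩ : B)) ?_
  · rw [Function.update_of_ne (Finset.ne_of_mem_erase hi)]
  · rintro ⟨v, x, hx⟩ ⟨w, y, hy⟩ h
    have h' := congrFun (Subtype.ext_iff.1 h)
    obtain rfl : v = w := by simpa using h' j
    obtain rfl : x = y := hD x hx y hy fun i hi ↦ by simpa [hi] using h' i
    rfl

/-- A removal lemma for simplices. -/
theorem exists_le_density_iInter (t : ℕ) {η : ℝ} (hη : 0 < η) :
    ∃ δ : ℝ, 0 < δ ∧ ∀ (V : Type) [Finite V] [Nonempty V] (E : Fin t → Set (Fin t → V))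
      (D : Set (Fin t → V)), (∀ j, E j ∈ cylinders V (Finset.univ.erase j)) → (∀ j, D ⊆ E j) →
      (∀ j, ∀ x ∈ D, ∀ y ∈ D, (∀ i ≠ j, x i = y i) → x = y) →
      η ≤ Nat.card V * density D → δ ≤ density (⋂ j, E j) := by
  by_contra! hcon
  choose V hfin hne E D hE hDE hD hηD hlt using
    fun n : ℕ ↦ hcon (1 / (n + 1)) Nat.one_div_pos_of_nat
  let _ : MeasurableSpace (∀ n, Fin t → V n) := loebSpace fun n ↦ Fin t → V n
  obtain ⟨μ, hμ, hlim⟩ := exists_loebMeasure (Y := fun n ↦ Fin t → V n)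
  have hmeas (A : ∀ n, Set (Fin t → V n)) : MeasurableSet (internal A) :=
    MeasurableSpace.measurableSet_generateFrom ⟨A, rfl⟩
  set F : Fin t → Set (∀ n, Fin t → V n) := fun j ↦ internal fun n ↦ E n j with hF
  have hnull : μ (⋂ j, F j) = 0 := by
    have h0 : Tendsto (fun n ↦ density (⋂ j, E n j)) (hyperfilter ℕ : Filter ℕ) (𝓝 0) :=
      squeeze_zero (fun n ↦ density_nonneg _) (fun n ↦ (hlt n).le)
        (tendsto_one_div_add_atTop_nhds_zero_nat.mono_left Nat.hyperfilter_le_atTop)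
    have h1 := tendsto_nhds_unique (hlim fun n ↦ ⋂ j, E n j) h0
    rw [hF, internal_iInter]
    exact (measureReal_eq_zero_iff (measure_ne_top _ _)).1 h1
  set η' : ℝ := η / (t + 1) with hη'
  have hη'0 : 0 < η' := by positivity
  obtain ⟨F', hF', hFF', hF'0⟩ := exists_empty_iInter_of_null_iInter (μ := μ)
    (fun _ ↦ isSetAlgebra_internalCylinders) (𝒜 := internalCylinders V)
    (by rintro e _ ⟨A, -, rfl⟩; exact hmeas A)
    (fun e 𝓕 h𝓕 Q hQ ↦ condIndepOf_of_mem_internalCylinders hmeas hlim h𝓕 hQ)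
    Finset.univ (𝓓 := fun j ↦ (Finset.univ.erase j).powerset) (fun j ↦ Finset.subset_univ _)
    (fun j e he e' he' ↦ Finset.mem_powerset.2 (he'.trans (Finset.mem_powerset.1 he)))
    (fun j ↦ MeasurableSpace.measurableSet_generateFrom
      (subset_gens (Finset.mem_powerset_self _) ⟨fun n ↦ E n j, fun n ↦ hE n j, rfl⟩))
    hnull (half_pos hη'0)
  have hF'mem j : F' j ∈ internalCylinders V (Finset.univ.erase j) := by
    have hsub : gens (internalCylinders V) (Finset.univ.erase j).powerset ⊆
        internalCylinders V (Finset.univ.erase j) :=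
      iUnion₂_subset fun e he ↦ internalCylinders_mono (Finset.mem_powerset.1 he)
    exact isSetAlgebra_internalCylinders.generateSetAlgebra_subset hsub (hF' j)
  choose A hA hAF using hF'mem
  have hempty : ∀ᶠ n in (hyperfilter ℕ : Filter ℕ), ⋂ j, A j n = ∅ := by
    refine eventually_eq_of_internal_eq ?_
    rw [internal_empty, ← internal_iInter, ← hF'0]
    simp_rw [hAF]
  have hsmall : ∀ᶠ n in (hyperfilter ℕ : Filter ℕ), ∀ j, density (E n j \ A j n) < η' := by
    refine eventually_all.2 fun j ↦ (hlim fun n ↦ E n j \ A j n).eventually_lt_const ?_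
    refine lt_of_le_of_lt ?_ (half_lt_self hη'0)
    have h1 := hFF' j
    rw [← hAF j, Set.sdiff_eq, internal_compl, internal_inter] at h1
    exact h1
  obtain ⟨n, hn, hsn⟩ := (hempty.and hsmall).exists
  have hcover : D n ⊆ ⋃ j, D n \ A j n := by
    rw [← sdiff_iInter, hn, sdiff_empty]
  have hcard : Nat.card (V n) * (D n).ncard ≤ ∑ j, (E n j \ A j n).ncard := by
    calc Nat.card (V n) * (D n).ncard ≤ Nat.card (V n) * ∑ j, (D n \ A j n).ncard := by
          gcongr
          refine (ncard_le_ncard hcover).trans ?_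
          simpa using Finset.univ.set_ncard_biUnion_le fun j ↦ D n \ A j n
      _ ≤ ∑ j, (E n j \ A j n).ncard := by
          rw [Finset.mul_sum]
          exact Finset.sum_le_sum fun j _ ↦ card_mul_ncard_le_ncard
            (isSetAlgebra_cylinders.sdiff_mem (hE n j) (hA j n)) (sdiff_subset_sdiff_left (hDE n j))
            fun x hx y hy ↦ hD n j x hx.1 y hy.1
  have hdens : Nat.card (V n) * density (D n) ≤ ∑ j, density (E n j \ A j n) := by
    simp only [density]
    rw [← Finset.sum_div, mul_div_assoc']
    gcongr
    exact_mod_cast hcard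
  have hfinal : ∑ j, density (E n j \ A j n) ≤ t * η' := by
    simpa using Finset.sum_le_sum fun j (_ : j ∈ Finset.univ) ↦ (hsn j).le
  have : η ≤ t * η' := (hηD n).trans (hdens.trans hfinal)
  have h2 : (t + 1) * η' = η := by
    rw [hη']
    field_simp
  linarith

end Simplex

section Groups

variable {G H : Type} [AddCommGroup G] [AddCommGroup H] {t : ℕ} (Φ : Fin t → H →+ G)
  (S : Set G)

/-- The tuples for which all the points of the configuration with base point `x + ∑ i, Φ i (h i)`
and dilation `-∑ i, h i` lie in `S`; the `j`-th condition does not involve `h j`. -/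
def configurationTuples (x : G) (j : Fin t) : Set (Fin t → H) :=
  {h | x + ∑ i, (Φ i - Φ j) (h i) ∈ S}

/-- The tuples giving rise to a trivial configuration in `S`. -/
def trivialTuples (x : G) : Set (Fin t → H) :=
  {h | ∑ i, h i = 0 ∧ x + ∑ i, Φ i (h i) ∈ S}

variable {Φ S}

lemma sum_sub_apply (j : Fin t) (h : Fin t → H) :
    ∑ i, (Φ i - Φ j) (h i) = ∑ i, Φ i (h i) - Φ j (∑ i, h i) := by
  simp [map_sum]

lemma configurationTuples_mem_cylinders (x : G) (j : Fin t) :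
    configurationTuples Φ S x j ∈ cylinders H (Finset.univ.erase j) := by
  intro h h' hh
  have : ∑ i, (Φ i - Φ j) (h i) = ∑ i, (Φ i - Φ j) (h' i) := by
    refine Finset.sum_congr rfl fun i _ ↦ ?_
    obtain rfl | hij := eq_or_ne i j
    · simp
    · rw [hh i (by simp [hij])]
  simp only [configurationTuples, mem_ofPred_eq, this]
  exact id

lemma trivialTuples_subset (x : G) (j : Fin t) :
    trivialTuples Φ S x ⊆ configurationTuples Φ S x j := by
  rintro h ⟨h0, h1⟩
  rw [configurationTuples, mem_ofPred_eq, sum_sub_apply, h0, map_zero, sub_zero]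
  exact h1

lemma trivialTuples_ext (x : G) (j : Fin t) {h h' : Fin t → H} (hh : h ∈ trivialTuples Φ S x)
    (hh' : h' ∈ trivialTuples Φ S x) (heq : ∀ i ≠ j, h i = h' i) : h = h' := by
  have h0 := hh.1.trans hh'.1.symm
  rw [← Finset.add_sum_erase _ _ (Finset.mem_univ j),
    ← Finset.add_sum_erase _ _ (Finset.mem_univ j),
    Finset.sum_congr rfl fun i hi ↦ heq i (Finset.ne_of_mem_erase hi), add_left_inj] at h0
  ext i
  obtain rfl | hij := eq_or_ne i j
  · exact h0
  · exact heq i hij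

variable [Finite G] [Finite H]

lemma card_mul_card_le_sum_trivialTuples [Fintype G] (j : Fin t) :
    Nat.card S * Nat.card (Fin t → H) ≤
      Nat.card H * ∑ x, (trivialTuples Φ S x).ncard := by
  have hcard : Nat.card (H × Σ x, trivialTuples Φ S x) =
      Nat.card H * ∑ x, (trivialTuples Φ S x).ncard := by
    simp [Nat.card_prod, Nat.card_sigma]
  rw [← hcard, ← Nat.card_prod]
  refine Nat.card_le_card_of_injective (fun p : S × (Fin t → H) ↦
    (∑ i, p.2 i, ⟨p.1 - ∑ i, Φ i (p.2 i - Pi.single (M := fun _ ↦ H) j (∑ k, p.2 k) i),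
      p.2 - Pi.single j (∑ i, p.2 i), ?_, ?_⟩)) ?_
  · simp [Finset.sum_sub_distrib]
  · simp
  · rintro ⟨⟨s, hs⟩, h⟩ ⟨⟨s', hs'⟩, h'⟩ heq
    obtain ⟨h1, h2⟩ := Prod.ext_iff.1 heq
    have h3 := congrArg (fun q : Σ x, trivialTuples Φ S x ↦ (q.2 : Fin t → H)) h2
    have h4 := congrArg Sigma.fst h2
    simp only at h1 h3 h4
    rw [h1, sub_left_inj] at h3
    subst h3
    obtain rfl := sub_left_inj.1 h4
    rfl

lemma card_mul_sum_le_card_mul_card [Fintype G] (j : Fin t) :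
    Nat.card H * ∑ x, (⋂ j, configurationTuples Φ S x j).ncard ≤
      Nat.card {p : G × H | ∀ j, p.1 + Φ j p.2 ∈ S} * Nat.card (Fin t → H) := by
  have hcard : Nat.card (H × Σ x, ↥(⋂ j, configurationTuples Φ S x j)) =
      Nat.card H * ∑ x, (⋂ j, configurationTuples Φ S x j).ncard := by
    simp only [Nat.card_prod, Nat.card_sigma, Nat.card_coe_set_eq]
  rw [← hcard, ← Nat.card_prod]
  refine Nat.card_le_card_of_injective
    (fun p : H × Σ x, ↥(⋂ j, configurationTuples Φ S x j) ↦
      (⟨(p.2.1 + ∑ i, Φ i (p.2.2.1 i), -∑ i, p.2.2.1 i), fun j ↦ ?_⟩,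
        p.2.2.1 + Pi.single j p.1)) ?_
  · have := mem_iInter.1 p.2.2.2 j
    rw [configurationTuples, mem_ofPred_eq, sum_sub_apply] at this
    rwa [map_neg, ← sub_eq_add_neg, add_sub_assoc]
  · rintro ⟨g, x, h, hh⟩ ⟨g', x', h', hh'⟩ heq
    simp only [Prod.mk.injEq, Subtype.mk.injEq, neg_inj] at heq
    obtain ⟨⟨h1, h2⟩, h3⟩ := heq
    have h4 := congrArg (fun f : Fin t → H ↦ ∑ i, f i) h3
    simp only [Pi.add_apply, Finset.sum_add_distrib, h2, Finset.sum_pi_single', Finset.mem_univ,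
      if_true, add_right_inj] at h4
    subst h4
    obtain rfl : h = h' := by simpa using h3
    obtain rfl : x = x' := by simpa using h1
    rfl

end Groups

/-- Homothetic configurations with a single group of dilations. -/
theorem exists_le_card_configurations {ε : ℝ} (hε : 0 < ε) (t : ℕ) [NeZero t] :
    ∃ δ : ℝ, 0 < δ ∧ ∀ (G H : Type) [AddCommGroup G] [Finite G] [AddCommGroup H] [Finite H]
      (Φ : Fin t → H →+ G) (S : Set G), ε * Nat.card G ≤ Nat.card S →
        δ * (Nat.card G * Nat.card H) ≤
          Nat.card {p : G × H | ∀ j, p.1 + Φ j p.2 ∈ S} := by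
  obtain ⟨δ, hδ, hsimplex⟩ := exists_le_density_iInter t (half_pos hε)
  refine ⟨δ * (ε / 2), by positivity, fun G H _ _ _ _ Φ S hS ↦ ?_⟩
  have := Fintype.ofFinite G
  have hN0 : (0 : ℝ) < Nat.card (Fin t → H) := Nat.cast_pos.2 Nat.card_pos
  have hH0 : (0 : ℝ) < Nat.card H := Nat.cast_pos.2 Nat.card_pos
  set d : G → ℝ := fun x ↦ Nat.card H * density (trivialTuples Φ S x) with hd
  have hd1 x : d x ≤ 1 := by
    have := card_mul_ncard_le_ncard (j := (0 : Fin t)) isSetAlgebra_cylinders.univ_mem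
      (subset_univ (trivialTuples Φ S x)) fun h hh h' hh' ↦ trivialTuples_ext x 0 hh hh'
    rw [ncard_univ] at this
    simp only [hd, density]
    rw [mul_div_assoc', div_le_one hN0]
    exact_mod_cast this
  have hdsum : ε * Nat.card G ≤ ∑ x, d x := by
    rw [hd, ← Finset.mul_sum]
    simp only [density]
    rw [← Finset.sum_div, mul_div_assoc', le_div_iff₀ hN0]
    refine (mul_le_mul_of_nonneg_right hS hN0.le).trans ?_
    exact_mod_cast card_mul_card_le_sum_trivialTuples (Φ := Φ) (S := S) (0 : Fin t)
  have hpoint x : δ * (d x - ε / 2) ≤ density (⋂ j, configurationTuples Φ S x j) := by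
    obtain hx | hx := le_total (ε / 2) (d x)
    · refine le_trans ?_ (hsimplex H (configurationTuples Φ S x) (trivialTuples Φ S x)
        (configurationTuples_mem_cylinders x) (trivialTuples_subset x)
        (fun j h hh h' hh' ↦ trivialTuples_ext x j hh hh') hx)
      exact mul_le_of_le_one_right hδ.le (by linarith [hd1 x])
    · exact (mul_nonpos_of_nonneg_of_nonpos hδ.le (by linarith)).trans (density_nonneg _)
  have hsum := Finset.sum_le_sum fun x (_ : x ∈ Finset.univ) ↦ hpoint x
  rw [← Finset.mul_sum, Finset.sum_sub_distrib, Finset.sum_const, Finset.card_univ,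
    ← Nat.card_eq_fintype_card, nsmul_eq_mul] at hsum
  have hlow : δ * (ε / 2) * Nat.card G ≤
      ∑ x, density (⋂ j, configurationTuples Φ S x j) := by
    refine le_trans ?_ hsum
    rw [mul_assoc]
    gcongr
    linarith
  have hcount : (Nat.card H : ℝ) * ∑ x, density (⋂ j, configurationTuples Φ S x j) ≤
      Nat.card {p : G × H | ∀ j, p.1 + Φ j p.2 ∈ S} := by
    simp only [density]
    rw [← Finset.sum_div, mul_div_assoc', div_le_iff₀ hN0]
    exact_mod_cast card_mul_sum_le_card_mul_card (Φ := Φ) (S := S) (0 : Fin t)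
  calc δ * (ε / 2) * (Nat.card G * Nat.card H)
      = Nat.card H * (δ * (ε / 2) * Nat.card G) := by ring
    _ ≤ _ := by gcongr
    _ ≤ _ := hcount

end HomotheticConfigurations

theorem counting_homothetic_configurations
    (ε : ℝ) (hε : 0 < ε) (t s : ℕ) :
    ∃ δ : ℝ, 0 < δ ∧
      ∀ (G : Type) [AddCommGroup G] [Fintype G]
        (Gs : Fin s → AddSubgroup G)
        (Φ : Fin t → ((∀ i, ↥(Gs i)) →+ G)) (S : Set G),
        (Nat.card ↥S : ℝ) ≥ ε * Nat.card G →
          (Nat.card ↥{p : G × (∀ i, ↥(Gs i)) |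
              ∀ j : Fin t, p.1 + Φ j p.2 ∈ S} : ℝ) ≥
            δ * ((Nat.card G : ℝ) * ∏ i : Fin s, (Nat.card ↥(Gs i) : ℝ)) := by
  obtain rfl | ht := eq_or_ne t 0
  · refine ⟨1, one_pos, fun G _ _ Gs Φ S _ ↦ le_of_eq ?_⟩
    rw [one_mul, ← Nat.cast_prod, ← Nat.card_pi, ← Nat.cast_mul, ← Nat.card_prod]
    simp
  · have : NeZero t := ⟨ht⟩
    obtain ⟨δ, hδ, h⟩ := HomotheticConfigurations.exists_le_card_configurations hε t
    refine ⟨δ, hδ, fun G _ _ Gs Φ S hS ↦ ?_⟩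
    rw [← Nat.cast_prod, ← Nat.card_pi]
    exact h G _ Φ S hS
end

section
/- Let G be a finite abelian group, A : G^m → G^k a homomorphism with m ≥ k, and suppose the solution set S = {x ∈ G^m : A(x) = 0} contains a subset R such that (i) for each i, the projection π_i(R) equals the projection π_i(S), and (ii) for each i and all g_1, g_2 ∈ π_i(S), |π_i^{-1}(g_1) ∩ R| = |π_i^{-1}(g_2) ∩ R|. Then for every ε > 0 there exists δ = δ(ε, m) > 0 such that for any subset X ⊆ G with |X^m ∩ R| > ε|R|, the number of solutions in X^m satisfies |S ∩ X^m| ≥ δ|S|. -/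
section

open MeasureTheory Set
open scoped ENNReal

/-- `g` is a version of the conditional probability of `W` given the sub-σ-algebra `𝒢`. -/
structure IsCondDensity {Ω : Type*} (𝒢 : MeasurableSpace Ω) {mΩ : MeasurableSpace Ω} (μ : Measure Ω)
    (W : Set Ω) (g : Ω → ℝ≥0∞) : Prop where
  measurable : Measurable[𝒢] g
  measure_inter : ∀ L, MeasurableSet[𝒢] L → μ (W ∩ L) = ∫⁻ x in L, g x ∂μ

theorem exists_isCondDensity {Ω : Type*} {𝒢 mΩ : MeasurableSpace Ω} (μ : Measure Ω)
    [IsFiniteMeasure μ] (h𝒢 : 𝒢 ≤ mΩ) {W : Set Ω}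
    (hW : MeasurableSet W) : ∃ g, IsCondDensity 𝒢 μ W g := by
  refine ⟨μ⁻[W.indicator 1|𝒢], measurable_condLExp _ _ _, fun L hL => ?_⟩
  rw [setLIntegral_condLExp h𝒢 _ _ hL, lintegral_indicator_one hW, Measure.restrict_apply hW]

theorem IsCondDensity.lintegral_mul {Ω : Type*} {𝒢 mΩ : MeasurableSpace Ω} {μ : Measure Ω}
    (h𝒢 : 𝒢 ≤ mΩ) {W : Set Ω} (hW : MeasurableSet W)
    {g : Ω → ℝ≥0∞} (hg : IsCondDensity 𝒢 μ W g) {Z : Ω → ℝ≥0∞} (hZ : Measurable[𝒢] Z) :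
    ∫⁻ x, Z x * W.indicator 1 x ∂μ = ∫⁻ x, Z x * g x ∂μ := by
  have hgm : Measurable g := hg.measurable.mono h𝒢 le_rfl
  have hWm : Measurable (W.indicator (1 : Ω → ℝ≥0∞)) := measurable_one.indicator hW
  refine Measurable.ennreal_induction (mα := 𝒢)
    (motive := fun Z => ∫⁻ x, Z x * W.indicator 1 x ∂μ = ∫⁻ x, Z x * g x ∂μ) ?_ ?_ ?_ hZ
  · intro c L hL
    have hL' := h𝒢 L hL
    have h1 : ∀ f : Ω → ℝ≥0∞, ∀ x, L.indicator (fun _ => c) x * f x =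
        c * L.indicator f x := fun f x => by
      by_cases hx : x ∈ L <;> simp [hx]
    simp_rw [h1]
    rw [lintegral_const_mul _ (hWm.indicator hL'), lintegral_const_mul _ (hgm.indicator hL'),
      lintegral_indicator hL', lintegral_indicator hL', lintegral_indicator_one hW,
      Measure.restrict_apply hW, hg.measure_inter L hL]
  · intro f f' _ hf hf' h1 h2
    have key : ∀ k : Ω → ℝ≥0∞, Measurable k →
        ∫⁻ x, f x * k x + f' x * k x ∂μ = ∫⁻ x, f x * k x ∂μ + ∫⁻ x, f' x * k x ∂μ :=
      fun k hk => lintegral_add_left ((hf.mono h𝒢 le_rfl).mul hk) _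
    simp only [Pi.add_apply, add_mul]
    rw [key _ hWm, key _ hgm, h1, h2]
  · intro f hf hmono h
    simp_rw [ENNReal.iSup_mul]
    have key : ∀ k : Ω → ℝ≥0∞, Measurable k →
        ∫⁻ x, ⨆ n, f n x * k x ∂μ = ⨆ n, ∫⁻ x, f n x * k x ∂μ := fun k hk =>
      lintegral_iSup (fun n => ((hf n).mono h𝒢 le_rfl).mul hk)
        (fun i j hij x => mul_le_mul_left (hmono hij x) _)
    rw [key _ hWm, key _ hgm]
    simp_rw [h]

theorem measurable_prod_indicator {Ω ι : Type*} {m : MeasurableSpace Ω} {T : Finset ι}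
    {a : ι → Set Ω} (ha : ∀ i ∈ T, MeasurableSet (a i)) :
    Measurable fun x => ∏ i ∈ T, (a i).indicator (1 : Ω → ℝ≥0∞) x :=
  Finset.measurable_prod _ fun i hi => measurable_one.indicator (ha i hi)

/-- The σ-algebra generated by the cylinder sets whose coordinate set lies in `𝒦`. -/
abbrev cylinderSigma {Ω J : Type*} (A : Finset J → Set (Set Ω)) (𝒦 : Set (Finset J)) :
    MeasurableSpace Ω :=
  MeasurableSpace.generateFrom {s | ∃ h ∈ 𝒦, s ∈ A h}

theorem cylinderSigma_mono {Ω J : Type*} (A : Finset J → Set (Set Ω)) {𝒦 ℒ : Set (Finset J)}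
    (h : 𝒦 ⊆ ℒ) : cylinderSigma A 𝒦 ≤ cylinderSigma A ℒ :=
  MeasurableSpace.generateFrom_mono fun _ ⟨f, hf, hs⟩ => ⟨f, h hf, hs⟩

theorem measurableSet_cylinderSigma {Ω J : Type*} {A : Finset J → Set (Set Ω)}
    {𝒦 : Set (Finset J)} {h : Finset J} (hh : h ∈ 𝒦) {s : Set Ω} (hs : s ∈ A h) :
    MeasurableSet[cylinderSigma A 𝒦] s :=
  MeasurableSpace.measurableSet_generateFrom ⟨h, hh, hs⟩

/-- A family of algebras of sets indexed by coordinate sets, behaving like the cylinder sets of a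
product: given the coordinates in `e`, cylinders with coordinate set `h` are only correlated with
cylinders on `h ∩ e`. -/
structure IsCylinderSystem {Ω J : Type*} {mΩ : MeasurableSpace Ω} (μ : Measure Ω)
    (A : Finset J → Set (Set Ω)) : Prop where
  isSetAlgebra : ∀ e, IsSetAlgebra (A e)
  mono : ∀ ⦃e f⦄, e ⊆ f → A e ⊆ A f
  measurableSet : ∀ ⦃e s⦄, s ∈ A e → MeasurableSet s
  isCondDensity : ∀ (e : Finset J) (𝒦 : Set (Finset J)), IsLowerSet 𝒦 → ∀ W,
    MeasurableSet[cylinderSigma A {e}] W → ∀ g,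
    IsCondDensity (cylinderSigma A {h ∈ 𝒦 | h ⊆ e}) μ W g →
    IsCondDensity (cylinderSigma A 𝒦) μ W g

namespace IsCylinderSystem

variable {Ω J : Type*} {mΩ : MeasurableSpace Ω} {μ : Measure Ω} {A : Finset J → Set (Set Ω)}

theorem cylinderSigma_le (hA : IsCylinderSystem μ A) (𝒦 : Set (Finset J)) :
    cylinderSigma A 𝒦 ≤ mΩ :=
  MeasurableSpace.generateFrom_le fun _ ⟨_, _, hs⟩ => hA.measurableSet hs

theorem cylinderSigma_le_singleton (hA : IsCylinderSystem μ A) {𝒦 : Set (Finset J)}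
    {e : Finset J} (h : ∀ f ∈ 𝒦, f ⊆ e) : cylinderSigma A 𝒦 ≤ cylinderSigma A {e} :=
  MeasurableSpace.generateFrom_mono fun _ ⟨f, hf, hs⟩ => ⟨e, rfl, hA.mono (h f hf) hs⟩

/-- Among cylinders on at most `c` coordinates, those on exactly `c` coordinates may be replaced by
their conditional probabilities on fewer coordinates. -/
theorem lintegral_mul_prod_indicator [DecidableEq J] (hA : IsCylinderSystem μ A) {c : ℕ}
    {a : Finset J → Set Ω} {g : Finset J → Ω → ℝ≥0∞} (T : Finset (Finset J))
    (hT : ∀ f ∈ T, f.card = c) (ha : ∀ f ∈ T, a f ∈ A f)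
    (hg : ∀ f ∈ T, IsCondDensity (cylinderSigma A {h | h ⊂ f}) μ (a f) (g f))
    {Y : Ω → ℝ≥0∞} (hY : Measurable[cylinderSigma A {h | h.card ≤ c ∧ h ∉ T}] Y) :
    ∫⁻ x, Y x * ∏ f ∈ T, (a f).indicator 1 x ∂μ = ∫⁻ x, Y x * ∏ f ∈ T, g f x ∂μ := by
  induction T using Finset.induction_on generalizing Y with
  | empty => simp
  | insert f T hfT ih =>
    simp only [Finset.forall_mem_insert] at hT ha hg
    have hlow : IsLowerSet {h : Finset J | ¬ f ⊆ h} := fun x y hyx hx hy => hx (hy.trans hyx)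
    have hf : IsCondDensity (cylinderSigma A {h | ¬ f ⊆ h}) μ (a f) (g f) := by
      refine hA.isCondDensity f _ hlow _ (measurableSet_cylinderSigma (mem_singleton f) ha.1) _ ?_
      convert hg.1 using 3
      ext h
      simp [ssubset_iff_subset_not_subset, and_comm]
    have hle : ∀ h : Finset J, h.card ≤ c → h ≠ f → ¬ f ⊆ h := fun h hc hne hsub =>
      hne (Finset.eq_of_subset_of_card_le hsub (hT.1 ▸ hc)).symm
    have hY' : Measurable[cylinderSigma A {h | ¬ f ⊆ h}]
        fun x => Y x * ∏ f ∈ T, (a f).indicator 1 x := by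
      refine Measurable.mul (hY.mono (cylinderSigma_mono A ?_) le_rfl)
        (measurable_prod_indicator fun h hh =>
          measurableSet_cylinderSigma ?_ (ha.2 h hh))
      · rintro h ⟨hc, hn⟩
        exact hle h hc fun h' => hn (by simp [h'])
      · exact hle h (hT.2 h hh).le fun h' => hfT (h' ▸ hh)
    calc ∫⁻ x, Y x * ∏ f ∈ insert f T, (a f).indicator 1 x ∂μ
        = ∫⁻ x, (Y x * ∏ f ∈ T, (a f).indicator 1 x) * (a f).indicator 1 x ∂μ := by
          refine lintegral_congr fun x => ?_
          rw [Finset.prod_insert hfT]; ring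
      _ = ∫⁻ x, (Y x * ∏ f ∈ T, (a f).indicator 1 x) * g f x ∂μ :=
          hf.lintegral_mul (hA.cylinderSigma_le _) (hA.measurableSet ha.1) hY'
      _ = ∫⁻ x, (Y x * g f x) * ∏ f ∈ T, (a f).indicator 1 x ∂μ := by
          refine lintegral_congr fun x => ?_
          ring
      _ = ∫⁻ x, (Y x * g f x) * ∏ f ∈ T, g f x ∂μ := by
          refine ih hT.2 ha.2 hg.2 (Measurable.mul
            (hY.mono (cylinderSigma_mono A ?_) le_rfl)
            (hg.1.measurable.mono (cylinderSigma_mono A ?_) le_rfl))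
          · exact fun h ⟨hc, hn⟩ => ⟨hc, fun h' => hn (by simp [h'])⟩
          · intro h hh
            have := hT.1 ▸ Finset.card_lt_card hh
            exact ⟨this.le, fun h' => this.ne (hT.2 h h')⟩
      _ = ∫⁻ x, Y x * ∏ f ∈ insert f T, g f x ∂μ := by
          refine lintegral_congr fun x => ?_
          rw [Finset.prod_insert hfT]; ring

end IsCylinderSystem

theorem prod_indicator_one_apply {Ω ι : Type*} (T : Finset ι) (a : ι → Set Ω) (x : Ω) :
    ∏ i ∈ T, (a i).indicator (1 : Ω → ℝ≥0∞) x = (⋂ i ∈ T, a i).indicator 1 x := by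
  by_cases hx : ∀ i ∈ T, x ∈ a i
  · rw [Finset.prod_eq_one fun i hi => by simp [hx i hi], indicator_of_mem (by simpa using hx)]
    rfl
  · obtain ⟨i, hi, hxi⟩ := by simpa using hx
    rw [Finset.prod_eq_zero hi (by simp [hxi]), indicator_of_notMem (by simpa using ⟨i, hi, hxi⟩)]

theorem indicator_one_mul_indicator_one {Ω : Type*} (s t : Set Ω) (x : Ω) :
    s.indicator (1 : Ω → ℝ≥0∞) x * t.indicator 1 x = (s ∩ t).indicator 1 x := by
  by_cases hs : x ∈ s <;> by_cases ht : x ∈ t <;> simp [hs, ht]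

namespace IsCylinderSystem

variable {Ω J ι : Type*} {mΩ : MeasurableSpace Ω} {μ : Measure Ω} {A : Finset J → Set (Set Ω)}

theorem isLowerSet_card_lt (c : ℕ) : IsLowerSet {h : Finset J | h.card < c} :=
  fun _ _ hba ha => (Finset.card_le_card hba).trans_lt ha

theorem measure_inter_iInter_eq_lintegral [DecidableEq J] (hA : IsCylinderSystem μ A) {c : ℕ}
    {a : Finset J → Set Ω} {g : Finset J → Ω → ℝ≥0∞} {T : Finset (Finset J)} {e : Finset J}
    (hT : ∀ f ∈ T, f.card = c ∧ ¬ f ⊆ e) (ha : ∀ f ∈ T, a f ∈ A f)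
    (hg : ∀ f ∈ T, IsCondDensity (cylinderSigma A {h | h ⊂ f}) μ (a f) (g f))
    {N S : Set Ω} {s : Ω → ℝ≥0∞} (hN : MeasurableSet[cylinderSigma A {h | h.card < c}] N)
    (hS : MeasurableSet[cylinderSigma A {h | h.card < c + 1 ∧ h ⊆ e}] S)
    (hs : IsCondDensity (cylinderSigma A {h | h.card < c ∧ h ⊆ e}) μ S s) :
    μ (N ∩ S ∩ ⋂ f ∈ T, a f) = ∫⁻ x, (N.indicator 1 x * ∏ f ∈ T, g f x) * s x ∂μ := by
  have hNm := hA.cylinderSigma_le _ _ hN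
  have hSm := hA.cylinderSigma_le _ _ hS
  have ham : MeasurableSet (⋂ f ∈ T, a f) :=
    T.measurableSet_biInter fun f hf => hA.measurableSet (ha f hf)
  have hS' : IsCondDensity (cylinderSigma A {h | h.card < c}) μ S s :=
    hA.isCondDensity e _ (isLowerSet_card_lt c) _
      (hA.cylinderSigma_le_singleton (fun f hf => hf.2) _ hS) _ hs
  have hgm : Measurable[cylinderSigma A {h | h.card < c}]
      fun x => N.indicator (1 : Ω → ℝ≥0∞) x * ∏ f ∈ T, g f x := by
    refine Measurable.mul (Measurable.indicator measurable_const hN)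
      (Finset.measurable_prod _ fun f hf => (hg f hf).measurable.mono
        (cylinderSigma_mono A fun h hh => ?_) le_rfl)
    exact (hT f hf).1 ▸ Finset.card_lt_card hh
  have hNS : Measurable[cylinderSigma A {h | h.card ≤ c ∧ h ∉ T}]
      fun x => (N ∩ S).indicator (1 : Ω → ℝ≥0∞) x := by
    refine Measurable.indicator measurable_const (MeasurableSet.inter
      (cylinderSigma_mono A ?_ _ hN) (cylinderSigma_mono A ?_ _ hS))
    · exact fun h hh => ⟨le_of_lt hh, fun h' => (ne_of_lt hh) (hT h h').1⟩
    · exact fun h hh => ⟨Nat.lt_succ_iff.1 hh.1, fun h' => (hT h h').2 hh.2⟩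
  calc μ (N ∩ S ∩ ⋂ f ∈ T, a f)
      = ∫⁻ x, (N ∩ S).indicator 1 x * ∏ f ∈ T, (a f).indicator 1 x ∂μ := by
        simp_rw [prod_indicator_one_apply, indicator_one_mul_indicator_one]
        rw [lintegral_indicator_one ((hNm.inter hSm).inter ham)]
    _ = ∫⁻ x, (N ∩ S).indicator 1 x * ∏ f ∈ T, g f x ∂μ :=
        hA.lintegral_mul_prod_indicator T (fun f hf => (hT f hf).1) ha hg hNS
    _ = ∫⁻ x, (N.indicator 1 x * ∏ f ∈ T, g f x) * S.indicator 1 x ∂μ := by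
        refine lintegral_congr fun x => ?_
        rw [← indicator_one_mul_indicator_one]; ring
    _ = _ := hS'.lintegral_mul (hA.cylinderSigma_le _) hSm hgm

/-- Consider cylinders `a f` with `c` coordinates each, and sets `E i` with null intersection. Where
all `a f` have positive conditional probability, and each `E i` has conditional probability close to
one inside the relevant cylinders, the points form a null set. -/
theorem measure_iInter_eq_zero [DecidableEq J] [Fintype J] [Fintype ι] [IsFiniteMeasure μ]
    (hA : IsCylinderSystem μ A) {c : ℕ} {e : ι → Finset J} {E : ι → Set Ω}
    (hE : ∀ i, MeasurableSet[cylinderSigma A {h | h.card < c + 1 ∧ h ⊆ e i}] (E i))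
    (hE0 : μ (⋂ i, E i) = 0)
    {a : Finset J → Set Ω} {g : Finset J → Ω → ℝ≥0∞} (ha : ∀ f, f.card = c → a f ∈ A f)
    (hg : ∀ f, f.card = c → IsCondDensity (cylinderSigma A {h | h ⊂ f}) μ (a f) (g f))
    {β : ι → Set Ω} (hβ : ∀ i, β i = {x | ∀ f, f.card = c → f ⊆ e i → x ∈ a f})
    {u w : ι → Ω → ℝ≥0∞}
    (hu : ∀ i, IsCondDensity (cylinderSigma A {h | h.card < c ∧ h ⊆ e i}) μ (β i \ E i) (u i))
    (hw : ∀ i, IsCondDensity (cylinderSigma A {h | h.card < c ∧ h ⊆ e i}) μ (β i) (w i))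
    {κ : ℝ≥0∞} (hκ : Fintype.card ι * κ < 1) :
    μ (⋂ i, {x | u i x ≤ κ * w i x ∧ ∀ f, f.card = c → f ⊆ e i → g f x ≠ 0}) = 0 := by
  classical
  set N := ⋂ i, {x | u i x ≤ κ * w i x ∧ ∀ f, f.card = c → f ⊆ e i → g f x ≠ 0} with hNdef
  by_contra hN0
  set T : Finset (Finset J) := Finset.univ.filter fun f => f.card = c ∧ ∃ i, f ⊆ e i with hTdef
  have hT : ∀ f ∈ T, f.card = c := fun f hf => (Finset.mem_filter.1 hf).2.1
  have hN : MeasurableSet[cylinderSigma A {h | h.card < c}] N := by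
    refine MeasurableSet.iInter fun i => MeasurableSet.inter ?_ ?_
    · refine measurableSet_le ((hu i).measurable.mono (cylinderSigma_mono A ?_) le_rfl)
        (Measurable.const_mul ((hw i).measurable.mono (cylinderSigma_mono A ?_) le_rfl) κ) <;>
      exact fun h hh => hh.1
    · have : {x | ∀ f, f.card = c → f ⊆ e i → g f x ≠ 0} =
          ⋂ f, ⋂ (_ : f.card = c), ⋂ (_ : f ⊆ e i), {x | g f x ≠ 0} := by ext; simp
      change MeasurableSet[cylinderSigma A {h | h.card < c}]
        {x | ∀ f, f.card = c → f ⊆ e i → g f x ≠ 0}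
      rw [this]
      refine MeasurableSet.iInter fun f => MeasurableSet.iInter fun hf => MeasurableSet.iInter
        fun _ => ?_
      refine ((hg f hf).measurable.mono (cylinderSigma_mono A fun h hh => ?_) le_rfl)
        (measurableSet_singleton 0).compl
      exact hf ▸ Finset.card_lt_card hh
  have hNm := hA.cylinderSigma_le _ _ hN
  have hgm : ∀ f ∈ T, Measurable (g f) := fun f hf =>
    (hg f (hT f hf)).measurable.mono (hA.cylinderSigma_le _) le_rfl
  set Q := N ∩ ⋂ f ∈ T, a f with hQ
  have hQm : MeasurableSet Q :=
    hNm.inter (T.measurableSet_biInter fun f hf => hA.measurableSet (ha f (hT f hf)))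
  have hQ0 : μ Q ≠ 0 := by
    have h1 : μ Q = ∫⁻ x, N.indicator 1 x * ∏ f ∈ T, g f x ∂μ := by
      rw [← hA.lintegral_mul_prod_indicator T hT (fun f hf => ha f (hT f hf))
        (fun f hf => hg f (hT f hf))]
      · simp_rw [prod_indicator_one_apply, indicator_one_mul_indicator_one]
        rw [lintegral_indicator_one hQm]
      · refine Measurable.indicator measurable_const (cylinderSigma_mono A ?_ _ hN)
        exact fun h hh => ⟨le_of_lt hh, fun h' => (ne_of_lt hh) (hT h h')⟩
    rw [h1]
    intro h2
    have h2 := (lintegral_eq_zero_iff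
      ((measurable_one.indicator hNm).mul (Finset.measurable_prod _ hgm))).1 h2
    refine hN0 (measure_mono_null (fun x hx => ?_) (ae_iff.1 h2))
    change ¬ N.indicator (1 : Ω → ℝ≥0∞) x * ∏ f ∈ T, g f x = 0
    rw [indicator_of_mem hx, Pi.one_apply, one_mul]
    refine Finset.prod_ne_zero_iff.2 fun f hf => ?_
    obtain ⟨hfc, i, hi⟩ := (Finset.mem_filter.1 hf).2
    exact (mem_iInter.1 hx i).2 f hfc hi
  have hQi : ∀ i, μ (Q \ E i) ≤ κ * μ Q := by
    intro i
    set Ti := T.filter fun f => ¬ f ⊆ e i with hTi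
    have hTi' : ∀ f ∈ Ti, f.card = c ∧ ¬ f ⊆ e i := fun f hf =>
      ⟨hT f (Finset.mem_filter.1 hf).1, (Finset.mem_filter.1 hf).2⟩
    have hQeq : Q = N ∩ β i ∩ ⋂ f ∈ Ti, a f := by
      rw [hβ i]
      ext x
      simp only [hQ, hTi, hTdef, mem_inter_iff, mem_iInter, Finset.mem_filter, Finset.mem_univ,
        true_and, mem_ofPred_eq, and_assoc]
      refine and_congr_right fun _ => ⟨fun h => ⟨fun f hf hfi => h f ⟨hf, i, hfi⟩,
        fun f hf => h f ⟨hf.1, hf.2.1⟩⟩, fun h f hf => ?_⟩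
      by_cases hfi : f ⊆ e i
      · exact h.1 f hf.1 hfi
      · exact h.2 f ⟨hf.1, hf.2, hfi⟩
    have hQEeq : Q \ E i = N ∩ (β i \ E i) ∩ ⋂ f ∈ Ti, a f := by
      rw [hQeq]; ext x; simp only [mem_inter_iff, mem_sdiff]; tauto
    have hβm : MeasurableSet[cylinderSigma A {h | h.card < c + 1 ∧ h ⊆ e i}] (β i) := by
      have : β i = ⋂ f, ⋂ (_ : f.card = c), ⋂ (_ : f ⊆ e i), a f := by rw [hβ i]; ext; simp
      rw [this]
      refine MeasurableSet.iInter fun f => MeasurableSet.iInter fun hf => MeasurableSet.iInter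
        fun hfi => measurableSet_cylinderSigma (h := f) ?_ (ha f hf)
      exact ⟨by simp [hf], hfi⟩
    rw [hQEeq, hA.measure_inter_iInter_eq_lintegral hTi' (fun f hf => ha f (hTi' f hf).1)
      (fun f hf => hg f (hTi' f hf).1) hN (hβm.diff (hE i)) (hu i), hQeq,
      hA.measure_inter_iInter_eq_lintegral hTi' (fun f hf => ha f (hTi' f hf).1)
      (fun f hf => hg f (hTi' f hf).1) hN hβm (hw i), ← lintegral_const_mul]
    · refine lintegral_mono fun x => ?_
      by_cases hx : x ∈ N
      · calc _ ≤ (N.indicator 1 x * ∏ f ∈ Ti, g f x) * (κ * w i x) := by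
              gcongr
              exact (mem_iInter.1 hx i).1
          _ = _ := by ring
      · simp [hx]
    · exact ((measurable_one.indicator hNm).mul (Finset.measurable_prod _ fun f hf =>
        hgm f (Finset.mem_filter.1 hf).1)).mul
        ((hw i).measurable.mono (hA.cylinderSigma_le _) le_rfl)
  have hle : μ Q ≤ Fintype.card ι * κ * μ Q := by
    calc μ Q ≤ μ ((⋂ i, E i) ∪ ⋃ i, Q \ E i) := by
          refine measure_mono fun x hx => ?_
          by_cases h : ∀ i, x ∈ E i
          · exact Or.inl (mem_iInter.2 h)
          · obtain ⟨i, hi⟩ := not_forall.1 h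
            exact Or.inr (mem_iUnion.2 ⟨i, hx, hi⟩)
      _ ≤ μ (⋂ i, E i) + ∑ i, μ (Q \ E i) :=
          (measure_union_le _ _).trans (by gcongr; exact measure_iUnion_fintype_le _ _)
      _ ≤ 0 + ∑ _i : ι, κ * μ Q := by
          rw [hE0]; gcongr with i; exact hQi i
      _ = Fintype.card ι * κ * μ Q := by simp [mul_assoc]
  have hlt : Fintype.card ι * κ * μ Q < 1 * μ Q :=
    ENNReal.mul_lt_mul_left hQ0 (measure_ne_top μ Q) hκ
  rw [one_mul] at hlt
  exact absurd hle (not_le.2 hlt)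

end IsCylinderSystem

/-- The points whose membership in the sets `p.2` with `p ∈ 𝒲` and `p.1 ⊆ e` is prescribed by
`α`. -/
def cylinderCell {Ω J : Type*} (𝒲 α : Finset (Finset J × Set Ω)) (e : Finset J) : Set Ω :=
  {x | ∀ p ∈ 𝒲, p.1 ⊆ e → (x ∈ p.2 ↔ p ∈ α)}

namespace IsCylinderSystem

variable {Ω J ι : Type*} {mΩ : MeasurableSpace Ω} {μ : Measure Ω} {A : Finset J → Set (Set Ω)}

/-- An element of the algebra generated by cylinders on at most `c` coordinates agrees, on each cell
of a suitable finite collection of cylinders on `c` coordinates, with a set depending on fewer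
coordinates. -/
theorem exists_inter_cylinderCell_eq {c : ℕ} {e : Finset J} {s : Set Ω}
    (hs : s ∈ generateSetAlgebra {s | ∃ h ∈ {h : Finset J | h.card < c + 1 ∧ h ⊆ e}, s ∈ A h}) :
    ∃ 𝒲₀ : Finset (Finset J × Set Ω), (∀ p ∈ 𝒲₀, p.1.card = c ∧ p.2 ∈ A p.1) ∧
      ∀ 𝒲, 𝒲₀ ⊆ 𝒲 → ∀ α, ∃ C, MeasurableSet[cylinderSigma A {h | h.card < c ∧ h ⊆ e}] C ∧
        ∀ x ∈ cylinderCell 𝒲 α e, x ∈ s ↔ x ∈ C := by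
  classical
  induction hs with
  | base s hs =>
    obtain ⟨h, ⟨hc, he⟩, hs⟩ := hs
    rcases Nat.lt_succ_iff_lt_or_eq.1 hc with hc | hc
    · exact ⟨∅, by simp, fun 𝒲 _ α =>
        ⟨s, measurableSet_cylinderSigma (𝒦 := {h | h.card < c ∧ h ⊆ e}) ⟨hc, he⟩ hs,
          fun x _ => Iff.rfl⟩⟩
    · refine ⟨{(h, s)}, by simp [hc, hs], fun 𝒲 h𝒲 α => ?_⟩
      by_cases hα : (h, s) ∈ α
      · refine ⟨univ, @MeasurableSet.univ _ (_), fun x hx => ?_⟩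
        simpa [hα] using hx (h, s) (h𝒲 (by simp)) he
      · refine ⟨∅, @MeasurableSet.empty _ (_), fun x hx => ?_⟩
        simpa [hα] using hx (h, s) (h𝒲 (by simp)) he
  | empty => exact ⟨∅, by simp, fun 𝒲 _ α => ⟨∅, @MeasurableSet.empty _ (_), fun x _ => Iff.rfl⟩⟩
  | compl s _ ih =>
    obtain ⟨𝒲₀, h₀, h⟩ := ih
    refine ⟨𝒲₀, h₀, fun 𝒲 h𝒲 α => ?_⟩
    obtain ⟨C, hC, h⟩ := h 𝒲 h𝒲 α
    exact ⟨Cᶜ, hC.compl, fun x hx => not_congr (h x hx)⟩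
  | union s t _ _ ihs iht =>
    obtain ⟨𝒲₀, h₀, h⟩ := ihs
    obtain ⟨𝒲₁, h₁, h'⟩ := iht
    refine ⟨𝒲₀ ∪ 𝒲₁, fun p hp => (Finset.mem_union.1 hp).elim (h₀ p) (h₁ p), fun 𝒲 h𝒲 α => ?_⟩
    obtain ⟨C, hC, h⟩ := h 𝒲 (Finset.union_subset_left h𝒲) α
    obtain ⟨C', hC', h'⟩ := h' 𝒲 (Finset.union_subset_right h𝒲) α
    exact ⟨C ∪ C', hC.union hC', fun x hx => or_congr (h x hx) (h' x hx)⟩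

theorem exists_mem_generateSetAlgebra_measure_symmDiff_lt [IsFiniteMeasure μ]
    (hA : IsCylinderSystem μ A) {𝒦 : Set (Finset J)} {s : Set Ω}
    (hs : MeasurableSet[cylinderSigma A 𝒦] s) {ε : ℝ≥0∞} (hε : 0 < ε) :
    ∃ t ∈ generateSetAlgebra {s | ∃ h ∈ 𝒦, s ∈ A h},
      MeasurableSet[cylinderSigma A 𝒦] t ∧ μ (symmDiff t s) < ε := by
  have hle := hA.cylinderSigma_le 𝒦
  have hgen : cylinderSigma A 𝒦 =
      MeasurableSpace.generateFrom (generateSetAlgebra {s | ∃ h ∈ 𝒦, s ∈ A h}) :=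
    generateFrom_generateSetAlgebra_eq.symm
  have htm : ∀ t ∈ generateSetAlgebra {s | ∃ h ∈ 𝒦, s ∈ A h},
      MeasurableSet[cylinderSigma A 𝒦] t := fun t ht => by
    rw [hgen]; exact MeasurableSpace.measurableSet_generateFrom ht
  obtain ⟨t, ht, hlt⟩ := exists_measure_symmDiff_lt_of_generateFrom_isSetRing
    (mα := cylinderSigma A 𝒦) (μ := μ.trim hle)
    isSetAlgebra_generateSetAlgebra.isSetRing
    ⟨{univ}, countable_singleton _,
      singleton_subset_iff.2 isSetAlgebra_generateSetAlgebra.univ_mem, by simp⟩ hgen hs hε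
  refine ⟨t, ht, htm t ht, ?_⟩
  rwa [trim_measurableSet_eq hle ((htm t ht).symmDiff hs)] at hlt

/-- Where the conditional probability `u` of `β \ E` is a large proportion of that of `β`, the set
`β ∩ E'` is small relative to `E' \ E`. -/
theorem mul_measure_inter_diff_le (hA : IsCylinderSystem μ A) {𝒦 : Set (Finset J)}
    {β E E' C : Set Ω} {u w : Ω → ℝ≥0∞} {κ : ℝ≥0∞}
    (hu : IsCondDensity (cylinderSigma A 𝒦) μ (β \ E) u)
    (hw : IsCondDensity (cylinderSigma A 𝒦) μ β w)
    (hC : MeasurableSet[cylinderSigma A 𝒦] C) (hCE : ∀ x ∈ β, x ∈ E' ↔ x ∈ C) :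
    κ * μ ((β ∩ E') \ {x | u x ≤ κ * w x}) ≤ μ (β ∩ (E' \ E)) := by
  have hle := hA.cylinderSigma_le 𝒦
  set L := C \ {x | u x ≤ κ * w x}
  have hL : MeasurableSet[cylinderSigma A 𝒦] L :=
    hC.diff (measurableSet_le hu.measurable (hw.measurable.const_mul κ))
  calc κ * μ ((β ∩ E') \ {x | u x ≤ κ * w x})
      = κ * μ (β ∩ L) := by
        congr 2
        ext x
        simp only [L, mem_sdiff, mem_inter_iff]
        have := hCE x
        tauto
    _ = ∫⁻ x in L, κ * w x ∂μ := by
        rw [hw.measure_inter L hL, lintegral_const_mul _ (hw.measurable.mono hle le_rfl)]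
    _ ≤ ∫⁻ x in L, u x ∂μ := by
        refine setLIntegral_mono' (hle _ hL) fun x hx => ?_
        exact (not_le.1 hx.2).le
    _ = μ ((β \ E) ∩ L) := (hu.measure_inter L hL).symm
    _ ≤ μ (β ∩ (E' \ E)) := by
        refine measure_mono fun x hx => ?_
        have := hCE x hx.1.1
        exact ⟨hx.1.1, this.2 hx.2.1, hx.1.2⟩

end IsCylinderSystem

namespace IsCylinderSystem

variable {Ω J ι : Type*} {mΩ : MeasurableSpace Ω} {μ : Measure Ω} {A : Finset J → Set (Set Ω)}

theorem setOf_mem_iff_mem (hA : IsCylinderSystem μ A) {𝒲 α : Finset (Finset J × Set Ω)}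
    {P : Finset J × Set Ω → Prop} {e : Finset J} (h : ∀ p ∈ 𝒲, P p → p.2 ∈ A e) :
    {x | ∀ p ∈ 𝒲, P p → (x ∈ p.2 ↔ p ∈ α)} ∈ A e := by
  classical
  have : {x | ∀ p ∈ 𝒲, P p → (x ∈ p.2 ↔ p ∈ α)} =
      ⋂ p ∈ 𝒲, if P p then (if p ∈ α then p.2 else p.2ᶜ) else univ := by
    ext x
    simp only [mem_ofPred_eq, mem_iInter]
    refine forall₂_congr fun p _ => ?_
    by_cases h1 : P p <;> by_cases h2 : p ∈ α <;> simp [h1, h2]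
  rw [this]
  refine (hA.isSetAlgebra e).biInter_mem 𝒲 fun p hp => ?_
  split_ifs with h1 h2
  · exact h p hp h1
  · exact (hA.isSetAlgebra e).compl_mem (h p hp h1)
  · exact (hA.isSetAlgebra e).univ_mem

theorem cylinderCell_mem (hA : IsCylinderSystem μ A) {𝒲 : Finset (Finset J × Set Ω)}
    (h𝒲 : ∀ p ∈ 𝒲, p.2 ∈ A p.1) (α : Finset (Finset J × Set Ω)) (e : Finset J) :
    cylinderCell 𝒲 α e ∈ A e :=
  hA.setOf_mem_iff_mem fun p hp he => hA.mono he (h𝒲 p hp)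

theorem cylinderCell_eq {𝒲 : Finset (Finset J × Set Ω)} {c : ℕ} (h𝒲 : ∀ p ∈ 𝒲, p.1.card = c)
    (α : Finset (Finset J × Set Ω)) (e : Finset J) :
    cylinderCell 𝒲 α e = {x | ∀ f, f.card = c → f ⊆ e →
      x ∈ {x | ∀ p ∈ 𝒲, p.1 = f → (x ∈ p.2 ↔ p ∈ α)}} := by
  ext x
  refine ⟨fun h f _ hfe p hp hpf => h p hp (hpf ▸ hfe), fun h p hp hpe => ?_⟩
  exact h p.1 (h𝒲 p hp) hpe p hp rfl

theorem cylinderCell_eq_of_mem {𝒲 α α' : Finset (Finset J × Set Ω)} {e : Finset J} {x : Ω}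
    (h : x ∈ cylinderCell 𝒲 α e) (h' : x ∈ cylinderCell 𝒲 α' e) :
    cylinderCell 𝒲 α e = cylinderCell 𝒲 α' e := by
  ext y
  refine forall₃_congr fun p hp he => ?_
  rw [← h p hp he, h' p hp he]

/-- Removal of the part of each `E i` lying in small or sparse cells: one step from complexity
`c + 1` to complexity `c`. -/
theorem exists_reduction [DecidableEq J] [Fintype J] [Fintype ι] [IsFiniteMeasure μ]
    (hA : IsCylinderSystem μ A) {c : ℕ} {e : ι → Finset J} {E : ι → Set Ω}
    (hE : ∀ i, MeasurableSet[cylinderSigma A {h | h.card < c + 1 ∧ h ⊆ e i}] (E i))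
    (hE0 : μ (⋂ i, E i) = 0) {ε : ℝ≥0∞} (hε : ε ≠ 0) :
    ∃ (𝒲 : Finset (Finset J × Set Ω)) (D : Finset (Finset J × Set Ω) → ι → Set Ω),
      (∀ p ∈ 𝒲, p.2 ∈ A p.1) ∧
      (∀ α i, MeasurableSet[cylinderSigma A {h | h.card < c ∧ h ⊆ e i}] (D α i)) ∧
      (∀ α, μ (⋂ i, D α i) = 0) ∧
      ∀ i, μ {x ∈ E i | ∃ α ∈ 𝒲.powerset, x ∈ cylinderCell 𝒲 α (e i) ∧ x ∉ D α i} ≤ ε := by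
  classical
  set κ : ℝ≥0∞ := (2 * (Fintype.card ι + 1))⁻¹ with hκdef
  have hκ0 : κ ≠ 0 := ENNReal.inv_ne_zero.2
    (ENNReal.mul_ne_top (by simp) (ENNReal.add_ne_top.2 ⟨by simp, by simp⟩))
  have hκ1 : κ ≤ 1 := by
    refine ENNReal.inv_le_one.2 ?_
    calc (1 : ℝ≥0∞) ≤ 2 * (0 + 1) := by norm_num
      _ ≤ _ := by gcongr; simp
  have hκt : κ ≠ ⊤ := (hκ1.trans_lt ENNReal.one_lt_top).ne
  have hκι : Fintype.card ι * κ < 1 := by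
    rw [hκdef, ← div_eq_mul_inv]
    refine ENNReal.div_lt_of_lt_mul ?_
    rw [one_mul]
    exact_mod_cast (by omega : Fintype.card ι < 2 * (Fintype.card ι + 1))
  have hε' : 0 < κ * (ε / 2) := by
    refine pos_iff_ne_zero.2 (mul_ne_zero hκ0 ?_)
    simp [hε]
  choose E' hE'alg hE'm hE'lt using fun i =>
    hA.exists_mem_generateSetAlgebra_measure_symmDiff_lt (hE i) hε'
  choose 𝒲₀ h𝒲₀ hC using fun i => exists_inter_cylinderCell_eq (hE'alg i)
  set 𝒲 := Finset.univ.biUnion 𝒲₀ with h𝒲def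
  have h𝒲 : ∀ p ∈ 𝒲, p.1.card = c ∧ p.2 ∈ A p.1 := fun p hp => by
    obtain ⟨i, -, hi⟩ := Finset.mem_biUnion.1 hp
    exact h𝒲₀ i p hi
  have hsub : ∀ i, 𝒲₀ i ⊆ 𝒲 := fun i => Finset.subset_biUnion_of_mem 𝒲₀ (Finset.mem_univ i)
  choose C hCm hCE using fun i => hC i 𝒲 (hsub i)
  have hEm : ∀ i, MeasurableSet (E i) := fun i => hA.cylinderSigma_le _ _ (hE i)
  have hE'm' : ∀ i, MeasurableSet (E' i) := fun i => hA.cylinderSigma_le _ _ (hE'm i)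
  have hu : ∀ i β, MeasurableSet β → ∃ u,
      IsCondDensity (cylinderSigma A {h | h.card < c ∧ h ⊆ e i}) μ (β \ E i) u := fun i β hβ =>
    exists_isCondDensity μ (hA.cylinderSigma_le _) (hβ.diff (hEm i))
  have hw : ∀ i β, MeasurableSet β → ∃ w,
      IsCondDensity (cylinderSigma A {h | h.card < c ∧ h ⊆ e i}) μ β w := fun i β hβ =>
    exists_isCondDensity μ (hA.cylinderSigma_le _) hβ
  choose! u hu using hu
  choose! w hw using hw
  set a : Finset (Finset J × Set Ω) → Finset J → Set Ω :=
    fun α f => {x | ∀ p ∈ 𝒲, p.1 = f → (x ∈ p.2 ↔ p ∈ α)} with hadef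
  have ha : ∀ α f, a α f ∈ A f := fun α f =>
    hA.setOf_mem_iff_mem fun p hp hpf => hpf ▸ (h𝒲 p hp).2
  choose g hg using fun α f => exists_isCondDensity (𝒢 := cylinderSigma A {h | h ⊂ f}) μ
    (hA.cylinderSigma_le _) (hA.measurableSet (ha α f))
  have hβm : ∀ α i, MeasurableSet (cylinderCell 𝒲 α (e i)) := fun α i =>
    hA.measurableSet (hA.cylinderCell_mem (fun p hp => (h𝒲 p hp).2) α (e i))
  set D : Finset (Finset J × Set Ω) → ι → Set Ω := fun α i =>
    {x | u i (cylinderCell 𝒲 α (e i)) x ≤ κ * w i (cylinderCell 𝒲 α (e i)) x ∧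
      ∀ f, f.card = c → f ⊆ e i → g α f x ≠ 0} with hDdef
  refine ⟨𝒲, D, fun p hp => (h𝒲 p hp).2, fun α i => ?_, fun α => ?_, fun i => ?_⟩
  · refine MeasurableSet.inter (measurableSet_le (hu i _ (hβm α i)).measurable
      ((hw i _ (hβm α i)).measurable.const_mul κ)) ?_
    have : {x | ∀ f, f.card = c → f ⊆ e i → g α f x ≠ 0} =
        ⋂ f, ⋂ (_ : f.card = c), ⋂ (_ : f ⊆ e i), {x | g α f x ≠ 0} := by ext; simp
    change MeasurableSet[cylinderSigma A {h | h.card < c ∧ h ⊆ e i}]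
      {x | ∀ f, f.card = c → f ⊆ e i → g α f x ≠ 0}
    rw [this]
    refine MeasurableSet.iInter fun f => MeasurableSet.iInter fun hf => MeasurableSet.iInter
      fun hfe => ((hg α f).measurable.mono (cylinderSigma_mono A fun h hh => ?_) le_rfl)
        (measurableSet_singleton 0).compl
    exact ⟨hf ▸ Finset.card_lt_card hh, hh.1.trans hfe⟩
  · exact hA.measure_iInter_eq_zero hE hE0 (fun f _ => ha α f) (fun f _ => hg α f)
      (fun i => cylinderCell_eq (fun p hp => (h𝒲 p hp).1) α (e i))
      (fun i => hu i _ (hβm α i)) (fun i => hw i _ (hβm α i)) hκι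
  · set ℬ := 𝒲.powerset.image fun α => cylinderCell 𝒲 α (e i) with hℬ
    set B : Set Ω → Set Ω := fun β => (β ∩ E' i) \ {x | u i β x ≤ κ * w i β x} with hBdef
    set Z : Set Ω := ⋃ α ∈ 𝒲.powerset, ⋃ f, a α f ∩ {x | g α f x = 0} with hZ
    have hZ0 : μ Z = 0 := by
      refine (measure_biUnion_null_iff (Finset.countable_toSet _)).2 fun α _ =>
        measure_iUnion_null fun f => ?_
      have hm : MeasurableSet[cylinderSigma A {h | h ⊂ f}] {x | g α f x = 0} :=
        (hg α f).measurable (measurableSet_singleton 0)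
      rw [(hg α f).measure_inter _ hm,
        setLIntegral_congr_fun (g := fun _ => 0) (hA.cylinderSigma_le _ _ hm) fun x hx => hx]
      simp
    have hmem : ∀ β ∈ ℬ, ∃ α ∈ 𝒲.powerset, cylinderCell 𝒲 α (e i) = β := fun β hβ =>
      Finset.mem_image.1 hβ
    have hBle : μ (⋃ β ∈ ℬ, B β) ≤ ε / 2 := by
      rw [← ENNReal.mul_le_mul_iff_right hκ0 hκt]
      calc κ * μ (⋃ β ∈ ℬ, B β) ≤ κ * ∑ β ∈ ℬ, μ (B β) := by
            gcongr; exact measure_biUnion_finset_le _ _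
        _ = ∑ β ∈ ℬ, κ * μ (B β) := Finset.mul_sum _ _ _
        _ ≤ ∑ β ∈ ℬ, μ (β ∩ (E' i \ E i)) := by
            refine Finset.sum_le_sum fun β hβ => ?_
            obtain ⟨α, -, rfl⟩ := hmem β hβ
            exact hA.mul_measure_inter_diff_le (hu i _ (hβm α i)) (hw i _ (hβm α i))
              (hCm i α) (hCE i α)
        _ = μ (⋃ β ∈ ℬ, β ∩ (E' i \ E i)) := by
            refine (measure_biUnion_finset ?_ fun β hβ => ?_).symm
            · intro β hβ β' hβ' hne
              obtain ⟨α, -, rfl⟩ := hmem β hβ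
              obtain ⟨α', -, rfl⟩ := hmem β' hβ'
              refine Set.disjoint_left.2 fun x hx hx' => hne ?_
              exact cylinderCell_eq_of_mem hx.1 hx'.1
            · obtain ⟨α, -, rfl⟩ := hmem β hβ
              exact (hβm α i).inter ((hE'm' i).diff (hEm i))
        _ ≤ μ (symmDiff (E' i) (E i)) := by
            refine measure_mono (iUnion₂_subset fun β _ x hx => Or.inl hx.2)
        _ ≤ κ * (ε / 2) := (hE'lt i).le
    calc μ {x ∈ E i | ∃ α ∈ 𝒲.powerset, x ∈ cylinderCell 𝒲 α (e i) ∧ x ∉ D α i}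
        ≤ μ (symmDiff (E' i) (E i) ∪ (⋃ β ∈ ℬ, B β) ∪ Z) := by
          refine measure_mono fun x hx => ?_
          obtain ⟨hxE, α, hα, hxα, hxD⟩ := hx
          by_cases hxE' : x ∈ E' i
          · by_cases hxu : u i (cylinderCell 𝒲 α (e i)) x ≤ κ * w i (cylinderCell 𝒲 α (e i)) x
            · refine Or.inr (mem_iUnion₂.2 ⟨α, hα, ?_⟩)
              have : ∃ f, f.card = c ∧ f ⊆ e i ∧ g α f x = 0 := by
                by_contra! hcon
                exact hxD ⟨hxu, hcon⟩
              obtain ⟨f, hf, hfe, hf0⟩ := this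
              refine mem_iUnion.2 ⟨f, ?_, hf0⟩
              rw [cylinderCell_eq (fun p hp => (h𝒲 p hp).1)] at hxα
              exact hxα f hf hfe
            · refine Or.inl (Or.inr (mem_iUnion₂.2 ⟨_, Finset.mem_image_of_mem _ hα, ?_⟩))
              exact ⟨⟨hxα, hxE'⟩, hxu⟩
          · exact Or.inl (Or.inl (Or.inr ⟨hxE, hxE'⟩))
      _ ≤ μ (symmDiff (E' i) (E i)) + μ (⋃ β ∈ ℬ, B β) + μ Z :=
          (measure_union_le _ _).trans (by gcongr; exact measure_union_le _ _)
      _ ≤ ε / 2 + ε / 2 + 0 := by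
          rw [hZ0]
          gcongr
          calc μ (symmDiff (E' i) (E i)) ≤ κ * (ε / 2) := (hE'lt i).le
            _ ≤ 1 * (ε / 2) := by gcongr
            _ = ε / 2 := one_mul _
      _ = ε := by rw [add_zero, ENNReal.add_halves]

/-- If finitely many sets, each depending on the coordinates in `e i`, have null intersection, then
they may be slightly shrunk within the algebras `A (e i)`, in a loose sense, to have empty
intersection. -/
theorem exists_removal [DecidableEq J] [Fintype J] [Fintype ι] [IsProbabilityMeasure μ]
    (hA : IsCylinderSystem μ A) (c : ℕ) {e : ι → Finset J} {E : ι → Set Ω}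
    (hE : ∀ i, MeasurableSet[cylinderSigma A {h | h.card < c ∧ h ⊆ e i}] (E i))
    (hE0 : μ (⋂ i, E i) = 0) {ε : ℝ≥0∞} (hε : ε ≠ 0) :
    ∃ F : ι → Set Ω, (∀ i, F i ∈ A (e i)) ∧ (∀ i, μ (E i \ F i) ≤ ε) ∧ ⋂ i, F i = ∅ := by
  classical
  induction c generalizing E ε with
  | zero =>
    have hbot : ∀ i, cylinderSigma A {h | h.card < 0 ∧ h ⊆ e i} = ⊥ := fun i =>
      le_antisymm (MeasurableSpace.generateFrom_le fun s ⟨h, hh, _⟩ =>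
        absurd hh.1 (Nat.not_lt_zero _)) bot_le
    have hE' : ∀ i, E i = ∅ ∨ E i = univ := fun i =>
      MeasurableSpace.measurableSet_bot_iff.1 (hbot i ▸ hE i)
    refine ⟨E, fun i => ?_, fun i => by simp, ?_⟩
    · rcases hE' i with h | h <;> rw [h]
      · exact (hA.isSetAlgebra _).empty_mem
      · exact (hA.isSetAlgebra _).univ_mem
    · have : ∃ i, E i = ∅ := by
        by_contra! hcon
        have huniv : ∀ i, E i = univ := fun i => (hE' i).resolve_left (hcon i).ne_empty
        simp [huniv] at hE0
      obtain ⟨i, hi⟩ := this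
      exact subset_eq_empty (iInter_subset E i) hi
  | succ c ih =>
    have hε2 : ε / 2 ≠ 0 := by simp [hε]
    obtain ⟨𝒲, D, h𝒲, hD, hD0, hle⟩ := hA.exists_reduction hE hE0 hε2
    have hcard : ((𝒲.powerset.card : ℕ) : ℝ≥0∞) ≠ 0 := by simp
    choose F hFA hFle hF using fun α => ih (hD α) (hD0 α)
      (ε := ε / 2 / 𝒲.powerset.card) (by simp [hε])
    refine ⟨fun i => ⋂ α ∈ 𝒲.powerset, (cylinderCell 𝒲 α (e i))ᶜ ∪ F α i, fun i => ?_,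
      fun i => ?_, ?_⟩
    · exact (hA.isSetAlgebra _).biInter_mem _ fun α _ => (hA.isSetAlgebra _).union_mem
        ((hA.isSetAlgebra _).compl_mem (hA.cylinderCell_mem h𝒲 α (e i))) (hFA α i)
    · calc _ ≤ μ ({x ∈ E i | ∃ α ∈ 𝒲.powerset, x ∈ cylinderCell 𝒲 α (e i) ∧ x ∉ D α i} ∪
              ⋃ α ∈ 𝒲.powerset, D α i \ F α i) := by
            refine measure_mono fun x hx => ?_
            have : ∃ α ∈ 𝒲.powerset, x ∈ cylinderCell 𝒲 α (e i) ∧ x ∉ F α i := by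
              by_contra! hcon
              refine hx.2 (mem_iInter₂.2 fun α hα => ?_)
              by_cases h : x ∈ cylinderCell 𝒲 α (e i)
              · exact Or.inr (hcon α hα h)
              · exact Or.inl h
            obtain ⟨α, hα, h1, h2⟩ := this
            by_cases h3 : x ∈ D α i
            · exact Or.inr (mem_iUnion₂.2 ⟨α, hα, h3, h2⟩)
            · exact Or.inl ⟨hx.1, α, hα, h1, h3⟩
        _ ≤ ε / 2 + ∑ α ∈ 𝒲.powerset, ε / 2 / 𝒲.powerset.card := by
            refine (measure_union_le _ _).trans (add_le_add (hle i) ?_)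
            exact (measure_biUnion_finset_le _ _).trans (Finset.sum_le_sum fun α _ => hFle α i)
        _ = ε := by
            rw [Finset.sum_const, nsmul_eq_mul, ENNReal.mul_div_cancel hcard (by simp),
              ENNReal.add_halves]
    · refine eq_empty_of_forall_notMem fun x hx => ?_
      set α := 𝒲.filter fun p => x ∈ p.2 with hα
      have hxα : ∀ i, x ∈ cylinderCell 𝒲 α (e i) := fun i p hp _ => by simp [hα, hp]
      have : x ∈ ⋂ i, F α i := mem_iInter.2 fun i =>
        (mem_iInter₂.1 (mem_iInter.1 hx i) α
          (Finset.mem_powerset.2 (Finset.filter_subset _ _))).resolve_left fun h => h (hxα i)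
      rw [hF α] at this
      exact this

end IsCylinderSystem

open Filter Topology BigOperators

section Internal

variable {W : ℕ → Type*} (U : Ultrafilter ℕ)

/-- The set of sequences lying in `F n` for almost all `n`. -/
def internalSet (F : ∀ n, Set (W n)) : Set (∀ n, W n) :=
  {x | ∀ᶠ n in U, x n ∈ F n}

theorem internalSet_compl (F : ∀ n, Set (W n)) :
    (internalSet U F)ᶜ = internalSet U fun n => (F n)ᶜ := by
  ext x
  exact Ultrafilter.eventually_not.symm

theorem internalSet_inter (F G : ∀ n, Set (W n)) :
    internalSet U F ∩ internalSet U G = internalSet U fun n => F n ∩ G n := by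
  ext x
  exact eventually_and.symm

theorem internalSet_union (F G : ∀ n, Set (W n)) :
    internalSet U F ∪ internalSet U G = internalSet U fun n => F n ∪ G n := by
  ext x
  exact Ultrafilter.eventually_or.symm

theorem internalSet_sdiff (F G : ∀ n, Set (W n)) :
    internalSet U F \ internalSet U G = internalSet U fun n => F n \ G n := by
  rw [sdiff_eq, internalSet_compl, internalSet_inter]
  rfl

theorem internalSet_iInter {ι : Type*} [Finite ι] (F : ι → ∀ n, Set (W n)) :
    ⋂ i, internalSet U (F i) = internalSet U fun n => ⋂ i, F i n := by
  ext x
  simp [internalSet, eventually_all]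

theorem internalSet_empty : internalSet U (fun n => (∅ : Set (W n))) = ∅ :=
  eq_empty_of_forall_notMem fun _ hx => (Eventually.exists hx).elim fun _ h => h

theorem internalSet_univ : internalSet U (fun n => (univ : Set (W n))) = univ :=
  eq_univ_of_forall fun _ => Eventually.of_forall fun _ => mem_univ _

theorem internalSet_congr {F G : ∀ n, Set (W n)} (h : ∀ᶠ n in U, F n = G n) :
    internalSet U F = internalSet U G := by
  ext x
  exact eventually_congr (h.mono fun n hn => by rw [hn])

/-- The σ-algebra generated by the internal sets. -/
abbrev internalSigma (W : ℕ → Type*) (U : Ultrafilter ℕ) : MeasurableSpace (∀ n, W n) :=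
  MeasurableSpace.generateFrom (range (internalSet (W := W) U))

theorem isSetAlgebra_range_internalSet :
    IsSetAlgebra (range (internalSet (W := W) U)) where
  empty_mem := ⟨_, internalSet_empty U⟩
  compl_mem := by rintro _ ⟨F, rfl⟩; exact ⟨_, (internalSet_compl U F).symm⟩
  union_mem := by rintro _ _ ⟨F, rfl⟩ ⟨G, rfl⟩; exact ⟨_, (internalSet_union U F G).symm⟩

variable [∀ n, Nonempty (W n)]

theorem internalSet_eq_empty_iff {F : ∀ n, Set (W n)} :
    internalSet U F = ∅ ↔ ∀ᶠ n in U, F n = ∅ := by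
  classical
  refine ⟨fun h => ?_, fun h => (internalSet_congr U h).trans (internalSet_empty U)⟩
  by_contra hcon
  have hcon := Ultrafilter.eventually_not.2 hcon
  have : ∀ n, ∃ x, F n ≠ ∅ → x ∈ F n := fun n => by
    by_cases hn : F n = ∅
    · exact ⟨Classical.arbitrary _, fun h => absurd hn h⟩
    · obtain ⟨x, hx⟩ := nonempty_iff_ne_empty.2 hn
      exact ⟨x, fun _ => hx⟩
  choose x hx using this
  exact eq_empty_iff_forall_notMem.1 h x (hcon.mono fun n hn => hx n hn)

theorem internalSet_eq_iff {F G : ∀ n, Set (W n)} :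
    internalSet U F = internalSet U G ↔ ∀ᶠ n in U, F n = G n := by
  refine ⟨fun h => ?_, internalSet_congr U⟩
  have h1 : internalSet U (fun n => F n \ G n) = ∅ := by rw [← internalSet_sdiff, h, Set.sdiff_self]
  have h2 : internalSet U (fun n => G n \ F n) = ∅ := by rw [← internalSet_sdiff, h, Set.sdiff_self]
  filter_upwards [(internalSet_eq_empty_iff U).1 h1, (internalSet_eq_empty_iff U).1 h2]
    with n hFG hGF
  exact (sdiff_eq_empty.1 hFG).antisymm (sdiff_eq_empty.1 hGF)

/-- Countable saturation: a decreasing sequence of nonempty internal sets has a common point. -/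
theorem exists_internalSet_eq_empty (hU : (U : Filter ℕ) ≤ atTop) {D : ℕ → ∀ n, Set (W n)}
    (hD : Antitone fun k => internalSet U (D k)) (h : ⋂ k, internalSet U (D k) = ∅) :
    ∃ k, internalSet U (D k) = ∅ := by
  by_contra! hcon
  set D' : ℕ → ∀ n, Set (W n) := fun k n => ⋂ j ≤ k, D j n with hD'
  have hanti : ∀ n {k l}, k ≤ l → D' l n ⊆ D' k n := fun n k l hkl x hx =>
    mem_iInter₂.2 fun j hj => mem_iInter₂.1 hx j (hj.trans hkl)
  have hne : ∀ k, ∀ᶠ n in U, (D' k n).Nonempty := fun k => by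
    obtain ⟨x, hx⟩ := hcon k
    have : ∀ᶠ n in U, ∀ j ∈ Finset.Iic k, x n ∈ D j n :=
      (Finset.eventually_all _).2 fun j hj => hD (Finset.mem_Iic.1 hj) hx
    exact this.mono fun n hn => ⟨x n, mem_iInter₂.2 fun j hj => hn j (Finset.mem_Iic.2 hj)⟩
  have hx : ∀ n M : ℕ, ∃ x, ∀ k ≤ M, (D' k n).Nonempty → x ∈ D' k n := fun n M => by
    induction M with
    | zero =>
      by_cases h0 : (D' 0 n).Nonempty
      · obtain ⟨x, hx⟩ := h0
        refine ⟨x, fun k hk _ => ?_⟩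
        rwa [Nat.le_zero.1 hk]
      · refine ⟨Classical.arbitrary _, fun k hk hk' => absurd hk' ?_⟩
        rwa [Nat.le_zero.1 hk]
    | succ M ih =>
      by_cases h0 : (D' (M + 1) n).Nonempty
      · obtain ⟨x, hx⟩ := h0
        exact ⟨x, fun k hk _ => hanti n hk hx⟩
      · obtain ⟨x, hx⟩ := ih
        refine ⟨x, fun k hk hk' => ?_⟩
        rcases Nat.le_succ_iff.1 hk with hk | rfl
        · exact hx k hk hk'
        · exact absurd hk' h0
  choose x hx using fun n => hx n n
  refine eq_empty_iff_forall_notMem.1 h x (mem_iInter.2 fun k => ?_)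
  filter_upwards [hne k, hU (eventually_ge_atTop k)] with n hn hkn
  exact mem_iInter₂.1 (hx n k hkn hn) k le_rfl

variable [∀ n, Fintype (W n)]

theorem expect_indicator_one_mem_Icc {α : Type*} [Fintype α] [Nonempty α] (F : Set α) :
    𝔼 x, F.indicator (1 : α → ℝ) x ∈ Icc (0 : ℝ) 1 := by
  refine ⟨Finset.expect_nonneg fun x _ => ?_, Finset.expect_le Finset.univ_nonempty fun x _ => ?_⟩
  · exact indicator_nonneg (fun _ _ => zero_le_one) x
  · exact indicator_le_self' (fun _ _ => zero_le_one) x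

/-- The Loeb measure on an ultraproduct of finite uniform probability spaces. -/
theorem exists_loebMeasure (hU : (U : Filter ℕ) ≤ atTop) :
    ∃ μ : @Measure (∀ n, W n) (internalSigma W U), IsProbabilityMeasure μ ∧
      ∀ F, Tendsto (fun n => 𝔼 x, (F n).indicator (1 : W n → ℝ) x) U
        (𝓝 (μ.real (internalSet U F))) := by
  classical
  have hlim : ∀ F : ∀ n, Set (W n), ∃ l ∈ Icc (0 : ℝ) 1,
      Tendsto (fun n => 𝔼 x, (F n).indicator (1 : W n → ℝ) x) U (𝓝 l) := fun F =>
    (isCompact_Icc (a := (0 : ℝ)) (b := 1)).ultrafilter_le_nhds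
      (U.map fun n => 𝔼 x, (F n).indicator (1 : W n → ℝ) x)
      (tendsto_principal.2 (Eventually.of_forall fun n => expect_indicator_one_mem_Icc (F n)))
  choose l hl01 hl using hlim
  have huniq : ∀ F G, internalSet U F = internalSet U G → l F = l G := fun F G h =>
    tendsto_nhds_unique ((hl F).congr' (((internalSet_eq_iff U).1 h).mono fun n hn => by
      simp only [hn])) (hl G)
  set m : Set (∀ n, W n) → ℝ≥0∞ := fun s =>
    if h : ∃ F, internalSet U F = s then ENNReal.ofReal (l h.choose) else 0 with hm
  have hmF : ∀ F, m (internalSet U F) = ENNReal.ofReal (l F) := fun F => by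
    have h : ∃ G, internalSet U G = internalSet U F := ⟨F, rfl⟩
    simp only [hm]
    rw [dif_pos h, huniq _ _ h.choose_spec]
  have hl0 : l (fun n => ∅) = 0 := tendsto_nhds_unique (hl _) (by simp)
  have hm0 : m ∅ = 0 := by
    rw [← internalSet_empty (W := W) U, hmF, hl0, ENNReal.ofReal_zero]
  have halg := isSetAlgebra_range_internalSet (W := W) U
  have hring := halg.isSetRing
  have hmadd : ∀ {s t : Set (∀ n, W n)}, s ∈ range (internalSet (W := W) U) →
      t ∈ range (internalSet (W := W) U) → Disjoint s t → m (s ∪ t) = m s + m t := by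
    rintro _ _ ⟨F, rfl⟩ ⟨G, rfl⟩ hdisj
    rw [internalSet_union, hmF, hmF, hmF, ← ENNReal.ofReal_add (hl01 F).1 (hl01 G).1]
    congr 1
    refine tendsto_nhds_unique (hl _) (((hl F).add (hl G)).congr' ?_)
    rw [disjoint_iff_inter_eq_empty, internalSet_inter, internalSet_eq_empty_iff] at hdisj
    filter_upwards [hdisj] with n hn
    rw [← Finset.expect_add_distrib]
    refine Finset.expect_congr rfl fun x _ => ?_
    rw [indicator_union_of_disjoint (disjoint_iff_inter_eq_empty.2 hn)]
  set M : AddContent ℝ≥0∞ (range (internalSet (W := W) U)) :=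
    hring.addContent_of_union m hm0 hmadd with hM
  have hMm : ∀ s, M s = m s := fun s => rfl
  have hsub : M.IsSigmaSubadditive := by
    refine isSigmaSubadditive_of_addContent_iUnion_eq_tsum hring fun f hf hUf hdisj => ?_
    refine addContent_iUnion_eq_sum_of_tendsto_zero hring M ?_ ?_ hf hUf hdisj
    · rintro _ ⟨F, rfl⟩
      rw [hMm, hmF]
      exact ENNReal.ofReal_ne_top
    · intro s hs hanti hempty
      choose D hD using hs
      obtain rfl : s = fun k => internalSet U (D k) := funext fun k => (hD k).symm
      obtain ⟨k, hk⟩ := exists_internalSet_eq_empty U hU hanti hempty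
      refine tendsto_const_nhds.congr' ((eventually_ge_atTop k).mono fun j hj => ?_)
      have hj0 : internalSet U (D j) = ∅ := subset_eq_empty (hanti hj) hk
      change 0 = m (internalSet U (D j))
      rw [hj0, hm0]
  let _ : MeasurableSpace (∀ n, W n) := internalSigma W U
  set μ := M.measure hring.isSetSemiring le_rfl hsub with hμ
  have hμF : ∀ F, μ (internalSet U F) = ENNReal.ofReal (l F) := fun F => by
    rw [hμ, M.measure_eq hring.isSetSemiring rfl hsub ⟨F, rfl⟩, hMm, hmF]
  refine ⟨μ, ⟨?_⟩, fun F => ?_⟩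
  · rw [← internalSet_univ (W := W) U, hμF]
    have : l (fun n => univ) = 1 := tendsto_nhds_unique (hl _) (by simp)
    rw [this, ENNReal.ofReal_one]
  · rw [measureReal_def, hμF, ENNReal.toReal_ofReal (hl01 F).1]
    exact hl F

end Internal

section Cylinder

/-- The set `F` is determined by the coordinates in `e`. -/
def IsCylinderOn {J : Type*} {V : J → Type*} (e : Finset J) (F : Set (∀ j, V j)) : Prop :=
  ∀ ⦃x y : ∀ j, V j⦄, (∀ j ∈ e, x j = y j) → x ∈ F → y ∈ F

theorem exists_expect_mul_le_expect_mul_piecewise {J : Type*} [DecidableEq J] {V : J → Type*}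
    [Fintype (∀ j, V j)] [Nonempty (∀ j, V j)] {e : Finset J} {ψ : (∀ j, V j) → ℝ}
    (hψ : ∀ x y, (∀ j ∈ e, x j = y j) → ψ x = ψ y) (θ : (∀ j, V j) → ℝ) :
    ∃ y, 𝔼 x, ψ x * θ x ≤ 𝔼 x, ψ x * θ (e.piecewise x y) := by
  have hpw : ∀ x y : ∀ j, V j, e.piecewise (e.piecewise x y) (e.piecewise y x) = x := fun x y => by
    ext j
    by_cases hj : j ∈ e <;> simp [hj]
  have h : 𝔼 x, ψ x * θ x ≤ 𝔼 y, 𝔼 x, ψ x * θ (e.piecewise x y) := by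
    refine le_of_eq ?_
    calc 𝔼 x, ψ x * θ x = 𝔼 y : ∀ j, V j, 𝔼 x, ψ x * θ x := (Fintype.expect_const _).symm
      _ = 𝔼 p : (∀ j, V j) × (∀ j, V j), ψ p.2 * θ p.2 :=
          (Finset.expect_product' Finset.univ Finset.univ fun _ x => ψ x * θ x).symm
      _ = 𝔼 p : (∀ j, V j) × (∀ j, V j), ψ p.2 * θ (e.piecewise p.2 p.1) := by
          refine (Finset.expect_nbij' (fun p => (e.piecewise p.1 p.2, e.piecewise p.2 p.1))
            (fun p => (e.piecewise p.1 p.2, e.piecewise p.2 p.1)) (by simp) (by simp)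
            (fun p _ => by simp [hpw]) (fun p _ => by simp [hpw]) fun p _ => ?_).symm
          simp only
          rw [hψ (e.piecewise p.2 p.1) p.2 fun j hj => by simp [hj]]
      _ = 𝔼 y, 𝔼 x, ψ x * θ (e.piecewise x y) :=
          Finset.expect_product' Finset.univ Finset.univ fun y x => ψ x * θ (e.piecewise x y)
  obtain ⟨y, -, hy⟩ := Finset.exists_le_of_le_expect Finset.univ_nonempty h
  exact ⟨y, hy⟩

variable {J : Type*} {V : ℕ → J → Type*} (U : Ultrafilter ℕ)

/-- The internal sets determined by the coordinates in `e`. -/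
def internalCylinders (V : ℕ → J → Type*) (U : Ultrafilter ℕ) (e : Finset J) :
    Set (Set (∀ n, ∀ j, V n j)) :=
  {s | ∃ F : ∀ n, Set (∀ j, V n j), (∀ n, IsCylinderOn e (F n)) ∧ internalSet U F = s}

theorem isSetAlgebra_internalCylinders (e : Finset J) :
    IsSetAlgebra (internalCylinders V U e) where
  empty_mem := ⟨_, fun _ _ _ _ h => h, internalSet_empty U⟩
  compl_mem := by
    rintro _ ⟨F, hF, rfl⟩
    exact ⟨_, fun n x y h (hx : x ∉ F n) hy => hx (hF n (fun j hj => (h j hj).symm) hy),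
      (internalSet_compl U F).symm⟩
  union_mem := by
    rintro _ _ ⟨F, hF, rfl⟩ ⟨G, hG, rfl⟩
    exact ⟨_, fun n x y h => Or.imp (hF n h) (hG n h), (internalSet_union U F G).symm⟩

theorem internalCylinders_mono {e f : Finset J} (hef : e ⊆ f) :
    internalCylinders V U e ⊆ internalCylinders V U f := by
  rintro _ ⟨F, hF, rfl⟩
  exact ⟨F, fun n x y h => hF n fun j hj => h j (hef hj), rfl⟩

theorem internalCylinders_measurable (e : Finset J) :
    ∀ s ∈ internalCylinders V U e, MeasurableSet[internalSigma (fun n => ∀ j, V n j) U] s := by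
  rintro _ ⟨F, -, rfl⟩
  exact MeasurableSpace.measurableSet_generateFrom ⟨F, rfl⟩

theorem cylinderSigma_internalCylinders_le (𝒦 : Set (Finset J)) :
    cylinderSigma (internalCylinders V U) 𝒦 ≤ internalSigma (fun n => ∀ j, V n j) U :=
  MeasurableSpace.generateFrom_le fun s ⟨h, _, hs⟩ => internalCylinders_measurable U h s hs

/-- A family of internal sets generating the σ-algebra `cylinderSigma _ 𝒦` and closed under
intersections. -/
def internalBoxes (V : ℕ → J → Type*) (U : Ultrafilter ℕ) (𝒦 : Set (Finset J)) :
    Set (Set (∀ n, ∀ j, V n j)) :=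
  {s | ∃ K : Finset J → ∀ n, Set (∀ j, V n j), (∀ h n, IsCylinderOn h (K h n)) ∧
    (∀ h ∉ 𝒦, ∀ n, K h n = univ) ∧ s = internalSet U fun n => ⋂ h, K h n}

theorem isPiSystem_internalBoxes (𝒦 : Set (Finset J)) : IsPiSystem (internalBoxes V U 𝒦) := by
  rintro _ ⟨K, hK, hK', rfl⟩ _ ⟨L, hL, hL', rfl⟩ -
  refine ⟨fun h n => K h n ∩ L h n,
    fun h n x y hxy hx => ⟨hK h n hxy hx.1, hL h n hxy hx.2⟩, fun h hh n => ?_, ?_⟩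
  · simp only [hK' h hh, hL' h hh, univ_inter]
  · rw [internalSet_inter]
    simp_rw [iInter_inter_distrib]

theorem univ_mem_internalBoxes (𝒦 : Set (Finset J)) : univ ∈ internalBoxes V U 𝒦 :=
  ⟨fun _ _ => univ, fun _ _ _ _ _ h => h, fun _ _ _ => rfl, by simp [internalSet_univ]⟩

theorem measurableSet_of_mem_internalBoxes [Finite J] {𝒦 : Set (Finset J)}
    {s : Set (∀ n, ∀ j, V n j)} (hs : s ∈ internalBoxes V U 𝒦) :
    MeasurableSet[cylinderSigma (internalCylinders V U) 𝒦] s := by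
  classical
  obtain ⟨K, hK, hK', rfl⟩ := hs
  rw [← internalSet_iInter]
  refine MeasurableSet.iInter fun h => ?_
  by_cases hh : h ∈ 𝒦
  · exact measurableSet_cylinderSigma hh ⟨K h, hK h, rfl⟩
  · have : K h = fun n => univ := funext fun n => hK' h hh n
    rw [this, internalSet_univ]
    exact @MeasurableSet.univ _ (_)

theorem cylinderSigma_eq_generateFrom_internalBoxes [Finite J] (𝒦 : Set (Finset J)) :
    cylinderSigma (internalCylinders V U) 𝒦 =
      MeasurableSpace.generateFrom (internalBoxes V U 𝒦) := by
  classical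
  refine le_antisymm (MeasurableSpace.generateFrom_mono ?_)
    (MeasurableSpace.generateFrom_le fun s hs => measurableSet_of_mem_internalBoxes U hs)
  rintro _ ⟨h, hh, F, hF, rfl⟩
  refine ⟨fun h' n => if h' = h then F n else univ, fun h' n => ?_, fun h' hh' n => ?_, ?_⟩
  · by_cases hh' : h' = h
    · simpa [hh'] using hF n
    · intro x y _ _
      simp [hh']
  · exact if_neg fun h'' : h' = h => hh' (h''.symm ▸ hh)
  · congr 1
    ext n x
    simp

section Measure

variable [∀ n, Fintype (∀ j, V n j)]
  {mΩ : MeasurableSpace (∀ n, ∀ j, V n j)}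
  {μ : Measure (∀ n, ∀ j, V n j)} [IsProbabilityMeasure μ]

/-- A function measurable with respect to the coordinates in `e` is approximated in `L¹` by
functions whose integrals over internal sets are limits of finite averages of functions of the coordinates in
`e`. -/
theorem exists_eLpNorm_sub_le_of_stronglyMeasurable
    (hmΩ : internalSigma (fun n => ∀ j, V n j) U = mΩ)
    (hμ : ∀ F, Tendsto (fun n => 𝔼 x, (F n).indicator (1 : (∀ j, V n j) → ℝ) x) U
        (𝓝 (μ.real (internalSet U F))))
    {e : Finset J} {φ : (∀ n, ∀ j, V n j) → ℝ}
    (hφ : StronglyMeasurable[cylinderSigma (internalCylinders V U) {e}] φ) (hφi : Integrable φ μ)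
    {η : ℝ≥0∞} (hη : η ≠ 0) :
    ∃ f : (∀ n, ∀ j, V n j) → ℝ, eLpNorm (φ - f) 1 μ ≤ η ∧ Integrable f μ ∧
      ∃ ψ : ∀ n, (∀ j, V n j) → ℝ, (∀ n x y, (∀ j ∈ e, x j = y j) → ψ n x = ψ n y) ∧
        ∀ K : ∀ n, Set (∀ j, V n j), Tendsto (fun n => 𝔼 x, ψ n x * (K n).indicator 1 x) U
          (𝓝 (∫ x in internalSet U K, f x ∂μ)) := by
  classical
  have hle : cylinderSigma (internalCylinders V U) {e} ≤ mΩ :=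
    hmΩ ▸ cylinderSigma_internalCylinders_le U _
  have halg := isSetAlgebra_internalCylinders (V := V) U e
  have hgen : cylinderSigma (internalCylinders V U) {e} =
      MeasurableSpace.generateFrom (internalCylinders V U e) := by
    rw [cylinderSigma]
    congr 1
    ext s
    simp
  let P : ((∀ n, ∀ j, V n j) → ℝ) → Prop := fun f =>
    StronglyMeasurable[cylinderSigma (internalCylinders V U) {e}] f ∧ Integrable f μ ∧
      ∃ ψ : ∀ n, (∀ j, V n j) → ℝ, (∀ n x y, (∀ j ∈ e, x j = y j) → ψ n x = ψ n y) ∧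
        ∀ K : ∀ n, Set (∀ j, V n j), Tendsto (fun n => 𝔼 x, ψ n x * (K n).indicator 1 x) U
          (𝓝 (∫ x in internalSet U K, f x ∂μ))
  have h0P : ∀ (c : ℝ) ⦃s : Set (∀ n, ∀ j, V n j)⦄,
      MeasurableSet[cylinderSigma (internalCylinders V U) {e}] s → μ.trim hle s < ⊤ →
        ∀ {ε : ℝ≥0∞}, ε ≠ 0 →
          ∃ g, eLpNorm (g - s.indicator fun _ => c) 1 (μ.trim hle) ≤ ε ∧ P g := by
    intro c s hs _ ε hε
    obtain ⟨ρ, hρ, hρ'⟩ := exists_eLpNorm_indicator_le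
      (m := cylinderSigma (internalCylinders V U) {e}) (p := 1) (μ := μ.trim hle) (by simp) c hε
    obtain ⟨t, ht, hlt⟩ := exists_measure_symmDiff_lt_of_generateFrom_isSetRing
      (mα := cylinderSigma (internalCylinders V U) {e}) (μ := μ.trim hle) halg.isSetRing
      ⟨{univ}, countable_singleton _, singleton_subset_iff.2 halg.univ_mem, by simp⟩ hgen hs
      (ENNReal.coe_pos.2 hρ)
    have htm : MeasurableSet[cylinderSigma (internalCylinders V U) {e}] t :=
      hgen ▸ MeasurableSpace.measurableSet_generateFrom ht
    refine ⟨t.indicator fun _ => c, ?_, stronglyMeasurable_const.indicator htm,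
      (integrable_const c).indicator (hle _ htm), ?_⟩
    · rw [eLpNorm_indicator_sub_indicator]
      exact hρ' _ hlt.le
    · obtain ⟨F, hF, rfl⟩ := ht
      refine ⟨fun n => (F n).indicator fun _ => c, fun n x y hxy => ?_, fun K => ?_⟩
      · have : x ∈ F n ↔ y ∈ F n := ⟨hF n hxy, hF n fun j hj => (hxy j hj).symm⟩
        by_cases hx : x ∈ F n
        · simp [hx, this.1 hx]
        · simp [hx, mt this.2 hx]
      · rw [setIntegral_indicator (hle _ htm), setIntegral_const, smul_eq_mul, mul_comm,
          internalSet_inter]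
        refine ((hμ _).const_mul c).congr fun n => ?_
        rw [Finset.mul_expect]
        refine Finset.expect_congr rfl fun x _ => ?_
        by_cases hx : x ∈ F n <;> by_cases hx' : x ∈ K n <;> simp [hx, hx']
  have h1P : ∀ f g, P f → P g → P (f + g) := by
    rintro f f' ⟨hf, hfi, ψ, hψ, hψK⟩ ⟨hf', hfi', ψ', hψ', hψK'⟩
    refine ⟨hf.add hf', hfi.add hfi', fun n x => ψ n x + ψ' n x, fun n x y h => ?_, fun K => ?_⟩
    · simp only [hψ n x y h, hψ' n x y h]
    · have := (hψK K).add (hψK' K)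
      rw [← integral_add hfi.integrableOn hfi'.integrableOn] at this
      refine this.congr fun n => ?_
      rw [← Finset.expect_add_distrib]
      simp_rw [add_mul]
  obtain ⟨f, hf, hfs, hfi, hfψ⟩ := @MemLp.induction_dense _ _
    (cylinderSigma (internalCylinders V U) {e}) _ 1 (μ.trim hle) (by simp) P h0P h1P
    (fun f hf => hf.1.aestronglyMeasurable) φ (memLp_one_iff_integrable.2 (hφi.trim hle hφ)) _ hη
  refine ⟨f, ?_, hfi, hfψ⟩
  rwa [eLpNorm_trim hle (hφ.sub hfs)] at hf

theorem setIntegral_sub_le_of_eLpNorm_le {Ω : Type*} {mΩ : MeasurableSpace Ω} {μ : Measure Ω}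
    {φ f : Ω → ℝ} (hφ : Integrable φ μ) (hf : Integrable f μ) {η : ℝ} (hη : 0 ≤ η)
    (h : eLpNorm (φ - f) 1 μ ≤ ENNReal.ofReal η) (s : Set Ω) :
    |∫ x in s, φ x ∂μ - ∫ x in s, f x ∂μ| ≤ η := by
  rw [← integral_sub hφ.integrableOn hf.integrableOn]
  have h1 : ‖∫ x in s, (φ - f) x ∂μ‖ₑ ≤ ENNReal.ofReal η := by
    refine (enorm_integral_le_lintegral_enorm _).trans ((setLIntegral_le_lintegral _ _).trans ?_)
    rwa [← eLpNorm_one_eq_lintegral_enorm]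
  rw [← ofReal_norm, ENNReal.ofReal_le_ofReal_iff hη] at h1
  simpa using h1

/-- If `φ` depends on the coordinates in `e` only and has zero integral over the sets
generated by cylinders in subsets of `e` lying in `𝒦`, then it has nonpositive integral over all boxes of type `𝒦`. -/
theorem setIntegral_internalBoxes_nonpos [DecidableEq J] [Finite J] [∀ n, Nonempty (∀ j, V n j)]
    (hmΩ : internalSigma (fun n => ∀ j, V n j) U = mΩ)
    (hμ : ∀ F, Tendsto (fun n => 𝔼 x, (F n).indicator (1 : (∀ j, V n j) → ℝ) x) U
        (𝓝 (μ.real (internalSet U F))))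
    {e : Finset J} {𝒦 : Set (Finset J)} (h𝒦 : IsLowerSet 𝒦) {φ : (∀ n, ∀ j, V n j) → ℝ}
    (hφ : StronglyMeasurable[cylinderSigma (internalCylinders V U) {e}] φ) (hφi : Integrable φ μ)
    (hφ0 : ∀ L, MeasurableSet[cylinderSigma (internalCylinders V U) {h ∈ 𝒦 | h ⊆ e}] L →
      ∫ x in L, φ x ∂μ = 0)
    {s : Set (∀ n, ∀ j, V n j)} (hs : s ∈ internalBoxes V U 𝒦) : ∫ x in s, φ x ∂μ ≤ 0 := by
  obtain ⟨K, hK, hK', rfl⟩ := hs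
  refine le_of_forall_pos_le_add fun η hη => ?_
  obtain ⟨f, hf, hfi, ψ, hψ, hψK⟩ := exists_eLpNorm_sub_le_of_stronglyMeasurable U hmΩ hμ hφ hφi
    (η := ENNReal.ofReal (η / 2)) (by simpa using hη)
  have habs := setIntegral_sub_le_of_eLpNorm_le hφi hfi (half_pos hη).le hf
  choose y hy using fun n => exists_expect_mul_le_expect_mul_piecewise (hψ n)
    ((⋂ h, K h n).indicator 1)
  set K' : Finset J → ∀ n, Set (∀ j, V n j) := fun h n => {x | e.piecewise x (y n) ∈ K h n}
  have hlim : ∫ x in internalSet U (fun n => ⋂ h, K h n), f x ∂μ ≤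
      ∫ x in internalSet U (fun n => ⋂ h, K' h n), f x ∂μ := by
    refine le_of_tendsto_of_tendsto' (hψK _) (hψK _) fun n => (hy n).trans_eq ?_
    refine Finset.expect_congr rfl fun x _ => ?_
    congr 1
    by_cases hx : e.piecewise x (y n) ∈ ⋂ h, K h n
    · rw [indicator_of_mem hx, indicator_of_mem (by simpa [K'] using hx)]
      rfl
    · rw [indicator_of_notMem hx, indicator_of_notMem (by simpa [K'] using hx)]
  have hmeas : MeasurableSet[cylinderSigma (internalCylinders V U) {h ∈ 𝒦 | h ⊆ e}]
      (internalSet U fun n => ⋂ h, K' h n) := by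
    rw [← internalSet_iInter]
    refine MeasurableSet.iInter fun h => ?_
    by_cases hh : h ∈ 𝒦
    · refine measurableSet_cylinderSigma (h := h ∩ e) (𝒦 := {h ∈ 𝒦 | h ⊆ e})
        ⟨h𝒦 Finset.inter_subset_left hh, Finset.inter_subset_right⟩
        ⟨K' h, fun n x x' hxx' hx => ?_, rfl⟩
      refine hK h n (fun j hj => ?_) hx
      by_cases hje : j ∈ e
      · simp [hje, hxx' j (Finset.mem_inter.2 ⟨hj, hje⟩)]
      · simp [hje]
    · have : K' h = fun n => univ := funext fun n => by simp [K', hK' h hh n]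
      rw [this, internalSet_univ]
      exact @MeasurableSet.univ _ (_)
  have h1 := (abs_le.1 (habs (internalSet U fun n => ⋂ h, K h n))).2
  have h2 := (abs_le.1 (habs (internalSet U fun n => ⋂ h, K' h n))).1
  rw [hφ0 _ hmeas] at h2
  linarith

theorem isCylinderSystem_internalCylinders [DecidableEq J] [Finite J]
    [∀ n, Nonempty (∀ j, V n j)]
    (hmΩ : internalSigma (fun n => ∀ j, V n j) U = mΩ)
    (hμ : ∀ F, Tendsto (fun n => 𝔼 x, (F n).indicator (1 : (∀ j, V n j) → ℝ) x) U
        (𝓝 (μ.real (internalSet U F)))) :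
    IsCylinderSystem μ (internalCylinders V U) where
  isSetAlgebra := isSetAlgebra_internalCylinders U
  mono _ _ h := internalCylinders_mono U h
  measurableSet _ _ h := hmΩ ▸ internalCylinders_measurable U _ _ h
  isCondDensity := by
    intro e 𝒦 h𝒦 W hW g hg
    have hle : ∀ 𝒦, cylinderSigma (internalCylinders V U) 𝒦 ≤ mΩ := fun 𝒦 =>
      hmΩ ▸ cylinderSigma_internalCylinders_le (V := V) U 𝒦
    have hsub : cylinderSigma (internalCylinders V U) {h ∈ 𝒦 | h ⊆ e} ≤
        cylinderSigma (internalCylinders V U) {e} :=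
      MeasurableSpace.generateFrom_mono fun _ ⟨f, hf, hs⟩ =>
        ⟨e, rfl, internalCylinders_mono U hf.2 hs⟩
    have hgm : Measurable g := hg.measurable.mono (hle _) le_rfl
    have hWm : MeasurableSet W := hle _ _ hW
    have hgW : ∫⁻ x, g x ∂μ = μ W := by
      simpa using (hg.measure_inter univ MeasurableSet.univ).symm
    have hgfin : ∫⁻ x, g x ∂μ ≠ ⊤ := hgW ▸ measure_ne_top μ W
    have hglt : ∀ᵐ x ∂μ, g x < ⊤ := ae_lt_top hgm hgfin
    have hgint : Integrable (fun x => (g x).toReal) μ :=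
      integrable_toReal_of_lintegral_ne_top hgm.aemeasurable hgfin
    set φ : (∀ n, ∀ j, V n j) → ℝ := fun x => W.indicator 1 x - (g x).toReal with hφ
    have hφm : StronglyMeasurable[cylinderSigma (internalCylinders V U) {e}] φ := by
      refine Measurable.stronglyMeasurable (Measurable.sub 
        ((@measurable_one _ _ _ (_) _).indicator hW) ?_)
      exact (hg.measurable.mono hsub le_rfl).ennreal_toReal
    have hWint : Integrable (W.indicator (1 : (∀ n, ∀ j, V n j) → ℝ)) μ :=
      (integrable_const (1 : ℝ)).indicator hWm
    have hφi : Integrable φ μ := hWint.sub hgint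
    have hφint : ∀ s, ∫ x in s, φ x ∂μ = μ.real (W ∩ s) - (∫⁻ x in s, g x ∂μ).toReal := fun s => by
      rw [integral_sub hWint.integrableOn hgint.integrableOn,
        integral_toReal hgm.aemeasurable (ae_restrict_of_ae hglt), integral_indicator_one hWm,
        measureReal_restrict_apply hWm]
    have hφ0 : ∀ L, MeasurableSet[cylinderSigma (internalCylinders V U) {h ∈ 𝒦 | h ⊆ e}] L →
        ∫ x in L, φ x ∂μ = 0 := fun L hL => by
      rw [hφint, ← hg.measure_inter L hL, measureReal_def, sub_self]
    have hbox : ∀ s ∈ internalBoxes V U 𝒦, μ (W ∩ s) = ∫⁻ x in s, g x ∂μ := by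
      intro s hs
      have h1 := setIntegral_internalBoxes_nonpos U hmΩ hμ h𝒦 hφm hφi hφ0 hs
      have h2 := setIntegral_internalBoxes_nonpos U hmΩ hμ h𝒦 hφm.neg hφi.neg
        (fun L hL => by simp [integral_neg, hφ0 L hL]) hs
      simp only [Pi.neg_apply, integral_neg, neg_nonpos] at h2
      have h3 := le_antisymm h1 h2
      rw [hφint, sub_eq_zero, measureReal_def, ENNReal.toReal_eq_toReal_iff'
        (measure_ne_top μ _)] at h3
      · exact h3
      · exact ((setLIntegral_le_lintegral _ _).trans_lt hgfin.lt_top).ne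
    refine ⟨hg.measurable.mono (cylinderSigma_mono _ fun h hh => hh.1) le_rfl, fun L hL => ?_⟩
    have hboxm : ∀ L, MeasurableSet[cylinderSigma (internalCylinders V U) 𝒦] L →
        ((μ.restrict W).trim (hle 𝒦)) L = μ (W ∩ L) ∧
          ((μ.withDensity g).trim (hle 𝒦)) L = ∫⁻ x in L, g x ∂μ := fun L hL => by
      rw [trim_measurableSet_eq _ hL, trim_measurableSet_eq _ hL,
        Measure.restrict_apply (hle _ _ hL), withDensity_apply _ (hle _ _ hL), inter_comm]
      exact ⟨rfl, rfl⟩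
    have hext : (μ.restrict W).trim (hle 𝒦) = (μ.withDensity g).trim (hle 𝒦) := by
      have hall : ∀ s ∈ internalBoxes V U 𝒦,
          (μ.restrict W).trim (hle 𝒦) s = (μ.withDensity g).trim (hle 𝒦) s := fun s hs => by
        obtain ⟨h1, h2⟩ := hboxm s (measurableSet_of_mem_internalBoxes U hs)
        rw [h1, h2, hbox s hs]
      exact ext_of_generate_finite _ (cylinderSigma_eq_generateFrom_internalBoxes U 𝒦)
        (isPiSystem_internalBoxes U 𝒦) hall (hall _ (univ_mem_internalBoxes U 𝒦))
    rw [← (hboxm L hL).1, ← (hboxm L hL).2, hext]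

end Measure

end Cylinder

section FiniteRemoval

theorem exists_finite_removal {J : Type*} [Fintype J] [DecidableEq J] {ε : ℝ} (hε : 0 < ε) :
    ∃ δ : ℝ, 0 < δ ∧ ∀ (V : J → Type) [∀ j, Fintype (V j)] [∀ j, Nonempty (V j)]
      (E : J → Set (∀ j, V j)), (∀ i, IsCylinderOn {i}ᶜ (E i)) →
      𝔼 x, (⋂ i, E i).indicator (1 : (∀ j, V j) → ℝ) x < δ →
      ∃ F : J → Set (∀ j, V j), (∀ i, IsCylinderOn {i}ᶜ (F i)) ∧
        (∀ i, 𝔼 x, (E i \ F i).indicator (1 : (∀ j, V j) → ℝ) x ≤ ε) ∧ ⋂ i, F i = ∅ := by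
  by_contra! hcon
  choose V i₁ i₂ E hE hδ hF using fun n : ℕ => hcon (1 / (n + 1)) Nat.one_div_pos_of_nat
  let U : Ultrafilter ℕ := hyperfilter ℕ
  have hU : (U : Filter ℕ) ≤ atTop := Nat.hyperfilter_le_atTop
  obtain ⟨μ, hμ1, hμ⟩ := exists_loebMeasure (W := fun n => ∀ j, V n j) U hU
  let _ : MeasurableSpace (∀ n, ∀ j, V n j) := internalSigma (fun n => ∀ j, V n j) U
  have hA : IsCylinderSystem μ (internalCylinders V U) :=
    isCylinderSystem_internalCylinders U rfl hμ
  have hEm : ∀ i, MeasurableSet[cylinderSigma (internalCylinders V U)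
      {h | h.card < Fintype.card J + 1 ∧ h ⊆ {i}ᶜ}] (internalSet U fun n => E n i) := fun i =>
    measurableSet_cylinderSigma (A := internalCylinders V U) (h := {i}ᶜ)
      (𝒦 := {h | h.card < Fintype.card J + 1 ∧ h ⊆ {i}ᶜ})
      ⟨Nat.lt_succ_of_le (Finset.card_le_univ _), subset_rfl⟩
      ⟨fun n => E n i, fun n => hE n i, rfl⟩
  have hE0 : μ (⋂ i, internalSet U fun n => E n i) = 0 := by
    rw [internalSet_iInter, ← measureReal_eq_zero_iff]
    refine tendsto_nhds_unique (hμ _) (squeeze_zero (fun n => ?_) (fun n => (hδ n).le)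
      (tendsto_one_div_add_atTop_nhds_zero_nat.mono_left hU))
    exact (expect_indicator_one_mem_Icc _).1
  obtain ⟨F, hFA, hFμ, hF0⟩ := hA.exists_removal _ hEm hE0
    (ε := ENNReal.ofReal (ε / 2)) (by simpa using hε)
  choose K hK hKF using hFA
  obtain rfl : (fun i => internalSet U (K i)) = F := funext hKF
  simp only [internalSet_iInter, internalSet_eq_empty_iff] at hF0
  have hsmall : ∀ i, ∀ᶠ n in U,
      𝔼 x, (E n i \ K i n).indicator (1 : (∀ j, V n j) → ℝ) x < ε := fun i => by
    refine (hμ fun n => E n i \ K i n).eventually_lt_const ?_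
    rw [← internalSet_sdiff]
    refine (ENNReal.toReal_le_of_le_ofReal (half_pos hε).le (hFμ i)).trans_lt (half_lt_self hε)
  obtain ⟨n, hn, hn'⟩ := ((eventually_all.2 hsmall).and hF0).exists
  exact (hF n (fun i => K i n) (fun i => hK i n) fun i => (hn i).le).ne_empty hn'

end FiniteRemoval

section Arithmetic

open scoped BigOperators

theorem expect_indicator_one {α : Type*} [Fintype α] (s : Set α) :
    𝔼 x, s.indicator (1 : α → ℝ) x = Nat.card s / Nat.card α := by
  classical
  rw [Fintype.expect_eq_sum_div_card, Nat.card_eq_fintype_card, Nat.card_eq_fintype_card,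
    Fintype.card_subtype]
  simp [Set.indicator_apply]

variable {I M : Type*} [Fintype I] [DecidableEq I] [AddCommGroup M] (W : I → AddSubgroup M)

theorem sum_coe_add_single (i : I) (v : ∀ i, W i) (u : W i) :
    ∑ j, ((v + (Pi.single i u : ∀ i, W i)) j : M) = ∑ j, (v j : M) + u := by
  simp only [Pi.add_apply, AddSubgroup.coe_add, Finset.sum_add_distrib]
  congr 1
  rw [Finset.sum_eq_single i]
  · simp
  · intro j _ hj
    simp [hj]
  · simp

theorem isCylinderOn_preimage_sum_coe {i : I} {Q : Set M} (hQ : ∀ x ∈ Q, ∀ u ∈ W i, x + u ∈ Q) :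
    IsCylinderOn {i}ᶜ {v : ∀ i, W i | ∑ j, (v j : M) ∈ Q} := by
  intro v w hvw (hv : _ ∈ Q)
  have hw : w = v + (Pi.single i (w i - v i) : ∀ i, W i) := by
    ext j
    by_cases hj : j = i
    · subst hj
      simp
    · simp [hj, hvw j (by simpa using hj)]
  change ∑ j, (w j : M) ∈ Q
  rw [hw, sum_coe_add_single]
  exact hQ _ hv _ (w i - v i).2

section

variable [∀ i, Fintype (W i)]

theorem expect_eq_expect_expect_add_single (i : I) (f : (∀ i, W i) → ℝ) :
    𝔼 v, f v = 𝔼 v, 𝔼 u : W i, f (v + (Pi.single i u : ∀ i, W i)) := by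
  rw [Finset.expect_comm]
  calc 𝔼 v, f v = 𝔼 _u : W i, 𝔼 v, f v := (Fintype.expect_const _).symm
    _ = _ := Finset.expect_congr rfl fun u _ =>
      (Fintype.expect_equiv (Equiv.addRight (Pi.single i u : ∀ i, W i)) _ _ fun v => rfl).symm

/-- If one of the subgroups is everything, sums of elements of the subgroups are equidistributed. -/
theorem expect_comp_sum_coe [Fintype M] {i : I} (hi : W i = ⊤) (f : M → ℝ) :
    𝔼 v : ∀ i, W i, f (∑ j, (v j : M)) = 𝔼 x, f x := by
  rw [expect_eq_expect_expect_add_single W i]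
  simp_rw [sum_coe_add_single]
  calc _ = 𝔼 _v : ∀ i, W i, 𝔼 x, f x := Finset.expect_congr rfl fun v _ => ?_
    _ = _ := Fintype.expect_const _
  refine Fintype.expect_bijective (fun u : W i => ∑ j, (v j : M) + u)
    ⟨fun u u' h => by simpa using h, fun x => ⟨⟨x - ∑ j, (v j : M), by simp [hi]⟩, by simp⟩⟩ _ _
    fun u => rfl

theorem expect_indicator_mul_indicator {i : I} {R : Set M} {d : ℕ}
    (hR : ∀ x : M, Nat.card {u : W i // x + u ∈ R} = d) {H : Set (∀ i, W i)}
    (hH : IsCylinderOn {i}ᶜ H) :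
    𝔼 v, H.indicator (1 : (∀ i, W i) → ℝ) v * R.indicator 1 (∑ j, (v j : M)) =
      (𝔼 v, H.indicator (1 : (∀ i, W i) → ℝ) v) * (d / Nat.card (W i)) := by
  rw [expect_eq_expect_expect_add_single W i, Finset.expect_mul]
  refine Finset.expect_congr rfl fun v _ => ?_
  simp_rw [sum_coe_add_single]
  have hv : ∀ u : W i, H.indicator (1 : (∀ i, W i) → ℝ) (v + (Pi.single i u : ∀ i, W i)) =
      H.indicator 1 v := by
    intro u
    have : v + Pi.single i u ∈ H ↔ v ∈ H := by
      constructor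
      · exact fun h => hH (fun j hj => by simp_all) h
      · exact fun h => hH (fun j hj => by simp_all) h
    by_cases hvH : v ∈ H
    · rw [indicator_of_mem hvH, indicator_of_mem (this.2 hvH)]
      rfl
    · rw [indicator_of_notMem hvH, indicator_of_notMem (mt this.1 hvH)]
  simp_rw [hv]
  rw [← Finset.mul_expect, ← hR (∑ j, (v j : M))]
  congr 1
  exact expect_indicator_one {u : W i | ∑ j, (v j : M) + u ∈ R}

end

theorem exists_mul_card_le_card_iInter (i₀ : I) {ε : ℝ} (hε : 0 < ε) :
    ∃ δ : ℝ, 0 < δ ∧ ∀ (M : Type) [AddCommGroup M] [Finite M] (W : I → AddSubgroup M),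
      W i₀ = ⊤ → ∀ (R : Set M) (d : I → ℕ),
      (∀ i, ∀ x : M, Nat.card {u : W i // x + u ∈ R} = d i) →
      ∀ Q : I → Set M, (∀ i, ∀ x ∈ Q i, ∀ u ∈ W i, x + u ∈ Q i) →
      ε * Nat.card R < Nat.card ↥(R ∩ ⋂ i, Q i) →
      δ * Nat.card M ≤ Nat.card ↥(⋂ i, Q i) := by
  classical
  have hI : (0 : ℝ) < Fintype.card I := by exact_mod_cast Fintype.card_pos_iff.2 ⟨i₀⟩
  obtain ⟨δ, hδ, h⟩ := exists_finite_removal (J := I) (div_pos hε hI)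
  refine ⟨δ, hδ, fun M _ _ W hW R d hR Q hQ hRQ => ?_⟩
  have := Fintype.ofFinite M
  have hM : (0 : ℝ) < Nat.card M := by exact_mod_cast Nat.card_pos
  by_contra! hcon
  obtain ⟨F, hF, hEF, hF0⟩ := h (fun i => W i) (fun i => {v | ∑ j, (v j : M) ∈ Q i})
    (fun i => isCylinderOn_preimage_sum_coe W (hQ i)) (by
      have := expect_comp_sum_coe W hW ((⋂ i, Q i).indicator 1)
      rw [expect_indicator_one] at this
      rw [← div_lt_iff₀ hM, ← this] at hcon
      refine lt_of_eq_of_lt (Finset.expect_congr rfl fun v _ => ?_) hcon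
      simp [Set.indicator_apply])
  have hden : ∀ i, (d i : ℝ) / Nat.card (W i) = Nat.card R / Nat.card M := by
    intro i
    have h1 := expect_indicator_mul_indicator W (hR i) (H := univ) fun _ _ _ h => h
    simp only [indicator_univ, Pi.one_apply, one_mul, Fintype.expect_const] at h1
    rw [← h1, expect_comp_sum_coe W hW, expect_indicator_one]
  refine hRQ.not_ge ?_
  rw [← div_le_div_iff_of_pos_right hM, mul_div_assoc, ← expect_indicator_one,
    ← expect_comp_sum_coe W hW]
  calc 𝔼 v : ∀ i, W i, (R ∩ ⋂ i, Q i).indicator (1 : M → ℝ) (∑ j, (v j : M))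
      ≤ 𝔼 v : ∀ i, W i, ∑ i, ({v : ∀ i, W i | ∑ j, (v j : M) ∈ Q i} \ F i).indicator
          (1 : (∀ i, W i) → ℝ) v * R.indicator 1 (∑ j, (v j : M)) := by
        refine Finset.expect_le_expect fun v _ => ?_
        have hnn : ∀ i ∈ Finset.univ, 0 ≤ ({v : ∀ i, W i | ∑ j, (v j : M) ∈ Q i} \ F i).indicator
          (1 : (∀ i, W i) → ℝ) v * R.indicator 1 (∑ j, (v j : M)) := fun i _ =>
          mul_nonneg (indicator_nonneg (fun _ _ => zero_le_one) _)
            (indicator_nonneg (fun _ _ => zero_le_one) _)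
        by_cases hv : ∑ j, (v j : M) ∈ R ∩ ⋂ i, Q i
        · obtain ⟨i, hi⟩ : ∃ i, v ∉ F i := by
            by_contra! hv'
            exact notMem_empty v (hF0 ▸ mem_iInter.2 hv')
          refine le_trans ?_ (Finset.single_le_sum hnn (Finset.mem_univ i))
          have hvi : v ∈ {v : ∀ i, W i | ∑ j, (v j : M) ∈ Q i} \ F i := ⟨mem_iInter.1 hv.2 i, hi⟩
          rw [indicator_of_mem hv, indicator_of_mem hv.1, indicator_of_mem hvi]
          simp
        · rw [indicator_of_notMem hv]
          exact Finset.sum_nonneg hnn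
    _ = ∑ i, (𝔼 v : ∀ i, W i, ({v : ∀ i, W i | ∑ j, (v j : M) ∈ Q i} \ F i).indicator
          (1 : (∀ i, W i) → ℝ) v) * (Nat.card R / Nat.card M) := by
        rw [Finset.expect_sum_comm]
        refine Finset.sum_congr rfl fun i _ => ?_
        rw [← hden i]
        refine expect_indicator_mul_indicator W (hR i) fun v w hvw hv => ?_
        exact ⟨isCylinderOn_preimage_sum_coe W (hQ i) hvw hv.1,
          fun hw => hv.2 (hF i (fun j hj => (hvw j hj).symm) hw)⟩
    _ ≤ ∑ _i : I, ε / Fintype.card I * (Nat.card R / Nat.card M) := by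
        gcongr with i
        exact hEF i
    _ = ε * (Nat.card R / Nat.card M) := by
        rw [Finset.sum_const, Finset.card_univ, nsmul_eq_mul]
        field_simp

end Arithmetic

end

theorem counting_solutions_from_fiber_equitable_subset
    (ε : ℝ) (hε : 0 < ε) (m k : ℕ) (hkm : k ≤ m) :
    ∃ δ : ℝ, 0 < δ ∧
      ∀ (G : Type) [AddCommGroup G] [Fintype G]
        (A : (Fin m → G) →+ (Fin k → G))
        (R : Set (Fin m → G)),
        R ⊆ {x : Fin m → G | A x = 0} →
        -- (i) `R` projects onto the projections of the solution set:
        (∀ i : Fin m, (fun x : Fin m → G => x i) '' R =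
          (fun x : Fin m → G => x i) '' {x : Fin m → G | A x = 0}) →
        -- (ii) the fibers of `R` over each coordinate are equinumerous:
        (∀ i : Fin m,
          ∀ g₁ ∈ (fun x : Fin m → G => x i) '' {x : Fin m → G | A x = 0},
          ∀ g₂ ∈ (fun x : Fin m → G => x i) '' {x : Fin m → G | A x = 0},
            Nat.card {x : Fin m → G // x ∈ R ∧ x i = g₁} =
              Nat.card {x : Fin m → G // x ∈ R ∧ x i = g₂}) →
        ∀ X : Set G,
          (Nat.card ↥(Set.univ.pi (fun _ : Fin m => X) ∩ R) : ℝ) >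
              ε * Nat.card ↥R →
            (Nat.card ↥({x : Fin m → G | A x = 0} ∩
                Set.univ.pi (fun _ : Fin m => X)) : ℝ) ≥
              δ * Nat.card {x : Fin m → G | A x = 0} := by
  classical
  obtain ⟨δ, hδ, h⟩ := exists_mul_card_le_card_iInter (none : Option (Fin m)) hε
  refine ⟨δ, hδ, fun G _ _ A R hRS _ hfib X hRX => ?_⟩
  let W : Option (Fin m) → AddSubgroup A.ker := fun o =>
    o.elim ⊤ fun j => ((Pi.evalAddMonoidHom (fun _ => G) j).comp A.ker.subtype).ker
  let Q : Option (Fin m) → Set A.ker := fun o => o.elim Set.univ fun j => {x | x.1 j ∈ X}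
  have hQ : (⋂ o, Q o) = Subtype.val ⁻¹' Set.univ.pi fun _ : Fin m => X := by
    ext x
    simp [Set.mem_iInter, Option.forall, Q, Set.mem_pi]
  have hcard : ∀ T : Set (Fin m → G), Nat.card ↥(Subtype.val ⁻¹' T : Set A.ker) =
      Nat.card ↥({x | A x = 0} ∩ T) := fun T =>
    Nat.card_congr ⟨fun x => ⟨x.1.1, x.1.2, x.2⟩, fun x => ⟨⟨x.1, x.2.1⟩, x.2.2⟩,
      fun _ => rfl, fun _ => rfl⟩
  have key := h A.ker W rfl (Subtype.val ⁻¹' R) (fun o => o.elim (Nat.card R) fun j =>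
    Nat.card {x : Fin m → G // x ∈ R ∧ x j = 0}) ?_ Q ?_ ?_
  · rw [hQ, hcard] at key
    exact key
  · rintro (_ | j) x
    · refine Nat.card_congr ⟨fun u => ⟨(x + u.1.1 : A.ker).1, u.2⟩,
        fun r => ⟨⟨⟨r.1, hRS r.2⟩ - x, trivial⟩, ?_⟩, fun u => ?_, fun r => ?_⟩
      · simp
      · ext; simp
      · ext; simp
    · refine Eq.trans ?_ (hfib j (x.1 j) ⟨x.1, x.2, rfl⟩ 0 ⟨0, map_zero A, rfl⟩)
      refine Nat.card_congr ⟨fun u => ⟨(x + u.1.1 : A.ker).1, u.2, ?_⟩,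
        fun r => ⟨⟨⟨r.1, hRS r.2.1⟩ - x, ?_⟩, ?_⟩, fun u => ?_, fun r => ?_⟩
      · have hu : u.1.1.1 j = 0 := u.1.2
        simp [hu]
      · change r.1 j - x.1 j = 0
        rw [r.2.2, sub_self]
      · simpa using r.2.1
      · ext; simp
      · ext; simp
  · rintro (_ | j) x hx u hu
    · trivial
    · have hu : u.1 j = 0 := hu
      change x.1 j + u.1 j ∈ X
      rwa [hu, add_zero]
  · rw [hQ, ← Set.preimage_inter, hcard, hcard, Set.inter_eq_right.2 hRS, ← Set.inter_assoc,
      Set.inter_eq_right.2 hRS, Set.inter_comm]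
    exact hRX
end
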